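/- Let T > 0 and let v = v(x,t) be a divergence-free, axis symmetric, smooth vector field on Q_{1,4} = C_{1,4,1}×[−T,T]. Then for every q > 1 there exists a constant c(q) > 0, independent of v and T, such that ‖∇v_r‖_{L^q(Q_{2,3})} + ‖v_r/r‖_{L^q(Q_{2,3})} + ‖∇v_z‖_{L^q(Q_{2,3})} ≤ c(q)·( ‖(curl v)_θ‖_{L^q(Q_{1,4})} + ‖v‖_{L^q(Q_{1,4})} ), where Q_{2,3} = C_{2,3,1}×[−T,T]. -/

import Mathlib

open MeasureTheory Real Set
open scoped ENNReal NNReal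

noncomputable section

/-- Points of `ℝ³`. -/
abbrev X3 : Type := Fin 3 → ℝ

/-- Cylindrical radius `r = √(x₁² + x₂²)`. -/
def rad (x : X3) : ℝ := Real.sqrt ((x 0)^2 + (x 1)^2)

/-- Radial unit vector `e_r`. -/
def er (x : X3) : X3 := ![x 0 / rad x, x 1 / rad x, 0]

/-- Angular unit vector `e_θ`. -/
def eθv (x : X3) : X3 := ![-(x 1) / rad x, x 0 / rad x, 0]

/-- Vertical unit vector `e_z`. -/
def ezv : X3 := ![0, 0, 1]

/-- Spatial partial derivative in the `i`-th coordinate direction. -/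
def pd (i : Fin 3) (g : X3 → ℝ) (x : X3) : ℝ := fderiv ℝ g x (Pi.single i 1)

/-- Squared length of the spatial gradient of `g`. -/
def gradSq (g : X3 → ℝ) (x : X3) : ℝ := ∑ i : Fin 3, (pd i g x)^2

/-- Euclidean Laplacian. -/
def lap (g : X3 → ℝ) (x : X3) : ℝ := ∑ i : Fin 3, pd i (pd i g) x

/-- Divergence of a vector field on `ℝ³`. -/
def divg (w : X3 → X3) (x : X3) : ℝ := ∑ i : Fin 3, pd i (fun y => w y i) x

/-- Curl of a vector field on `ℝ³`. -/
def curl3 (w : X3 → X3) (x : X3) : X3 :=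
  ![pd 1 (fun y => w y 2) x - pd 2 (fun y => w y 1) x,
    pd 2 (fun y => w y 0) x - pd 0 (fun y => w y 2) x,
    pd 0 (fun y => w y 1) x - pd 1 (fun y => w y 0) x]

/-- The incompressible Navier-Stokes equations
`Δv − (v·∇)v − ∇p − ∂_t v = 0`, `div v = 0` hold at the space-time point `(x,t)`. -/
def NSat (v : X3 → ℝ → X3) (p : X3 → ℝ → ℝ) (x : X3) (t : ℝ) : Prop :=
  (∀ i : Fin 3,
    lap (fun y => v y t i) x - (∑ j : Fin 3, v x t j * pd j (fun y => v y t i) x)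
      - pd i (fun y => p y t) x - deriv (fun s => v x s i) t = 0)
  ∧ divg (fun y => v y t) x = 0

/-- Cylindrical profile functions: arguments `(r, z, t)`. -/
abbrev Prof : Type := ℝ → ℝ → ℝ → ℝ

/-- `∂_r` of a profile. -/
def pdr (f : Prof) : Prof := fun r z t => deriv (fun u => f u z t) r

/-- `∂_z` of a profile. -/
def pdz (f : Prof) : Prof := fun r z t => deriv (fun u => f r u t) z

/-- `∂_t` of a profile. -/
def pdt (f : Prof) : Prof := fun r z t => deriv (fun u => f r z u) t

/-- `v` is the axis symmetric vector field with cylindrical components `vr, vθ, vz`. -/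
def IsAxisym (v : X3 → ℝ → X3) (vr vθ vz : Prof) : Prop :=
  ∀ (x : X3) (t : ℝ), 0 < rad x →
    ∀ i : Fin 3, v x t i =
      vr (rad x) (x 2) t * er x i + vθ (rad x) (x 2) t * eθv x i + vz (rad x) (x 2) t * ezv i

/-- Radial vorticity component `ω_r = −∂_z v_θ`. -/
def omR (vθ : Prof) : Prof := fun r z t => - pdz vθ r z t

/-- Angular vorticity component `ω_θ = ∂_z v_r − ∂_r v_z`. -/
def omθ (vr vz : Prof) : Prof := fun r z t => pdz vr r z t - pdr vz r z t

/-- Vertical vorticity component `ω_z = ∂_r v_θ + v_θ/r`. -/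
def omZ (vθ : Prof) : Prof := fun r z t => pdr vθ r z t + vθ r z t / r

/-- The hollowed-out cylinder `C_{A,B,R} = {AR ≤ r ≤ BR, |z| ≤ BR}`. -/
def Ccyl (A B R : ℝ) : Set X3 :=
  {x | A * R ≤ rad x ∧ rad x ≤ B * R ∧ |x 2| ≤ B * R}

/-- `C(σ) = C_{5−4σ, 4σ, 1}`. -/
def Cσ (σ : ℝ) : Set X3 := Ccyl (5 - 4*σ) (4*σ) 1

/-- Squared space-time `L²` integral of a scalar `g` over `P_{A,B,R} = C_{A,B,R}×(−R²,0)`. -/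
def stIntSq (g : X3 → ℝ → ℝ) (A B R : ℝ) : ℝ :=
  ∫ t in Ioo (-(R^2)) 0, ∫ x in Ccyl A B R, (g x t)^2

/-- Squared space-time `L²` integral of a vector field over `P_{A,B,R}`. -/
def stIntSqVec (v : X3 → ℝ → X3) (A B R : ℝ) : ℝ :=
  ∫ t in Ioo (-(R^2)) 0, ∫ x in Ccyl A B R, ∑ i : Fin 3, (v x t i)^2

/-- `‖b‖_{L^∞(−R²,0;L²(C_{A,B,R}))}` where `b = v_r e_r + v_z e_z`. -/
def KbNorm (vr vz : Prof) (A B R : ℝ) : ℝ :=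
  sSup ((fun t => (∫ x in Ccyl A B R,
      ((vr (rad x) (x 2) t)^2 + (vz (rad x) (x 2) t)^2)) ^ ((1:ℝ)/2)) '' Ioo (-(R^2)) 0)

/-- `‖r v_θ(·,t₀)‖_{L^∞(ℝ³)}`. -/
def swirlSup (vθ : Prof) (t₀ : ℝ) : ℝ :=
  sSup ((fun x : X3 => |rad x * vθ (rad x) (x 2) t₀|) '' univ)

/-- `r v_θ(·,t₀) ∈ L^∞(ℝ³)`. -/
def swirlBdd (vθ : Prof) (t₀ : ℝ) : Prop :=
  BddAbove ((fun x : X3 => |rad x * vθ (rad x) (x 2) t₀|) '' univ)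

/-- `Λ = ‖v_θ‖_{L^∞(P_{A,B,R})}`. -/
def vθSupP (vθ : Prof) (A B R : ℝ) : ℝ :=
  sSup ((fun q : X3 × ℝ => |vθ (rad q.1) (q.1 2) q.2|) '' (Ccyl A B R ×ˢ Ioo (-(R^2)) 0))

/-- Finiteness of `‖v_θ‖_{L^∞(P_{A,B,R})}`. -/
def vθBddP (vθ : Prof) (A B R : ℝ) : Prop :=
  BddAbove ((fun q : X3 × ℝ => |vθ (rad q.1) (q.1 2) q.2|) '' (Ccyl A B R ×ˢ Ioo (-(R^2)) 0))

/-- Finiteness of `‖b‖_{L^∞(−R²,0;L²(C_{A,B,R}))}`. -/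
def KbBdd (vr vz : Prof) (A B R : ℝ) : Prop :=
  BddAbove ((fun t => (∫ x in Ccyl A B R,
      ((vr (rad x) (x 2) t)^2 + (vz (rad x) (x 2) t)^2)) ^ ((1:ℝ)/2)) '' Ioo (-(R^2)) 0)

/-- The axis symmetric Navier-Stokes system in cylindrical coordinates at `(r,z,t)`. -/
def cylNSat (vr vθ vz p : Prof) (r z t : ℝ) : Prop :=
  (pdr (pdr vr) r z t + (1/r) * pdr vr r z t + pdz (pdz vr) r z t - vr r z t / r^2
     - (vr r z t * pdr vr r z t + vz r z t * pdz vr r z t)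
     + (vθ r z t)^2 / r - pdr p r z t - pdt vr r z t = 0)
  ∧ (pdr (pdr vθ) r z t + (1/r) * pdr vθ r z t + pdz (pdz vθ) r z t - vθ r z t / r^2
     - (vr r z t * pdr vθ r z t + vz r z t * pdz vθ r z t)
     - vθ r z t * vr r z t / r - pdt vθ r z t = 0)
  ∧ (pdr (pdr vz) r z t + (1/r) * pdr vz r z t + pdz (pdz vz) r z t
     - (vr r z t * pdr vz r z t + vz r z t * pdz vz r z t)
     - pdz p r z t - pdt vz r z t = 0)
  ∧ (pdr vr r z t + vr r z t / r + pdz vz r z t = 0)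

/-- Refined cut-off `ψ = φ(y)η(s)` for the pair `(σ₁,σ₂)` with parameter `δ`
and cut-off constants `c₁, c₂`. -/
def RefinedCutoff (φ : X3 → ℝ) (η : ℝ → ℝ) (σ₁ σ₂ c₁ c₂ δ : ℝ) : Prop :=
  ContDiff ℝ (⊤ : ℕ∞) φ ∧ ContDiff ℝ (⊤ : ℕ∞) η ∧
  (∀ x, x ∉ Cσ σ₁ → φ x = 0) ∧ (∀ x ∈ Cσ σ₂, φ x = 1) ∧
  (∀ x, 0 ≤ φ x) ∧ (∀ x, φ x ≤ 1) ∧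
  (∀ x, Real.sqrt (gradSq φ x) ≤ (c₁ / (σ₁ - σ₂)) * φ x ^ δ) ∧
  (∀ s, s ∉ Ioc (-(σ₁^2)) 0 → η s = 0) ∧ (∀ s ∈ Icc (-(σ₂^2)) 0, η s = 1) ∧
  (∀ s, 0 ≤ η s) ∧ (∀ s, η s ≤ 1) ∧ (∀ s, |deriv η s| ≤ c₂ / (σ₁ - σ₂)^2)

/-- `Ω = ω_θ / r` as a function on `ℝ³ × ℝ`. -/
def Ωfun (vr vz : Prof) (x : X3) (s : ℝ) : ℝ := omθ vr vz (rad x) (x 2) s / rad x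

/-- `Ω̄₊`: equals `Ω + Λ` where `Ω ≥ 0` and `Λ` where `Ω < 0`. -/
def Ωplus (vr vz : Prof) (Λ : ℝ) (x : X3) (s : ℝ) : ℝ :=
  if 0 ≤ Ωfun vr vz x s then Ωfun vr vz x s + Λ else Λ

/-- Smoothness of a time-dependent vector field on a space-time set. -/
def SmoothVF (v : X3 → ℝ → X3) (S : Set (X3 × ℝ)) : Prop :=
  ContDiffOn ℝ (⊤ : ℕ∞) (fun q : X3 × ℝ => v q.1 q.2) S

/-- Smoothness of a time-dependent scalar field on a space-time set. -/
def SmoothSF (p : X3 → ℝ → ℝ) (S : Set (X3 × ℝ)) : Prop :=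
  ContDiffOn ℝ (⊤ : ℕ∞) (fun q : X3 × ℝ => p q.1 q.2) S

section

/-- The conjugate Poisson kernel at height `δ`, up to the factor `1/π`. -/
def conjPoisson (δ x : ℝ) : ℝ := x / (x ^ 2 + δ ^ 2)

/-- The Poisson kernel at height `δ`, up to the factor `1/π`. -/
def poissonKer (δ x : ℝ) : ℝ := δ / (x ^ 2 + δ ^ 2)

/-- The regularized Hilbert transform: convolution with the conjugate Poisson kernel. -/
def hilbertReg (δ : ℝ) (f : ℝ → ℂ) (x : ℝ) : ℂ := ∫ s, (conjPoisson δ (x - s) : ℂ) * f s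

/-- The Cauchy-type integral whose boundary values combine the Poisson and the
conjugate Poisson integrals of `f`. -/
def cauchyInt (f : ℝ → ℝ) (z : ℂ) : ℂ := ∫ t, (f t : ℂ) * (Complex.I / (z - t))

lemma continuous_conjPoisson {δ : ℝ} (hδ : 0 < δ) : Continuous (conjPoisson δ) := by
  unfold conjPoisson
  exact continuous_id.div (by fun_prop) fun x => by positivity

lemma continuous_poissonKer {δ : ℝ} (hδ : 0 < δ) : Continuous (poissonKer δ) := by
  unfold poissonKer
  exact continuous_const.div (by fun_prop) fun x => by positivity

lemma conjPoisson_neg (δ x : ℝ) : conjPoisson δ (-x) = -conjPoisson δ x := by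
  simp [conjPoisson, neg_div]

lemma abs_im_rpow_le_of_re_pos {p : ℝ} (hp : 1 < p) (hp2 : p ≤ 2) :
    ∃ A B : ℝ, 0 ≤ A ∧ 0 ≤ B ∧ ∀ z : ℂ, 0 < z.re →
      |z.im| ^ p ≤ A * z.re ^ p - B * (z ^ (p : ℂ)).re := by
  have hpi := Real.pi_pos
  set φ₀ : ℝ := π * (1 + p) / (4 * p) with hφ₀
  have hpφ : p * φ₀ = π * (1 + p) / 4 := by rw [hφ₀]; field_simp
  have h1 : 0 < φ₀ := by positivity
  have h2 : φ₀ < π / 2 := by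
    rw [hφ₀, div_lt_div_iff₀ (by positivity) (by norm_num)]; nlinarith
  have hc0 : 0 < Real.cos φ₀ := Real.cos_pos_of_mem_Ioo ⟨by linarith, h2⟩
  have hc1 : Real.cos (p * φ₀) < 0 := by
    rw [hpφ]
    apply Real.cos_neg_of_pi_div_two_lt_of_lt <;> nlinarith
  set B : ℝ := 1 / (-Real.cos (p * φ₀)) with hB
  have hB0 : 0 < B := by rw [hB]; apply div_pos one_pos; linarith
  refine ⟨(1 + B) / Real.cos φ₀ ^ p, B, by positivity, hB0.le, fun z hz => ?_⟩
  have hz0 : z ≠ 0 := fun h => by simp [h] at hz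
  have hn : 0 < ‖z‖ := norm_pos_iff.2 hz0
  have harg : |z.arg| < π / 2 := by
    rw [Complex.abs_arg_lt_pi_div_two_iff]; exact Or.inl hz
  rw [Complex.cpow_ofReal_re]
  have hre : z.re = ‖z‖ * Real.cos z.arg := by
    rw [Complex.cos_arg hz0]; field_simp
  have him : |z.im| = ‖z‖ * |Real.sin z.arg| := by
    rw [Complex.sin_arg, abs_div, abs_of_pos hn]; field_simp
  have hcos : Real.cos z.arg = Real.cos |z.arg| := (Real.cos_abs _).symm
  have hcosp : Real.cos (z.arg * p) = Real.cos (p * |z.arg|) := by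
    rw [← Real.cos_abs, abs_mul, abs_of_pos (by linarith : 0 < p), mul_comm]
  have hcpos : 0 < Real.cos |z.arg| :=
    Real.cos_pos_of_mem_Ioo ⟨by linarith [abs_nonneg z.arg], harg⟩
  have hsin : |Real.sin z.arg| ^ p ≤ 1 :=
    Real.rpow_le_one (abs_nonneg _) (Real.abs_sin_le_one _) (by linarith)
  have key : |Real.sin z.arg| ^ p ≤
      (1 + B) / Real.cos φ₀ ^ p * Real.cos |z.arg| ^ p - B * Real.cos (p * |z.arg|) := by
    rcases le_total |z.arg| φ₀ with h | h
    · have hle : Real.cos φ₀ ≤ Real.cos |z.arg| :=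
        Real.cos_le_cos_of_nonneg_of_le_pi (abs_nonneg _) (by linarith) h
      have : 1 ≤ Real.cos |z.arg| ^ p / Real.cos φ₀ ^ p := by
        rw [one_le_div (by positivity)]
        exact Real.rpow_le_rpow hc0.le hle (by linarith)
      have h3 : (1 + B) / Real.cos φ₀ ^ p * Real.cos |z.arg| ^ p
          = (1 + B) * (Real.cos |z.arg| ^ p / Real.cos φ₀ ^ p) := by ring
      rw [h3]
      nlinarith [Real.cos_le_one (p * |z.arg|)]
    · have hle : Real.cos (p * |z.arg|) ≤ Real.cos (p * φ₀) :=
        Real.cos_le_cos_of_nonneg_of_le_pi (by positivity) (by nlinarith)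
          (mul_le_mul_of_nonneg_left h (by linarith))
      have h4 : B * Real.cos (p * φ₀) = -1 := by
        rw [hB]; have := hc1.ne; field_simp
      have : 0 ≤ (1 + B) / Real.cos φ₀ ^ p * Real.cos |z.arg| ^ p := by positivity
      nlinarith
  rw [him, hre, Real.mul_rpow hn.le (abs_nonneg _), hcos, Real.mul_rpow hn.le hcpos.le, hcosp]
  have := mul_le_mul_of_nonneg_left key (by positivity : 0 ≤ ‖z‖ ^ p)
  linarith

variable {f : ℝ → ℝ}

lemma cauchyInt_line {δ : ℝ} (hδ : 0 < δ) (hf : Continuous f) (hc : HasCompactSupport f) (x : ℝ) :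
    cauchyInt f (x + δ * Complex.I) =
      ((∫ t, poissonKer δ (x - t) * f t : ℝ) : ℂ)
        + ((∫ t, conjPoisson δ (x - t) * f t : ℝ) : ℂ) * Complex.I := by
  have i1 : Integrable fun t => poissonKer δ (x - t) * f t :=
    (((continuous_poissonKer hδ).comp (by fun_prop)).mul hf).integrable_of_hasCompactSupport
      hc.mul_left
  have i2 : Integrable fun t => conjPoisson δ (x - t) * f t :=
    (((continuous_conjPoisson hδ).comp (by fun_prop)).mul hf).integrable_of_hasCompactSupport
      hc.mul_left
  rw [← integral_complex_ofReal, ← integral_complex_ofReal, ← integral_mul_const, ← integral_add]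
  · unfold cauchyInt
    congr 1; ext t
    have h0 : ((x - t) ^ 2 + δ ^ 2 : ℝ) ≠ 0 := by positivity
    have h1 : ((x : ℂ) + δ * Complex.I - t) ≠ 0 := by
      intro h; have := congrArg Complex.im h; simp at this; exact hδ.ne' this
    have h2 : ((x - t : ℂ) ^ 2 + δ ^ 2) ≠ 0 := by exact_mod_cast h0
    have h3 : Complex.I / (x + δ * Complex.I - t)
        = (δ + (x - t) * Complex.I) / ((x - t) ^ 2 + δ ^ 2) := by
      rw [div_eq_div_iff h1 h2]
      linear_combination (-δ * (x - t) : ℂ) * Complex.I_sq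
    simp only [poissonKer, conjPoisson, h3]
    push_cast
    ring
  · exact i1.ofReal
  · exact i2.ofReal.mul_const _

lemma differentiableAt_cauchyInt (hf : Continuous f) (hc : HasCompactSupport f) {z : ℂ}
    (hz : 0 < z.im) : DifferentiableAt ℂ (cauchyInt f) z := by
  have hs : {w : ℂ | z.im / 2 < w.im} ∈ nhds z :=
    (isOpen_lt continuous_const Complex.continuous_im).mem_nhds (by simp; linarith)
  have hne : ∀ w ∈ {w : ℂ | z.im / 2 < w.im}, ∀ t : ℝ, z.im / 2 < ‖w - t‖ := by
    intro w hw t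
    calc z.im / 2 < (w - t).im := by simpa using hw
      _ ≤ ‖w - t‖ := (le_abs_self _).trans (Complex.abs_im_le_norm _)
  have hne0 : ∀ w ∈ {w : ℂ | z.im / 2 < w.im}, ∀ t : ℝ, w - t ≠ 0 := fun w hw t h => by
    have := hne w hw t; rw [h, norm_zero] at this; linarith
  have hcont : ∀ w ∈ {w : ℂ | z.im / 2 < w.im},
      Continuous fun t : ℝ => (f t : ℂ) * (Complex.I / (w - t)) := fun w hw => by
    refine (Complex.continuous_ofReal.comp hf).mul (continuous_const.div (by fun_prop) (hne0 w hw))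
  have hcs : HasCompactSupport fun t => (f t : ℂ) := hc.comp_left (g := ((↑) : ℝ → ℂ)) rfl
  have hz' : z ∈ {w : ℂ | z.im / 2 < w.im} := by simp; linarith
  refine (hasDerivAt_integral_of_dominated_loc_of_deriv_le
    (F := fun (w : ℂ) (t : ℝ) => (f t : ℂ) * (Complex.I / (w - t)))
    (F' := fun (w : ℂ) (t : ℝ) => (f t : ℂ) * (-Complex.I / (w - t) ^ 2))
    (bound := fun t => |f t| * (1 / (z.im / 2) ^ 2)) hs ?_ ?_ ?_ ?_ ?_ ?_).2.differentiableAt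
  · filter_upwards [hs] with w hw using (hcont w hw).aestronglyMeasurable
  · exact (hcont z hz').integrable_of_hasCompactSupport hcs.mul_right
  · refine Continuous.aestronglyMeasurable ?_
    exact (Complex.continuous_ofReal.comp hf).mul
      (continuous_const.div (by fun_prop) fun t => pow_ne_zero _ (hne0 z hz' t))
  · refine ae_of_all _ fun t w hw => ?_
    have := hne w hw t
    rw [norm_mul, norm_div, norm_neg, Complex.norm_I, norm_pow, Complex.norm_real, Real.norm_eq_abs]
    gcongr
  · exact ((hf.abs).integrable_of_hasCompactSupport hc.abs).mul_const _
  · refine ae_of_all _ fun t w hw => ?_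
    have h1 : HasDerivAt (fun w : ℂ => w - (t:ℂ)) 1 w := (hasDerivAt_id w).sub_const _
    have := ((hasDerivAt_const w Complex.I).div h1 (hne0 w hw t)).const_mul (f t : ℂ)
    simpa using this

lemma norm_cauchyInt_le (hf : Continuous f) (hc : HasCompactSupport f) {z : ℂ} {d : ℝ} (hd : 0 < d)
    (h : ∀ t ∈ tsupport f, d ≤ ‖z - t‖) : ‖cauchyInt f z‖ ≤ (∫ t, |f t|) / d := by
  unfold cauchyInt
  rw [div_eq_mul_inv, ← integral_mul_const]
  refine norm_integral_le_of_norm_le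
    (((hf.abs).integrable_of_hasCompactSupport hc.abs).mul_const _) (ae_of_all _ fun t => ?_)
  by_cases ht : t ∈ tsupport f
  · rw [norm_mul, norm_div, Complex.norm_I, Complex.norm_real, Real.norm_eq_abs, one_div]
    gcongr; exact h t ht
  · simp [image_eq_zero_of_notMem_tsupport ht]

lemma cauchyInt_re_pos (hf : Continuous f) (hc : HasCompactSupport f) (h0 : ∀ t, 0 ≤ f t)
    (hne : f ≠ 0) {z : ℂ} (hz : 0 < z.im) : 0 < (cauchyInt f z).re := by
  have hline := cauchyInt_line hz hf hc z.re
  rw [Complex.re_add_im] at hline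
  rw [hline]
  simp only [Complex.add_re, Complex.ofReal_re, Complex.mul_re, Complex.I_re, mul_zero,
    Complex.ofReal_im, Complex.I_im, mul_one, sub_zero, add_zero]
  have hk : ∀ t, 0 < poissonKer z.im (z.re - t) := fun t => by unfold poissonKer; positivity
  refine Continuous.integral_pos_of_hasCompactSupport_nonneg_nonzero
    (((continuous_poissonKer hz).comp (by fun_prop)).mul hf) hc.mul_left
    (fun t => mul_nonneg (hk t).le (h0 t)) ?_ (x := (Function.ne_iff.1 hne).choose)
  exact mul_ne_zero (hk _).ne' (Function.ne_iff.1 hne).choose_spec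

end

lemma lintegral_rpow_le_measure_univ_mul {α : Type*} [MeasurableSpace α] {μ : Measure α}
    {p : ℝ} (hp : 1 < p) {h : α → ℝ≥0∞} (hh : AEMeasurable h μ) :
    (∫⁻ a, h a ∂μ) ^ p ≤ μ univ ^ (p - 1) * ∫⁻ a, h a ^ p ∂μ := by
  have hpq := Real.HolderConjugate.conjExponent hp
  have h1 := ENNReal.lintegral_mul_le_Lp_mul_Lq μ hpq hh (aemeasurable_const (b := (1 : ℝ≥0∞)))
  simp only [Pi.mul_apply, mul_one, ENNReal.one_rpow, lintegral_const, one_mul] at h1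
  calc (∫⁻ a, h a ∂μ) ^ p
      ≤ ((∫⁻ a, h a ^ p ∂μ) ^ (1 / p) * μ univ ^ (1 / p.conjExponent)) ^ p := by gcongr
    _ = μ univ ^ (p - 1) * ∫⁻ a, h a ^ p ∂μ := by
      rw [ENNReal.mul_rpow_of_nonneg _ _ hpq.nonneg, ← ENNReal.rpow_mul, ← ENNReal.rpow_mul,
        one_div_mul_cancel hpq.pos.ne', ENNReal.rpow_one, mul_comm]
      congr 2
      rw [Real.conjExponent]
      have : p - 1 ≠ 0 := by linarith
      field_simp

lemma lintegral_poissonKer {δ : ℝ} (hδ : 0 < δ) :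
    ∫⁻ x, ENNReal.ofReal (poissonKer δ x) = ENNReal.ofReal π := by
  have h1 : ∀ x, poissonKer δ x = δ⁻¹ * (1 + (x / δ) ^ 2)⁻¹ := fun x => by
    unfold poissonKer; field_simp; ring
  have h2 : Integrable (poissonKer δ) := by
    simp_rw [funext h1]
    exact (integrable_inv_one_add_sq.comp_div hδ.ne').const_mul _
  rw [← ofReal_integral_eq_lintegral_ofReal h2
    (ae_of_all _ fun x => by unfold poissonKer; positivity)]
  congr 1
  simp_rw [h1]
  rw [integral_const_mul, Measure.integral_comp_div (fun x => (1 + x ^ 2)⁻¹),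
    integral_univ_inv_one_add_sq, abs_of_pos hδ, smul_eq_mul]
  field_simp

lemma lintegral_poisson_rpow_le {p δ : ℝ} (hp : 1 < p) (hδ : 0 < δ) {f : ℝ → ℝ}
    (hf : Continuous f) (hc : HasCompactSupport f) (h0 : ∀ t, 0 ≤ f t) :
    ∫⁻ x, ENNReal.ofReal (∫ t, poissonKer δ (x - t) * f t) ^ p
      ≤ ENNReal.ofReal π ^ p * ∫⁻ x, ENNReal.ofReal (f x) ^ p := by
  have hcont := continuous_poissonKer hδ
  have hm : Measurable fun q : ℝ × ℝ => ENNReal.ofReal (poissonKer δ (q.1 - q.2)) :=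
    (ENNReal.continuous_ofReal.comp (hcont.comp (by fun_prop))).measurable
  have hmf : Measurable fun t => ENNReal.ofReal (f t) := by fun_prop
  have hk : ∀ t, 0 ≤ poissonKer δ t := fun t => by unfold poissonKer; positivity
  have hpt : ∀ x, ENNReal.ofReal (∫ t, poissonKer δ (x - t) * f t) ^ p ≤
      ENNReal.ofReal π ^ (p - 1) *
        ∫⁻ t, ENNReal.ofReal (poissonKer δ (x - t)) * ENNReal.ofReal (f t) ^ p := by
    intro x
    have hmx : Measurable fun t => ENNReal.ofReal (poissonKer δ (x - t)) :=
      (ENNReal.continuous_ofReal.comp (hcont.comp (by fun_prop))).measurable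
    have i1 : Integrable fun t => poissonKer δ (x - t) * f t :=
      (((continuous_poissonKer hδ).comp (by fun_prop)).mul hf).integrable_of_hasCompactSupport
        hc.mul_left
    have h := lintegral_rpow_le_measure_univ_mul
      (μ := volume.withDensity fun t => ENNReal.ofReal (poissonKer δ (x - t))) hp hmf.aemeasurable
    rw [lintegral_withDensity_eq_lintegral_mul _ hmx hmf,
      lintegral_withDensity_eq_lintegral_mul _ hmx (hmf.pow_const p),
      withDensity_apply _ MeasurableSet.univ, Measure.restrict_univ,
      lintegral_sub_left_eq_self (fun t => ENNReal.ofReal (poissonKer δ t)) x,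
      lintegral_poissonKer hδ] at h
    rw [ofReal_integral_eq_lintegral_ofReal i1 (ae_of_all _ fun t => mul_nonneg (hk _) (h0 t))]
    simp_rw [ENNReal.ofReal_mul (hk _)]
    exact h
  calc _ ≤ ∫⁻ x, ENNReal.ofReal π ^ (p - 1) *
        ∫⁻ t, ENNReal.ofReal (poissonKer δ (x - t)) * ENNReal.ofReal (f t) ^ p :=
        lintegral_mono hpt
    _ = ENNReal.ofReal π ^ (p - 1) * (ENNReal.ofReal π * ∫⁻ x, ENNReal.ofReal (f x) ^ p) := by
      rw [lintegral_const_mul', lintegral_lintegral_swap]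
      · congr 1
        rw [← lintegral_const_mul' _ _ ENNReal.ofReal_ne_top]
        congr 1; ext t
        rw [lintegral_mul_const', lintegral_sub_right_eq_self
          (fun t => ENNReal.ofReal (poissonKer δ t)) t, lintegral_poissonKer hδ]
        exact ENNReal.rpow_ne_top_of_nonneg (by linarith) ENNReal.ofReal_ne_top
      · exact (hm.mul ((hmf.pow_const p).comp measurable_snd)).aemeasurable
      · exact ENNReal.rpow_ne_top_of_nonneg (by linarith) ENNReal.ofReal_ne_top
    _ = _ := by
      rw [← mul_assoc]
      congr 1
      conv_lhs => rw [← ENNReal.rpow_one (ENNReal.ofReal π), ← ENNReal.rpow_mul, one_mul]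
      rw [← ENNReal.rpow_add _ _ (by simpa using Real.pi_pos) ENNReal.ofReal_ne_top]
      congr 1; ring

lemma tendsto_integral_cauchyInt_cpow {p δ : ℝ} (hp : 1 < p) (hδ : 0 < δ) {f : ℝ → ℝ}
    (hf : Continuous f) (hc : HasCompactSupport f) (h0 : ∀ t, 0 ≤ f t) (hne : f ≠ 0) :
    Filter.Tendsto (fun N : ℕ => ∫ x in (-(N : ℝ))..N,
      cauchyInt f (x + δ * Complex.I) ^ (p : ℂ)) Filter.atTop (nhds 0) := by
  obtain ⟨R, hR0, hR⟩ : ∃ R : ℝ, 0 < R ∧ ∀ t ∈ tsupport f, |t| ≤ R := by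
    obtain ⟨R, hR⟩ := hc.isCompact.isBounded.exists_norm_le
    exact ⟨max R 1, by positivity, fun t ht => (hR t ht).trans (le_max_left _ _)⟩
  set M : ℝ := ∫ t, |f t| with hM
  have hM0 : 0 ≤ M := integral_nonneg fun t => abs_nonneg _
  have hlim : Filter.Tendsto (fun N : ℕ => 4 * (2 * M) ^ p * (N : ℝ) ^ (-(p - 1)))
      Filter.atTop (nhds 0) := by
    have := ((tendsto_rpow_neg_atTop (by linarith : 0 < p - 1)).comp
      (tendsto_natCast_atTop_atTop (R := ℝ))).const_mul (4 * (2 * M) ^ p)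
    simpa using this
  refine squeeze_zero_norm' ?_ hlim
  filter_upwards [Filter.eventually_ge_atTop ⌈2 * R⌉₊] with N hN
  have hN2 : 2 * R ≤ N := Nat.ceil_le.1 hN
  have hN0 : 0 < (N : ℝ) := by linarith
  have hdiff : DifferentiableOn ℂ (fun z => cauchyInt f z ^ (p : ℂ))
      (uIcc ((-(N : ℝ) : ℝ) + δ * Complex.I : ℂ).re ((N : ℝ) + (δ + N : ℝ) * Complex.I : ℂ).re ×ℂ
        uIcc ((-(N : ℝ) : ℝ) + δ * Complex.I : ℂ).im ((N : ℝ) + (δ + N : ℝ) * Complex.I : ℂ).im) := by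
    intro z hz
    have him : 0 < z.im := by
      have := hz.2
      simp only [Complex.add_im, Complex.mul_im, Complex.ofReal_im, Complex.ofReal_re,
        Complex.I_im, Complex.I_re, mem_preimage] at this
      rw [uIcc_of_le (by linarith)] at this
      have := this.1
      linarith
    exact ((differentiableAt_cauchyInt hf hc him).cpow_const
      (Or.inl (cauchyInt_re_pos hf hc h0 hne him))).differentiableWithinAt
  have hrect := Complex.integral_boundary_rect_eq_zero_of_differentiableOn _ _ _ hdiff
  simp only [Complex.add_re, Complex.mul_re, Complex.ofReal_re, Complex.I_re,
    Complex.ofReal_im, Complex.I_im, Complex.add_im, Complex.mul_im,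
    mul_zero, mul_one, sub_zero, add_zero, zero_add] at hrect
  have hbound : ∀ z : ℂ, 0 < z.im → (N : ℝ) ≤ z.im ∨ (N : ℝ) ≤ |z.re| →
      ‖cauchyInt f z ^ (p : ℂ)‖ ≤ (2 * M / N) ^ p := by
    intro z him hz
    rw [Complex.norm_cpow_real]
    refine Real.rpow_le_rpow (norm_nonneg _) ?_ (by linarith)
    have : ‖cauchyInt f z‖ ≤ M / (N / 2) := by
      refine norm_cauchyInt_le hf hc (by positivity) fun t ht => ?_
      rcases hz with h | h
      · have h1 := Complex.abs_im_le_norm (z - t)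
        simp only [Complex.sub_im, Complex.ofReal_im, sub_zero] at h1
        linarith [le_abs_self z.im]
      · have h1 := Complex.abs_re_le_norm (z - t)
        simp only [Complex.sub_re, Complex.ofReal_re] at h1
        linarith [abs_sub_abs_le_abs_sub z.re t, hR t ht]
    calc _ ≤ _ := this
      _ = _ := by field_simp
  have b1 := intervalIntegral.norm_integral_le_of_norm_le_const
    (f := fun x : ℝ => cauchyInt f (x + (δ + N : ℝ) * Complex.I) ^ (p : ℂ))
    (a := -(N : ℝ)) (b := N) (C := (2 * M / N) ^ p)
    fun x _ => hbound _ (by simp; positivity) (Or.inl (by simp; positivity))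
  have b2 := intervalIntegral.norm_integral_le_of_norm_le_const
    (f := fun y : ℝ => cauchyInt f ((N : ℝ) + y * Complex.I) ^ (p : ℂ))
    (a := δ) (b := δ + N) (C := (2 * M / N) ^ p)
    fun y hy => hbound _ (by
      rw [uIoc_of_le (by linarith)] at hy; simpa using hδ.trans hy.1) (Or.inr (by simp))
  have b3 := intervalIntegral.norm_integral_le_of_norm_le_const
    (f := fun y : ℝ => cauchyInt f ((-(N : ℝ) : ℝ) + y * Complex.I) ^ (p : ℂ))
    (a := δ) (b := δ + N) (C := (2 * M / N) ^ p)
    fun y hy => hbound _ (by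
      rw [uIoc_of_le (by linarith)] at hy; simpa using hδ.trans hy.1) (Or.inr (by simp))
  have heq : (4 : ℝ) * (2 * M) ^ p * (N : ℝ) ^ (-(p - 1)) = 4 * N * (2 * M / N) ^ p := by
    rw [Real.div_rpow (by positivity) hN0.le, neg_sub, Real.rpow_sub hN0, Real.rpow_one]
    field_simp
  rw [heq]
  have habs1 : |(N : ℝ) - -N| = 2 * N := by rw [abs_of_nonneg] <;> linarith
  have habs2 : |δ + (N : ℝ) - δ| = N := by rw [abs_of_nonneg] <;> linarith
  rw [habs1] at b1
  rw [habs2] at b2 b3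
  set P := ∫ x in (-(N : ℝ))..N, cauchyInt f (x + δ * Complex.I) ^ (p : ℂ)
  set Q := ∫ x in (-(N : ℝ))..N, cauchyInt f (x + (δ + N : ℝ) * Complex.I) ^ (p : ℂ)
  set S := ∫ y in δ..(δ + N), cauchyInt f ((N : ℝ) + y * Complex.I) ^ (p : ℂ)
  set W := ∫ y in δ..(δ + N), cauchyInt f ((-(N : ℝ) : ℝ) + y * Complex.I) ^ (p : ℂ)
  have hP : P = Q - Complex.I * S + Complex.I * W := by
    have : P - Q + Complex.I * S - Complex.I * W = 0 := hrect
    linear_combination this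
  calc ‖P‖ ≤ ‖Q‖ + ‖Complex.I * S‖ + ‖Complex.I * W‖ := by
        rw [hP]; exact (norm_add_le _ _).trans (add_le_add_left (norm_sub_le _ _) _)
    _ ≤ (2 * M / N) ^ p * (2 * N) + (2 * M / N) ^ p * N + (2 * M / N) ^ p * N := by
        rw [norm_mul, norm_mul, Complex.norm_I, one_mul, one_mul]; gcongr
    _ = _ := by ring

lemma lintegral_hilbertReg_rpow_le_of_nonneg {p : ℝ} (hp : 1 < p) (hp2 : p ≤ 2) :
    ∃ C : ℝ≥0∞, C ≠ ∞ ∧ ∀ δ > 0, ∀ f : ℝ → ℝ, Continuous f → HasCompactSupport f → (∀ t, 0 ≤ f t) →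
      ∫⁻ x, ‖hilbertReg δ (fun t => (f t : ℂ)) x‖ₑ ^ p ≤ C * ∫⁻ x, ‖f x‖ₑ ^ p := by
  obtain ⟨A, B, hA, hB, hAB⟩ := abs_im_rpow_le_of_re_pos hp hp2
  refine ⟨ENNReal.ofReal A * ENNReal.ofReal π ^ p, ENNReal.mul_ne_top ENNReal.ofReal_ne_top
    (ENNReal.rpow_ne_top_of_nonneg (by linarith) ENNReal.ofReal_ne_top),
    fun δ hδ f hf hc h0 => ?_⟩
  rcases eq_or_ne f 0 with rfl | hne
  · simp [hilbertReg, show 0 < p by linarith]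
  set U : ℝ → ℝ := fun x => ∫ t, poissonKer δ (x - t) * f t with hU
  set V : ℝ → ℝ := fun x => ∫ t, conjPoisson δ (x - t) * f t with hV
  have hF : Continuous fun x : ℝ => cauchyInt f (x + δ * Complex.I) := by
    refine continuous_iff_continuousAt.2 fun x => ?_
    have := (differentiableAt_cauchyInt hf hc (z := x + δ * Complex.I) (by simpa using hδ))
    exact this.continuousAt.comp (f := fun x : ℝ => (x + δ * Complex.I : ℂ)) (by fun_prop)
  have hre : ∀ x : ℝ, (cauchyInt f (x + δ * Complex.I)).re = U x := fun x => by
    rw [cauchyInt_line hδ hf hc]; simp [U]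
  have him : ∀ x : ℝ, (cauchyInt f (x + δ * Complex.I)).im = V x := fun x => by
    rw [cauchyInt_line hδ hf hc]; simp [V]
  have hUc : Continuous U := (Complex.continuous_re.comp hF).congr hre
  have hVc : Continuous V := (Complex.continuous_im.comp hF).congr him
  have hpos : ∀ x, 0 < U x := fun x => by
    rw [← hre]; exact cauchyInt_re_pos hf hc h0 hne (by simpa using hδ)
  have hHV : ∀ x, ‖hilbertReg δ (fun t => (f t : ℂ)) x‖ₑ ^ p = ENNReal.ofReal (|V x| ^ p) := by
    intro x
    have : hilbertReg δ (fun t => (f t : ℂ)) x = (V x : ℂ) := by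
      simp only [hilbertReg, hV, ← integral_complex_ofReal, Complex.ofReal_mul]
    rw [this, ← ENNReal.ofReal_rpow_of_nonneg (abs_nonneg _) (by linarith), ← ofReal_norm,
      Complex.norm_real, Real.norm_eq_abs]
  have hfx : ∀ x, ‖f x‖ₑ ^ p = ENNReal.ofReal (f x) ^ p := fun x => by
    rw [Real.enorm_eq_ofReal (h0 x)]
  simp_rw [hHV, hfx]
  have hFp : Continuous fun x : ℝ => cauchyInt f (x + δ * Complex.I) ^ (p : ℂ) :=
    hF.cpow continuous_const fun x => Or.inl (by rw [hre]; exact hpos x)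
  have hVp : Continuous fun x => |V x| ^ p := hVc.abs.rpow_const fun _ => Or.inr (by linarith)
  have hUp : Continuous fun x => U x ^ p := hUc.rpow_const fun _ => Or.inr (by linarith)
  set E : ℕ → ℝ := fun N => ‖∫ x in (-(N : ℝ))..N, cauchyInt f (x + δ * Complex.I) ^ (p : ℂ)‖
  have hstep : ∀ N : ℕ, ∫⁻ x in Ioc (-(N : ℝ)) N, ENNReal.ofReal (|V x| ^ p) ≤
      ENNReal.ofReal A * (ENNReal.ofReal π ^ p * ∫⁻ x, ENNReal.ofReal (f x) ^ p)
        + ENNReal.ofReal (B * E N) := by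
    intro N
    have hN : -(N : ℝ) ≤ N := by linarith [N.cast_nonneg (α := ℝ)]
    have h1 : ∫ x in (-(N : ℝ))..N, |V x| ^ p ≤
        A * (∫ x in (-(N : ℝ))..N, U x ^ p) + B * E N := by
      calc ∫ x in (-(N : ℝ))..N, |V x| ^ p
          ≤ ∫ x in (-(N : ℝ))..N,
            (A * U x ^ p - B * (cauchyInt f (x + δ * Complex.I) ^ (p : ℂ)).re) := by
            refine intervalIntegral.integral_mono_on hN (hVp.intervalIntegrable _ _) ?_ ?_
            · exact ((hUp.const_mul A).sub
                ((Complex.continuous_re.comp hFp).const_mul B)).intervalIntegrable _ _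
            · intro x _
              have := hAB (cauchyInt f (x + δ * Complex.I)) (by rw [hre]; exact hpos x)
              rwa [hre, him] at this
        _ = A * (∫ x in (-(N : ℝ))..N, U x ^ p) -
            B * (∫ x in (-(N : ℝ))..N, cauchyInt f (x + δ * Complex.I) ^ (p : ℂ)).re := by
            rw [intervalIntegral.integral_sub, intervalIntegral.integral_const_mul,
              intervalIntegral.integral_const_mul]
            · congr 2
              exact Complex.reCLM.intervalIntegral_comp_comm (hFp.intervalIntegrable _ _)
            · exact (hUp.const_mul A).intervalIntegrable _ _
            · exact ((Complex.continuous_re.comp hFp).const_mul B).intervalIntegrable _ _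
        _ ≤ _ := by
            have := mul_le_mul_of_nonneg_left ((neg_le_abs _).trans (Complex.abs_re_le_norm
              (∫ x in (-(N : ℝ))..N, cauchyInt f (x + δ * Complex.I) ^ (p : ℂ)))) hB
            simp only [E]; linarith
    have h2 : ENNReal.ofReal (∫ x in (-(N : ℝ))..N, U x ^ p) ≤
        ENNReal.ofReal π ^ p * ∫⁻ x, ENNReal.ofReal (f x) ^ p := by
      refine le_trans ?_ (lintegral_poisson_rpow_le hp hδ hf hc h0)
      rw [intervalIntegral.integral_of_le hN, ofReal_integral_eq_lintegral_ofReal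
        (hUp.integrableOn_Ioc) (ae_of_all _ fun x => (Real.rpow_nonneg (hpos x).le p))]
      refine (lintegral_mono fun x => ?_).trans (setLIntegral_le_lintegral _ _)
      simp only [hU] at hpos ⊢
      rw [ENNReal.ofReal_rpow_of_nonneg (hpos x).le (by linarith)]
    rw [← ofReal_integral_eq_lintegral_ofReal (hVp.integrableOn_Ioc)
      (ae_of_all _ fun x => Real.rpow_nonneg (abs_nonneg _) p),
      ← intervalIntegral.integral_of_le hN]
    calc _ ≤ ENNReal.ofReal (A * (∫ x in (-(N : ℝ))..N, U x ^ p) + B * E N) :=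
          ENNReal.ofReal_le_ofReal h1
      _ ≤ ENNReal.ofReal A * ENNReal.ofReal (∫ x in (-(N : ℝ))..N, U x ^ p)
          + ENNReal.ofReal (B * E N) := by
          rw [← ENNReal.ofReal_mul hA]; exact ENNReal.ofReal_add_le
      _ ≤ _ := by gcongr
  have hcov : AECover volume Filter.atTop fun N : ℕ => Ioc (-(N : ℝ)) N :=
    aecover_Ioc (Filter.tendsto_neg_atTop_atBot.comp tendsto_natCast_atTop_atTop)
      tendsto_natCast_atTop_atTop
  have hlim := hcov.lintegral_tendsto_of_nat
    (f := fun x => ENNReal.ofReal (|V x| ^ p)) (by fun_prop)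
  have hE : Filter.Tendsto (fun N => ENNReal.ofReal A * (ENNReal.ofReal π ^ p *
      ∫⁻ x, ENNReal.ofReal (f x) ^ p) + ENNReal.ofReal (B * E N)) Filter.atTop
      (nhds (ENNReal.ofReal A * (ENNReal.ofReal π ^ p * ∫⁻ x, ENNReal.ofReal (f x) ^ p) + 0)) := by
    refine tendsto_const_nhds.add ?_
    have := (tendsto_integral_cauchyInt_cpow hp hδ hf hc h0 hne).norm.const_mul B
    simpa using ENNReal.tendsto_ofReal this
  refine (le_of_tendsto_of_tendsto' hlim hE hstep).trans_eq ?_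
  rw [add_zero, mul_assoc]

lemma continuous_hilbertReg {δ : ℝ} (hδ : 0 < δ) {f : ℝ → ℂ} (hf : Continuous f)
    (hc : HasCompactSupport f) : Continuous (hilbertReg δ f) := by
  have h : hilbertReg δ f = fun x => ∫ s in tsupport f, (conjPoisson δ (x - s) : ℂ) * f s := by
    ext x
    refine (setIntegral_eq_integral_of_forall_compl_eq_zero fun s hs => ?_).symm
    simp [image_eq_zero_of_notMem_tsupport hs]
  rw [h]
  refine continuous_parametric_integral_of_continuous ?_ hc.isCompact
  have := continuous_conjPoisson hδ
  exact (Complex.continuous_ofReal.comp (this.comp (by fun_prop))).mul (hf.comp continuous_snd)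

lemma integrable_conjPoisson_mul {δ : ℝ} (hδ : 0 < δ) {f : ℝ → ℂ} (hf : Continuous f)
    (hc : HasCompactSupport f) (x : ℝ) :
    Integrable fun s => (conjPoisson δ (x - s) : ℂ) * f s :=
  ((Complex.continuous_ofReal.comp ((continuous_conjPoisson hδ).comp (by fun_prop))).mul
    hf).integrable_of_hasCompactSupport hc.mul_left

lemma hilbertReg_add {δ : ℝ} (hδ : 0 < δ) {f g : ℝ → ℂ} (hf : Continuous f)
    (hfc : HasCompactSupport f) (hg : Continuous g) (hgc : HasCompactSupport g) (x : ℝ) :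
    hilbertReg δ (fun t => f t + g t) x = hilbertReg δ f x + hilbertReg δ g x := by
  simp only [hilbertReg, mul_add]
  exact integral_add (integrable_conjPoisson_mul hδ hf hfc x) (integrable_conjPoisson_mul hδ hg hgc x)

lemma hilbertReg_const_mul (δ : ℝ) (c : ℂ) (f : ℝ → ℂ) (x : ℝ) :
    hilbertReg δ (fun t => c * f t) x = c * hilbertReg δ f x := by
  simp only [hilbertReg, ← integral_const_mul]
  congr 1; ext s; ring

/-- Subadditivity of `g ↦ ∫ |g| ^ p` up to a constant, packaged as an estimate for the
regularized Hilbert transform of a sum. -/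
lemma lintegral_hilbertReg_add_rpow_le {p δ : ℝ} (hp : 1 < p) (hδ : 0 < δ) {C K : ℝ≥0∞}
    {f g : ℝ → ℂ} (hf : Continuous f) (hfc : HasCompactSupport f) (hg : Continuous g)
    (hgc : HasCompactSupport g)
    (h1 : ∫⁻ x, ‖hilbertReg δ f x‖ₑ ^ p ≤ C * K) (h2 : ∫⁻ x, ‖hilbertReg δ g x‖ₑ ^ p ≤ C * K) :
    ∫⁻ x, ‖hilbertReg δ (fun t => f t + g t) x‖ₑ ^ p ≤ (2 ^ p * C) * K := by
  have hm : Measurable fun x => ‖hilbertReg δ f x‖ₑ ^ p :=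
    ((continuous_hilbertReg hδ hf hfc).measurable.enorm).pow_const p
  calc ∫⁻ x, ‖hilbertReg δ (fun t => f t + g t) x‖ₑ ^ p
      ≤ ∫⁻ x, 2 ^ (p - 1) * (‖hilbertReg δ f x‖ₑ ^ p + ‖hilbertReg δ g x‖ₑ ^ p) := by
        refine lintegral_mono fun x => ?_
        rw [hilbertReg_add hδ hf hfc hg hgc]
        exact (ENNReal.rpow_le_rpow (enorm_add_le _ _) (by linarith)).trans
          (ENNReal.rpow_add_le_mul_rpow_add_rpow _ _ hp.le)
    _ ≤ 2 ^ (p - 1) * (C * K + C * K) := by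
        rw [lintegral_const_mul' _ _ (ENNReal.rpow_ne_top_of_nonneg (by linarith) (by simp)),
          lintegral_add_left hm]
        gcongr
    _ = _ := by
        rw [← two_mul, ← mul_assoc, ← mul_assoc]
        congr 2
        conv_lhs => rw [← ENNReal.rpow_one 2, ← ENNReal.rpow_mul, one_mul]
        rw [← ENNReal.rpow_add _ _ (by simp) (by simp)]
        congr 1; ring

lemma lintegral_hilbertReg_rpow_le_of_le_two {p : ℝ} (hp : 1 < p) (hp2 : p ≤ 2) :
    ∃ C : ℝ≥0∞, C ≠ ∞ ∧ ∀ δ > 0, ∀ f : ℝ → ℂ, Continuous f → HasCompactSupport f →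
      ∫⁻ x, ‖hilbertReg δ f x‖ₑ ^ p ≤ C * ∫⁻ x, ‖f x‖ₑ ^ p := by
  obtain ⟨C, hC, H⟩ := lintegral_hilbertReg_rpow_le_of_nonneg hp hp2
  refine ⟨2 ^ p * (2 ^ p * C), ENNReal.mul_ne_top (ENNReal.rpow_ne_top_of_nonneg (by linarith)
    (by simp)) (ENNReal.mul_ne_top (ENNReal.rpow_ne_top_of_nonneg (by linarith) (by simp)) hC),
    fun δ hδ f hf hc => ?_⟩
  have part : ∀ (c : ℂ) (φ : ℂ → ℝ), ‖c‖ = 1 → Continuous φ → (∀ w, 0 ≤ φ w) → (∀ w, φ w ≤ ‖w‖) →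
      Continuous (fun t => c * (φ (f t) : ℂ)) ∧ HasCompactSupport (fun t => c * (φ (f t) : ℂ)) ∧
      ∫⁻ x, ‖hilbertReg δ (fun t => c * (φ (f t) : ℂ)) x‖ₑ ^ p ≤ C * ∫⁻ x, ‖f x‖ₑ ^ p := by
    intro c φ hnc hφ h0 hle
    have hφ0 : φ 0 = 0 := le_antisymm (by simpa using hle 0) (h0 0)
    have hcs : HasCompactSupport fun t => φ (f t) := hc.comp_left (g := φ) hφ0
    refine ⟨by fun_prop, (hcs.comp_left (g := fun y : ℝ => c * (y : ℂ)) (by simp)), ?_⟩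
    simp only [hilbertReg_const_mul, enorm_mul]
    have hc1 : ‖c‖ₑ = 1 := by rw [← ofReal_norm, hnc, ENNReal.ofReal_one]
    simp only [hc1, one_mul]
    refine (H δ hδ _ (hφ.comp hf) hcs fun t => h0 _).trans ?_
    gcongr with x
    rw [← ofReal_norm, ← ofReal_norm]
    apply ENNReal.ofReal_le_ofReal
    rw [Function.comp, Real.norm_of_nonneg (h0 _)]
    exact hle _
  obtain ⟨c1, k1, e1⟩ := part 1 (fun w => max w.re 0) (by simp) (by fun_prop)
    (fun w => le_max_right _ _)
    fun w => max_le ((le_abs_self _).trans (Complex.abs_re_le_norm w)) (norm_nonneg _)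
  obtain ⟨c2, k2, e2⟩ := part (-1) (fun w => max (-w.re) 0) (by simp) (by fun_prop)
    (fun w => le_max_right _ _)
    fun w => max_le ((neg_le_abs _).trans (Complex.abs_re_le_norm w)) (norm_nonneg _)
  obtain ⟨c3, k3, e3⟩ := part Complex.I (fun w => max w.im 0) (by simp) (by fun_prop)
    (fun w => le_max_right _ _)
    fun w => max_le ((le_abs_self _).trans (Complex.abs_im_le_norm w)) (norm_nonneg _)
  obtain ⟨c4, k4, e4⟩ := part (-Complex.I) (fun w => max (-w.im) 0) (by simp) (by fun_prop)
    (fun w => le_max_right _ _)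
    fun w => max_le ((neg_le_abs _).trans (Complex.abs_im_le_norm w)) (norm_nonneg _)
  have h12 := lintegral_hilbertReg_add_rpow_le hp hδ c1 k1 c2 k2 e1 e2
  have h34 := lintegral_hilbertReg_add_rpow_le hp hδ c3 k3 c4 k4 e3 e4
  have h := lintegral_hilbertReg_add_rpow_le hp hδ (c1.add c2) (k1.add k2) (c3.add c4) (k3.add k4)
    h12 h34
  convert h using 6 with x
  ext t
  have hmax : ∀ y : ℝ, y = max y 0 - max (-y) 0 := fun y => by
    rcases le_total y 0 with h | h
    · rw [max_eq_right h, max_eq_left (by linarith)]; ring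
    · rw [max_eq_left h, max_eq_right (by linarith)]; ring
  conv_lhs => rw [← Complex.re_add_im (f t), hmax (f t).re, hmax (f t).im]
  push_cast
  simp only [Pi.add_apply]
  ring

lemma integral_hilbertReg_mul {δ : ℝ} (hδ : 0 < δ) {f g : ℝ → ℂ} (hf : Continuous f)
    (hfc : HasCompactSupport f) (hg : Continuous g) (hgc : HasCompactSupport g) :
    ∫ x, hilbertReg δ f x * g x = -∫ x, f x * hilbertReg δ g x := by
  have hk := continuous_conjPoisson hδ
  have h_int : Integrable (fun q : ℝ × ℝ => (conjPoisson δ (q.1 - q.2) : ℂ) * f q.2 * g q.1)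
      (volume.prod volume) := by
    refine Continuous.integrable_of_hasCompactSupport ?_ ?_
    · exact ((Complex.continuous_ofReal.comp (hk.comp (by fun_prop))).mul
        (hf.comp continuous_snd)).mul (hg.comp continuous_fst)
    · refine HasCompactSupport.intro (hgc.isCompact.prod hfc.isCompact) fun q hq => ?_
      by_cases h1 : q.1 ∈ tsupport g
      · have : q.2 ∉ tsupport f := fun h2 => hq ⟨h1, h2⟩
        simp [image_eq_zero_of_notMem_tsupport this]
      · simp [image_eq_zero_of_notMem_tsupport h1]
  calc ∫ x, hilbertReg δ f x * g x = ∫ x, ∫ s, (conjPoisson δ (x - s) : ℂ) * f s * g x := by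
        simp only [hilbertReg, integral_mul_const]
    _ = ∫ s, ∫ x, (conjPoisson δ (x - s) : ℂ) * f s * g x := integral_integral_swap h_int
    _ = ∫ s, -(f s * hilbertReg δ g s) := by
        congr 1; ext s
        rw [hilbertReg, ← integral_const_mul, ← integral_neg]
        congr 1; ext x
        rw [← neg_sub s x, conjPoisson_neg]; push_cast; ring
    _ = _ := integral_neg _

lemma lintegral_hilbertReg_rpow_le {p : ℝ} (hp : 1 < p) :
    ∃ C : ℝ≥0∞, C ≠ ∞ ∧ ∀ δ > 0, ∀ f : ℝ → ℂ, Continuous f → HasCompactSupport f →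
      ∫⁻ x, ‖hilbertReg δ f x‖ₑ ^ p ≤ C * ∫⁻ x, ‖f x‖ₑ ^ p := by
  rcases le_or_gt p 2 with hp2 | hp2
  · exact lintegral_hilbertReg_rpow_le_of_le_two hp hp2
  have hpq := Real.HolderConjugate.conjExponent hp
  set q := p.conjExponent with hq
  have hq2 : q ≤ 2 := by
    rw [hq, Real.conjExponent, div_le_iff₀ (by linarith)]; linarith
  obtain ⟨C, hC, H⟩ := lintegral_hilbertReg_rpow_le_of_le_two hpq.symm.lt hq2
  refine ⟨C ^ (p / q), ENNReal.rpow_ne_top_of_nonneg (by have := hpq.symm.pos; positivity) hC,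
    fun δ hδ f hf hc => ?_⟩
  set v := hilbertReg δ f with hv
  have hvc : Continuous v := continuous_hilbertReg hδ hf hc
  have hstep : ∀ N : ℕ, ∫⁻ x in Ioc (-(N : ℝ)) N, ‖v x‖ₑ ^ p ≤
      C ^ (p / q) * ∫⁻ x, ‖f x‖ₑ ^ p := by
    intro N
    set χ : ℝ → ℝ := fun x => max 0 (min 1 (N + 1 - |x|)) with hχ
    have hχc : Continuous χ := by fun_prop
    have hχ0 : ∀ x, 0 ≤ χ x := fun x => le_max_left _ _
    have hχ1 : ∀ x, χ x ≤ 1 := fun x => max_le zero_le_one (min_le_left _ _)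
    have hχcs : HasCompactSupport χ := by
      refine HasCompactSupport.intro (isCompact_Icc (a := -(N + 1 : ℝ)) (b := N + 1)) fun x hx => ?_
      have : (N : ℝ) + 1 - |x| ≤ 0 := by
        by_contra! h
        exact hx (abs_le.1 (by linarith))
      simp only [χ]
      exact max_eq_left ((min_le_right _ _).trans this)
    set h : ℝ → ℂ := fun x => starRingEnd ℂ (v x) * ((‖v x‖ ^ (p - 2) * χ x : ℝ) : ℂ) with hh
    have hhc : Continuous h := by
      refine (Complex.continuous_conj.comp hvc).mul (Complex.continuous_ofReal.comp ?_)
      exact (hvc.norm.rpow_const fun _ => Or.inr (by linarith)).mul hχc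
    have hhcs : HasCompactSupport h := by
      have h1 : HasCompactSupport fun x => ‖v x‖ ^ (p - 2) * χ x := hχcs.mul_left
      have h2 : HasCompactSupport fun x => ((‖v x‖ ^ (p - 2) * χ x : ℝ) : ℂ) :=
        h1.comp_left (g := ((↑) : ℝ → ℂ)) rfl
      exact h2.mul_left
    have hvh : ∀ x, v x * h x = ((‖v x‖ ^ p * χ x : ℝ) : ℂ) := by
      intro x
      simp only [h]
      rw [← mul_assoc, Complex.mul_conj, Complex.normSq_eq_norm_sq, ← Complex.ofReal_mul]
      congr 1
      rw [← mul_assoc]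
      congr 1
      rcases (norm_nonneg (v x)).eq_or_lt with h0 | h0
      · rw [← h0]; simp [Real.zero_rpow hpq.pos.ne']
      · rw [← Real.rpow_natCast, ← Real.rpow_add h0]; congr 1; push_cast; ring
    have hnh : ∀ x, ‖h x‖ ^ q ≤ ‖v x‖ ^ p * χ x := by
      intro x
      have e1 : ‖h x‖ = ‖v x‖ ^ (p - 1) * χ x := by
        simp only [h]
        rw [norm_mul, RCLike.norm_conj, Complex.norm_real, Real.norm_of_nonneg
          (mul_nonneg (Real.rpow_nonneg (norm_nonneg _) _) (hχ0 x)), ← mul_assoc]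
        congr 1
        rcases (norm_nonneg (v x)).eq_or_lt with h0 | h0
        · rw [← h0]; simp [Real.zero_rpow (sub_pos.2 hp).ne']
        · conv_lhs => rw [← Real.rpow_one ‖v x‖, ← Real.rpow_mul h0.le, one_mul]
          rw [← Real.rpow_add h0]; congr 1; ring
      rw [e1, Real.mul_rpow (Real.rpow_nonneg (norm_nonneg _) _) (hχ0 x),
        ← Real.rpow_mul (norm_nonneg _), hpq.sub_one_mul_conj]
      refine mul_le_mul_of_nonneg_left ?_ (Real.rpow_nonneg (norm_nonneg _) _)
      calc χ x ^ q ≤ χ x ^ (1 : ℝ) :=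
            Real.rpow_le_rpow_of_exponent_ge' (hχ0 x) (hχ1 x) zero_le_one hpq.symm.lt.le
        _ = χ x := Real.rpow_one _
    set X : ℝ := ∫ x, ‖v x‖ ^ p * χ x with hX
    have hXc : Continuous fun x => ‖v x‖ ^ p * χ x :=
      (hvc.norm.rpow_const fun _ => Or.inr (by linarith)).mul hχc
    have hXi : Integrable fun x => ‖v x‖ ^ p * χ x :=
      hXc.integrable_of_hasCompactSupport hχcs.mul_left
    have hX0 : ∀ x, 0 ≤ ‖v x‖ ^ p * χ x := fun x =>
      mul_nonneg (Real.rpow_nonneg (norm_nonneg _) _) (hχ0 x)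
    have hXl : ENNReal.ofReal X = ∫⁻ x, ENNReal.ofReal (‖v x‖ ^ p * χ x) :=
      ofReal_integral_eq_lintegral_ofReal hXi (ae_of_all _ hX0)
    have hleft : ∫⁻ x in Ioc (-(N : ℝ)) N, ‖v x‖ₑ ^ p ≤ ENNReal.ofReal X := by
      rw [hXl]
      refine le_trans (setLIntegral_mono' measurableSet_Ioc fun x hx => ?_)
        (setLIntegral_le_lintegral _ _)
      have : χ x = 1 := by
        have : |x| ≤ N := abs_le.2 ⟨hx.1.le, hx.2⟩
        simp only [χ]
        rw [min_eq_left (by linarith), max_eq_right zero_le_one]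
      rw [this, mul_one, ← ENNReal.ofReal_rpow_of_nonneg (norm_nonneg _) (by linarith), ofReal_norm]
    have hdual : ENNReal.ofReal X ≤
        (∫⁻ x, ‖f x‖ₑ ^ p) ^ (1 / p) * (C * ENNReal.ofReal X) ^ (1 / q) := by
      have e1 : (X : ℂ) = -∫ x, f x * hilbertReg δ h x := by
        rw [← integral_hilbertReg_mul hδ hf hc hhc hhcs, hX, ← integral_complex_ofReal]
        congr 1; ext x; exact (hvh x).symm
      have e2 : ENNReal.ofReal X ≤ ∫⁻ x, ‖f x‖ₑ * ‖hilbertReg δ h x‖ₑ := by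
        have : ENNReal.ofReal X = ‖(X : ℂ)‖ₑ := by
          rw [← ofReal_norm, Complex.norm_real, Real.norm_of_nonneg (integral_nonneg hX0)]
        rw [this, e1, enorm_neg]
        refine (enorm_integral_le_lintegral_enorm _).trans_eq ?_
        simp only [enorm_mul]
      refine e2.trans ((ENNReal.lintegral_mul_le_Lp_mul_Lq volume hpq
        hf.measurable.enorm.aemeasurable
        (continuous_hilbertReg hδ hhc hhcs).measurable.enorm.aemeasurable).trans ?_)
      have hq0 := hpq.symm.pos
      gcongr
      refine (H δ hδ h hhc hhcs).trans ?_
      gcongr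
      rw [hXl]
      refine lintegral_mono fun x => ?_
      rw [← ofReal_norm, ENNReal.ofReal_rpow_of_nonneg (norm_nonneg _) hpq.symm.nonneg]
      exact ENNReal.ofReal_le_ofReal (hnh x)
    refine hleft.trans ?_
    rcases eq_or_ne (ENNReal.ofReal X) 0 with h0 | h0
    · rw [h0]; exact zero_le
    set Y := ENNReal.ofReal X
    have hYt : Y ≠ ∞ := ENNReal.ofReal_ne_top
    have hq0 := hpq.symm.pos
    have hp0 := hpq.pos
    have hYq0 : Y ^ (1 / q) ≠ 0 := by
      simp [ENNReal.rpow_eq_zero_iff, h0, hYt]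
    have hYqt : Y ^ (1 / q) ≠ ∞ := ENNReal.rpow_ne_top_of_nonneg (by positivity) hYt
    have hsum : 1 / p + 1 / q = 1 := by simpa using hpq.inv_add_inv_eq_one
    have h2 : Y ^ (1 / p) ≤ (∫⁻ x, ‖f x‖ₑ ^ p) ^ (1 / p) * C ^ (1 / q) := by
      rw [ENNReal.mul_rpow_of_nonneg _ _ (by positivity), ← mul_assoc] at hdual
      rw [← ENNReal.mul_le_mul_iff_left hYq0 hYqt, ← ENNReal.rpow_add _ _ h0 hYt, hsum,
        ENNReal.rpow_one]
      exact hdual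
    have h3 := ENNReal.rpow_le_rpow h2 hp0.le
    rw [← ENNReal.rpow_mul, one_div_mul_cancel hp0.ne', ENNReal.rpow_one,
      ENNReal.mul_rpow_of_nonneg _ _ hp0.le, ← ENNReal.rpow_mul, ← ENNReal.rpow_mul,
      one_div_mul_cancel hp0.ne', ENNReal.rpow_one, mul_comm, one_div_mul_eq_div] at h3
    exact h3
  have hcov : AECover volume Filter.atTop fun N : ℕ => Ioc (-(N : ℝ)) N :=
    aecover_Ioc (Filter.tendsto_neg_atTop_atBot.comp tendsto_natCast_atTop_atTop)
      tendsto_natCast_atTop_atTop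
  exact le_of_tendsto' (hcov.lintegral_tendsto_of_nat (f := fun x => ‖v x‖ₑ ^ p)
    (hvc.measurable.enorm.pow_const p).aemeasurable) hstep

/-- Tensor product of two regularized Hilbert transforms, acting on functions on the plane. -/
def dblHilbert (δ : ℝ) (f : ℂ → ℂ) (z : ℂ) : ℂ :=
  hilbertReg δ (fun s => hilbertReg δ (fun t => f ⟨s, t⟩) z.im) z.re

lemma continuous_complex_mk : Continuous fun q : ℝ × ℝ => (⟨q.1, q.2⟩ : ℂ) :=
  Complex.equivRealProdCLM.symm.continuous

lemma lintegral_complex_eq {F : ℂ → ℝ≥0∞} (hF : Measurable F) :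
    ∫⁻ z, F z = ∫⁻ s : ℝ, ∫⁻ t : ℝ, F ⟨s, t⟩ := by
  have := (Complex.volume_preserving_equiv_real_prod.symm).lintegral_comp hF
  rw [← this, Measure.volume_eq_prod, lintegral_prod]
  · rfl
  · exact (hF.comp Complex.measurableEquivRealProd.symm.measurable).aemeasurable

lemma integral_complex_eq {F : ℂ → ℂ} (hF : Integrable F) :
    ∫ z, F z = ∫ s : ℝ, ∫ t : ℝ, F ⟨s, t⟩ := by
  have h1 := (Complex.volume_preserving_equiv_real_prod.symm).integral_comp
    Complex.measurableEquivRealProd.symm.measurableEmbedding F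
  rw [← h1, Measure.volume_eq_prod, integral_prod]
  · rfl
  · exact ((Complex.volume_preserving_equiv_real_prod.symm).integrable_comp_emb
      Complex.measurableEquivRealProd.symm.measurableEmbedding).2 hF

lemma hasCompactSupport_mk_left {f : ℂ → ℂ} (hc : HasCompactSupport f) (s : ℝ) :
    HasCompactSupport fun t : ℝ => f ⟨s, t⟩ := by
  refine HasCompactSupport.intro (hc.isCompact.image Complex.continuous_im) fun t ht => ?_
  exact image_eq_zero_of_notMem_tsupport fun h => ht ⟨_, h, rfl⟩

lemma continuous_hilbertReg_param {δ : ℝ} (hδ : 0 < δ) {f : ℂ → ℂ} (hf : Continuous f)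
    (hc : HasCompactSupport f) :
    Continuous fun q : ℝ × ℝ => hilbertReg δ (fun t => f ⟨q.1, t⟩) q.2 := by
  have h : (fun q : ℝ × ℝ => hilbertReg δ (fun t => f ⟨q.1, t⟩) q.2) = fun q : ℝ × ℝ =>
      ∫ t in Complex.im '' tsupport f, (conjPoisson δ (q.2 - t) : ℂ) * f ⟨q.1, t⟩ := by
    ext q
    refine (setIntegral_eq_integral_of_forall_compl_eq_zero fun t ht => ?_).symm
    have : f ⟨q.1, t⟩ = 0 := image_eq_zero_of_notMem_tsupport fun h => ht ⟨_, h, rfl⟩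
    simp [this]
  rw [h]
  refine continuous_parametric_integral_of_continuous ?_ (hc.isCompact.image Complex.continuous_im)
  exact (Complex.continuous_ofReal.comp ((continuous_conjPoisson hδ).comp (by fun_prop))).mul
    (hf.comp (continuous_complex_mk.comp
      (by fun_prop : Continuous fun q : (ℝ × ℝ) × ℝ => (q.1.1, q.2))))

lemma hasCompactSupport_hilbertReg_param (δ : ℝ) {f : ℂ → ℂ} (hc : HasCompactSupport f) (y : ℝ) :
    HasCompactSupport fun s => hilbertReg δ (fun t => f ⟨s, t⟩) y := by
  refine HasCompactSupport.intro (hc.isCompact.image Complex.continuous_re) fun s hs => ?_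
  have : ∀ t, f ⟨s, t⟩ = 0 := fun t =>
    image_eq_zero_of_notMem_tsupport fun h => hs ⟨_, h, rfl⟩
  simp [hilbertReg, this]

lemma continuous_conjPoisson_mul {δ : ℝ} (hδ : 0 < δ) :
    Continuous fun w : ℂ => ((conjPoisson δ w.re * conjPoisson δ w.im : ℝ) : ℂ) := by
  have := continuous_conjPoisson hδ
  exact Complex.continuous_ofReal.comp ((this.comp Complex.continuous_re).mul
    (this.comp Complex.continuous_im))

lemma dblHilbert_eq_integral {δ : ℝ} (hδ : 0 < δ) {f : ℂ → ℂ} (hf : Continuous f)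
    (hc : HasCompactSupport f) (z : ℂ) :
    dblHilbert δ f z =
      ∫ w, ((conjPoisson δ (z - w).re * conjPoisson δ (z - w).im : ℝ) : ℂ) * f w := by
  rw [integral_complex_eq]
  · simp only [dblHilbert, hilbertReg, ← integral_const_mul]
    congr 1; ext s; congr 1; ext t
    simp; ring
  · refine Continuous.integrable_of_hasCompactSupport ?_ hc.mul_left
    exact ((continuous_conjPoisson_mul hδ).comp (by fun_prop)).mul hf

lemma continuous_dblHilbert {δ : ℝ} (hδ : 0 < δ) {f : ℂ → ℂ} (hf : Continuous f)
    (hc : HasCompactSupport f) : Continuous (dblHilbert δ f) := by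
  have h : dblHilbert δ f = fun z => ∫ w in tsupport f,
      ((conjPoisson δ (z - w).re * conjPoisson δ (z - w).im : ℝ) : ℂ) * f w := by
    ext z
    rw [dblHilbert_eq_integral hδ hf hc]
    refine (setIntegral_eq_integral_of_forall_compl_eq_zero fun s hs => ?_).symm
    simp [image_eq_zero_of_notMem_tsupport hs]
  rw [h]
  refine continuous_parametric_integral_of_continuous ?_ hc.isCompact
  exact ((continuous_conjPoisson_mul hδ).comp (by fun_prop)).mul (hf.comp continuous_snd)

lemma lintegral_dblHilbert_rpow_le {p : ℝ} (hp : 1 < p) :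
    ∃ C : ℝ≥0∞, C ≠ ∞ ∧ ∀ δ > 0, ∀ f : ℂ → ℂ, Continuous f → HasCompactSupport f →
      ∫⁻ z, ‖dblHilbert δ f z‖ₑ ^ p ≤ C * ∫⁻ z, ‖f z‖ₑ ^ p := by
  obtain ⟨C, hC, H⟩ := lintegral_hilbertReg_rpow_le hp
  refine ⟨C * C, ENNReal.mul_ne_top hC hC, fun δ hδ f hf hc => ?_⟩
  have hF := continuous_hilbertReg_param hδ hf hc
  have hFm : Measurable fun q : ℝ × ℝ => ‖hilbertReg δ (fun t => f ⟨q.1, t⟩) q.2‖ₑ ^ p :=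
    hF.measurable.enorm.pow_const p
  have hDm : Measurable fun z => ‖dblHilbert δ f z‖ₑ ^ p :=
    (continuous_dblHilbert hδ hf hc).measurable.enorm.pow_const p
  rw [lintegral_complex_eq hDm, lintegral_complex_eq (hf.measurable.enorm.pow_const p),
    lintegral_lintegral_swap (f := fun s t => ‖dblHilbert δ f ⟨s, t⟩‖ₑ ^ p)
      (hDm.comp continuous_complex_mk.measurable).aemeasurable]
  calc ∫⁻ y : ℝ, ∫⁻ x : ℝ, ‖dblHilbert δ f ⟨x, y⟩‖ₑ ^ p
      ≤ ∫⁻ y : ℝ, C * ∫⁻ s : ℝ, ‖hilbertReg δ (fun t => f ⟨s, t⟩) y‖ₑ ^ p :=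
        lintegral_mono fun y => H δ hδ _ (hF.comp (by fun_prop : Continuous fun s : ℝ => (s, y)))
          (hasCompactSupport_hilbertReg_param δ hc y)
    _ = C * ∫⁻ s : ℝ, ∫⁻ y : ℝ, ‖hilbertReg δ (fun t => f ⟨s, t⟩) y‖ₑ ^ p := by
        rw [lintegral_const_mul' _ _ hC]
        congr 1
        exact (lintegral_lintegral_swap hFm.aemeasurable).symm
    _ ≤ C * ∫⁻ s : ℝ, C * ∫⁻ t : ℝ, ‖f ⟨s, t⟩‖ₑ ^ p := by
        gcongr with s
        exact H δ hδ _ (hf.comp (continuous_complex_mk.comp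
          (by fun_prop : Continuous fun t : ℝ => (s, t)))) (hasCompactSupport_mk_left hc s)
    _ = _ := by rw [lintegral_const_mul' _ _ hC, mul_assoc]

lemma measurePreserving_mul_left {u : ℂ} (hu : ‖u‖ = 1) : MeasurePreserving fun z : ℂ => u * z :=
  (rotation ⟨u, mem_sphere_zero_iff_norm.2 hu⟩).measurePreserving

/-- Average of the operators `dblHilbert` over all rotations of the plane, weighted by the
character of degree `-2`. -/
def rotAvg (δ : ℝ) (f : ℂ → ℂ) (z : ℂ) : ℂ :=
  ∫ α in Ioc (-π) π, Complex.exp (-(2 * α * Complex.I)) *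
    dblHilbert δ (fun w => f (Complex.exp (α * Complex.I) * w)) (Complex.exp (-(α * Complex.I)) * z)

lemma norm_exp_neg_mul_I (α : ℝ) : ‖Complex.exp (-(α * Complex.I))‖ = 1 := by
  rw [← neg_mul, ← Complex.ofReal_neg, Complex.norm_exp_ofReal_mul_I]

lemma hasCompactSupport_comp_mul_left {f : ℂ → ℂ} (hc : HasCompactSupport f) {u : ℂ}
    (hu : u ≠ 0) : HasCompactSupport fun w => f (u * w) :=
  hc.comp_homeomorph (Homeomorph.mulLeft₀ u hu)

lemma continuous_dblHilbert_rot {δ : ℝ} (hδ : 0 < δ) {f : ℂ → ℂ} (hf : Continuous f)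
    (hc : HasCompactSupport f) :
    Continuous fun q : ℝ × ℂ => dblHilbert δ (fun w => f (Complex.exp (q.1 * Complex.I) * w))
      (Complex.exp (-(q.1 * Complex.I)) * q.2) := by
  obtain ⟨R, hR⟩ := hc.isCompact.isBounded.subset_closedBall 0
  have h : (fun q : ℝ × ℂ => dblHilbert δ (fun w => f (Complex.exp (q.1 * Complex.I) * w))
      (Complex.exp (-(q.1 * Complex.I)) * q.2)) = fun q : ℝ × ℂ =>
      ∫ w in Metric.closedBall (0 : ℂ) R,
        ((conjPoisson δ (Complex.exp (-(q.1 * Complex.I)) * q.2 - w).re *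
          conjPoisson δ (Complex.exp (-(q.1 * Complex.I)) * q.2 - w).im : ℝ) : ℂ) *
            f (Complex.exp (q.1 * Complex.I) * w) := by
    ext q
    rw [dblHilbert_eq_integral hδ (by fun_prop)
      (hasCompactSupport_comp_mul_left hc (Complex.exp_ne_zero _))]
    refine (setIntegral_eq_integral_of_forall_compl_eq_zero fun w hw => ?_).symm
    rw [image_eq_zero_of_notMem_tsupport (f := f), mul_zero]
    intro h
    apply hw
    have := hR h
    simpa [Complex.norm_exp_ofReal_mul_I] using this
  rw [h]
  refine continuous_parametric_integral_of_continuous ?_ (isCompact_closedBall _ _)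
  exact ((continuous_conjPoisson_mul hδ).comp (by fun_prop)).mul (hf.comp (by fun_prop))

lemma lintegral_rotAvg_rpow_le {p : ℝ} (hp : 1 < p) :
    ∃ C : ℝ≥0∞, C ≠ ∞ ∧ ∀ δ > 0, ∀ f : ℂ → ℂ, Continuous f → HasCompactSupport f →
      ∫⁻ z, ‖rotAvg δ f z‖ₑ ^ p ≤ C * ∫⁻ z, ‖f z‖ₑ ^ p := by
  obtain ⟨C, hC, H⟩ := lintegral_dblHilbert_rpow_le hp
  set V : ℝ≥0∞ := (volume.restrict (Ioc (-π) π)) univ with hV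
  have hVt : V ≠ ∞ := measure_ne_top _ _
  refine ⟨V ^ (p - 1) * (C * V), ENNReal.mul_ne_top
    (ENNReal.rpow_ne_top_of_nonneg (by linarith) hVt) (ENNReal.mul_ne_top hC hVt),
    fun δ hδ f hf hc => ?_⟩
  set D : ℝ → ℂ → ℂ := fun α z => dblHilbert δ (fun w => f (Complex.exp (α * Complex.I) * w))
      (Complex.exp (-(α * Complex.I)) * z) with hD
  have hDc : Continuous fun q : ℝ × ℂ => D q.1 q.2 := continuous_dblHilbert_rot hδ hf hc
  have hrot : ∀ α : ℝ, ∫⁻ z, ‖D α z‖ₑ ^ p ≤ C * ∫⁻ z, ‖f z‖ₑ ^ p := by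
    intro α
    have hu : ‖Complex.exp (α * Complex.I)‖ = 1 := Complex.norm_exp_ofReal_mul_I α
    have hc' := hasCompactSupport_comp_mul_left hc (Complex.exp_ne_zero (α * Complex.I))
    have hf' : Continuous fun w => f (Complex.exp (α * Complex.I) * w) := by fun_prop
    have e1 := (measurePreserving_mul_left (norm_exp_neg_mul_I α)).lintegral_comp
      ((continuous_dblHilbert hδ hf' hc').measurable.enorm.pow_const p)
    have e2 := (measurePreserving_mul_left hu).lintegral_comp
      (hf.measurable.enorm.pow_const p)
    rw [← e2]
    exact e1.trans_le (H δ hδ _ hf' hc')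
  calc ∫⁻ z, ‖rotAvg δ f z‖ₑ ^ p
      ≤ ∫⁻ z, V ^ (p - 1) * ∫⁻ α in Ioc (-π) π, ‖D α z‖ₑ ^ p := by
        refine lintegral_mono fun z => ?_
        refine le_trans (ENNReal.rpow_le_rpow (enorm_integral_le_lintegral_enorm _)
          (by linarith)) ?_
        have : ∀ α : ℝ, ‖Complex.exp (-(2 * α * Complex.I)) * D α z‖ₑ = ‖D α z‖ₑ := fun α => by
          have := norm_exp_neg_mul_I (2 * α)
          push_cast at this
          rw [enorm_mul, ← ofReal_norm, this, ENNReal.ofReal_one, one_mul]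
        simp only [D] at this
        simp only [this]
        exact lintegral_rpow_le_measure_univ_mul hp
          (hDc.comp (by fun_prop : Continuous fun α : ℝ => (α, z))).measurable.enorm.aemeasurable
    _ = V ^ (p - 1) * ∫⁻ α in Ioc (-π) π, ∫⁻ z, ‖D α z‖ₑ ^ p := by
        rw [lintegral_const_mul' _ _ (ENNReal.rpow_ne_top_of_nonneg (by linarith) hVt)]
        congr 1
        exact (lintegral_lintegral_swap (hDc.measurable.enorm.pow_const p).aemeasurable).symm
    _ ≤ V ^ (p - 1) * ∫⁻ α in Ioc (-π) π, C * ∫⁻ z, ‖f z‖ₑ ^ p := by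
        gcongr with α
        exact hrot α
    _ = _ := by
        rw [lintegral_const]; ring

/-- The Wirtinger derivative `∂/∂z̄`. -/
def wirtBar (g : ℂ → ℂ) (w : ℂ) : ℂ :=
  (1 / 2) * (fderiv ℝ g w 1 + Complex.I * fderiv ℝ g w Complex.I)

/-- The Wirtinger derivative `∂/∂z`. -/
def wirt (g : ℂ → ℂ) (w : ℂ) : ℂ :=
  (1 / 2) * (fderiv ℝ g w 1 - Complex.I * fderiv ℝ g w Complex.I)

lemma fderiv_eq_wirt (g : ℂ → ℂ) (w u : ℂ) :
    fderiv ℝ g w u = wirt g w * u + wirtBar g w * starRingEnd ℂ u := by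
  have h : u = u.re • (1 : ℂ) + u.im • Complex.I := by
    conv_lhs => rw [← Complex.re_add_im u]
    simp
  have hu : starRingEnd ℂ u = (u.re : ℂ) - u.im * Complex.I := by
    apply Complex.ext <;> simp
  conv_lhs => rw [h, map_add, map_smul, map_smul]
  rw [hu]
  conv_rhs => rw [← Complex.re_add_im u]
  simp only [wirt, wirtBar, Complex.real_smul, Complex.add_re, Complex.add_im, Complex.ofReal_re,
    Complex.ofReal_im, Complex.mul_re, Complex.mul_im, Complex.I_re, Complex.I_im, mul_zero,
    mul_one, sub_zero, add_zero, zero_add]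
  linear_combination (fderiv ℝ g w Complex.I * u.im) * Complex.I_mul_I

/-- Angular Fourier coefficient of degree `2` of `h` on the circle of radius `r`. -/
def angMean (h : ℂ → ℂ) (r : ℝ) : ℂ :=
  ∫ y in (-π)..π, Complex.exp (-(2 * y * Complex.I)) * h (r * Complex.exp (y * Complex.I))

lemma continuous_angMean {h : ℂ → ℂ} (hh : Continuous h) : Continuous (angMean h) := by
  unfold angMean
  exact intervalIntegral.continuous_parametric_intervalIntegral_of_continuous' (by fun_prop) _ _

lemma continuous_wirtBar {g : ℂ → ℂ} (hg : ContDiff ℝ 1 g) : Continuous (wirtBar g) := by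
  have := hg.continuous_fderiv one_ne_zero
  unfold wirtBar
  fun_prop

lemma integral_angMean_wirtBar_div {φ : ℂ → ℂ} (hφ : ContDiff ℝ 1 φ) {ε R : ℝ} (hε : 0 < ε)
    (hεR : ε < R) (hR : ∀ w, R ≤ ‖w‖ → φ w = 0) :
    ∫ r in ε..R, (r : ℂ)⁻¹ * angMean (wirtBar φ) r =
      -(1 / 2) * ∫ y in (-π)..π, φ (ε * Complex.exp (y * Complex.I)) /
        (ε * Complex.exp (y * Complex.I)) := by
  have hR0 : 0 < R := hε.trans hεR
  have hsub : ∫ s in (log ε)..(log R), angMean (wirtBar φ) (rexp s) =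
      ∫ r in ε..R, (r : ℂ)⁻¹ * angMean (wirtBar φ) r := by
    have := intervalIntegral.integral_deriv_smul_comp' (a := log ε) (b := log R) (f := rexp)
      (f' := rexp) (g := fun r : ℝ => (r : ℂ)⁻¹ * angMean (wirtBar φ) r)
      (fun x _ => Real.hasDerivAt_exp x) Real.continuous_exp.continuousOn (by
        refine ContinuousOn.mul (ContinuousOn.inv₀ (by fun_prop) ?_)
          (continuous_angMean (continuous_wirtBar hφ)).continuousOn
        rintro x ⟨y, _, rfl⟩
        exact_mod_cast (Real.exp_pos y).ne')
    rw [Real.exp_log hε, Real.exp_log hR0] at this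
    rw [← this]
    congr 1; ext s
    have : (rexp s : ℂ) ≠ 0 := by exact_mod_cast (Real.exp_pos s).ne'
    simp only [Function.comp, Complex.real_smul]
    rw [mul_inv_cancel_left₀ this]
  rw [← hsub]
  set F : ℂ → ℂ := fun ζ => φ (Complex.exp ζ) * Complex.exp (-ζ) with hF
  have hFs : ContDiff ℝ 1 F := by
    exact (hφ.comp Complex.contDiff_exp).mul (Complex.contDiff_exp.comp contDiff_neg)
  have hkey : ∀ ζ, Complex.I • fderiv ℝ F ζ 1 - fderiv ℝ F ζ Complex.I =
      2 * Complex.I * Complex.exp (-ζ) * (wirtBar φ (Complex.exp ζ) *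
        starRingEnd ℂ (Complex.exp ζ)) := by
    intro ζ
    have e1 : HasFDerivAt Complex.exp
        ((ContinuousLinearMap.toSpanSingleton ℂ (Complex.exp ζ)).restrictScalars ℝ) ζ :=
      (Complex.hasDerivAt_exp ζ).hasFDerivAt.restrictScalars ℝ
    have e2 : HasFDerivAt (fun ζ => Complex.exp (-ζ))
        ((ContinuousLinearMap.toSpanSingleton ℂ (-Complex.exp (-ζ))).restrictScalars ℝ) ζ := by
      have := ((Complex.hasDerivAt_exp (-ζ)).comp ζ (hasDerivAt_neg ζ))
      simpa [Function.comp_def] using this.hasFDerivAt.restrictScalars ℝ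
    have e3 := ((hφ.differentiable one_ne_zero (Complex.exp ζ)).hasFDerivAt.comp ζ e1).mul e2
    have e4 : fderiv ℝ F ζ = _ := e3.fderiv
    rw [e4]
    simp only [add_apply, smul_apply,
      ContinuousLinearMap.coe_restrictScalars', ContinuousLinearMap.toSpanSingleton_apply,
      ContinuousLinearMap.comp_apply, smul_eq_mul, one_mul, Function.comp, fderiv_eq_wirt φ,
      map_mul, Complex.conj_I]
    ring
  have hrect := Complex.integral_boundary_rect_of_hasFDerivAt_real_off_countable F (fderiv ℝ F)
    ⟨log ε, -π⟩ ⟨log R, π⟩ ∅ countable_empty hFs.continuous.continuousOn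
    (fun x _ => (hFs.differentiable one_ne_zero x).hasFDerivAt) (by
      refine ContinuousOn.integrableOn_compact (isCompact_uIcc.reProdIm isCompact_uIcc) ?_
      have := hFs.continuous_fderiv one_ne_zero
      fun_prop)
  simp only [hkey] at hrect
  have hper : ∀ x : ℝ, F (x + (-π : ℝ) * Complex.I) = F (x + (π : ℝ) * Complex.I) := by
    intro x
    simp only [F]
    have h1 : Complex.exp (x + (-π : ℝ) * Complex.I) = Complex.exp (x + (π : ℝ) * Complex.I) := by
      rw [← Complex.exp_periodic]; congr 1; push_cast; ring
    rw [Complex.exp_neg, Complex.exp_neg, h1]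
  have hend : ∀ y : ℝ, F (log R + y * Complex.I) = 0 := by
    intro y
    simp only [F]
    rw [hR, zero_mul]
    simp [Complex.norm_exp, Real.exp_log hR0]
  have hstart : ∀ y : ℝ, F (log ε + y * Complex.I) =
      φ (ε * Complex.exp (y * Complex.I)) / (ε * Complex.exp (y * Complex.I)) := by
    intro y
    simp only [F]
    rw [Complex.exp_neg, Complex.exp_add, ← Complex.ofReal_exp, Real.exp_log hε, div_eq_mul_inv]
  have hin : ∀ x y : ℝ, 2 * Complex.I * Complex.exp (-(x + y * Complex.I)) *
      (wirtBar φ (Complex.exp (x + y * Complex.I)) *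
        starRingEnd ℂ (Complex.exp (x + y * Complex.I))) =
      2 * Complex.I * (Complex.exp (-(2 * y * Complex.I)) *
        wirtBar φ ((rexp x : ℝ) * Complex.exp (y * Complex.I))) := by
    intro x y
    rw [← Complex.exp_conj]
    have : Complex.exp (-(x + y * Complex.I)) * Complex.exp ((starRingEnd ℂ) (x + y * Complex.I)) =
        Complex.exp (-(2 * y * Complex.I)) := by
      rw [← Complex.exp_add]; congr 1
      simp; ring
    rw [← this, Complex.exp_add (x : ℂ), Complex.ofReal_exp]
    ring
  simp only [hper, hend, hin, hstart, sub_self, intervalIntegral.integral_zero,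
    zero_add, intervalIntegral.integral_const_mul, smul_eq_mul] at hrect
  simp only [angMean]
  have hI := Complex.I_ne_zero
  apply mul_left_cancel₀ (mul_ne_zero two_ne_zero hI)
  rw [← hrect]
  ring

lemma integral_exp_mul_I_eq_zero {c : ℂ} {n : ℤ} (hn : n ≠ 0) (hc : c = n * Complex.I) :
    ∫ y in (-π)..π, Complex.exp (c * y) = 0 := by
  have hc0 : c ≠ 0 := by
    rw [hc]; exact mul_ne_zero (by exact_mod_cast hn) Complex.I_ne_zero
  rw [integral_exp_mul_complex hc0]
  have : Complex.exp (c * π) = Complex.exp (c * (-π : ℝ)) := by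
    rw [Complex.exp_eq_exp_iff_exists_int]
    exact ⟨n, by rw [hc]; push_cast; ring⟩
  rw [this]; simp

open Filter Topology in
lemma tendsto_integral_circle_div {φ : ℂ → ℂ} (hφ : ContDiff ℝ 1 φ) (hc : HasCompactSupport φ) :
    Tendsto (fun ε : ℝ => ∫ y in (-π)..π, φ (ε * Complex.exp (y * Complex.I)) /
        (ε * Complex.exp (y * Complex.I))) (𝓝[>] 0) (𝓝 (2 * π * wirt φ 0)) := by
  obtain ⟨L, hL⟩ := hφ.lipschitzWith_of_hasCompactSupport hc one_ne_zero
  have hval : ∫ y in (-π)..π, Complex.exp (-(y * Complex.I)) *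
      fderiv ℝ φ 0 (Complex.exp (y * Complex.I)) = 2 * π * wirt φ 0 := by
    have : ∀ y : ℝ, Complex.exp (-(y * Complex.I)) * fderiv ℝ φ 0 (Complex.exp (y * Complex.I)) =
        wirt φ 0 + wirtBar φ 0 * Complex.exp (((-2 : ℤ) * Complex.I) * y) := by
      intro y
      rw [fderiv_eq_wirt, ← Complex.exp_conj]
      have h1 : Complex.exp (-(y * Complex.I)) * Complex.exp (y * Complex.I) = 1 := by
        rw [← Complex.exp_add]; simp
      have h2 : Complex.exp (-(y * Complex.I)) * Complex.exp ((starRingEnd ℂ) (y * Complex.I)) =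
          Complex.exp (((-2 : ℤ) * Complex.I) * y) := by
        rw [← Complex.exp_add]; congr 1; simp; ring
      rw [← h2]
      linear_combination wirt φ 0 * h1
    simp only [this]
    rw [intervalIntegral.integral_add (by simp) (Continuous.intervalIntegrable (by fun_prop) _ _),
      intervalIntegral.integral_const, intervalIntegral.integral_const_mul,
      integral_exp_mul_I_eq_zero (n := -2) (by norm_num) rfl]
    simp [← two_mul]
  rw [← hval]
  have hsub : ∀ᶠ ε : ℝ in 𝓝[>] 0, ∫ y in (-π)..π, (φ (ε * Complex.exp (y * Complex.I)) - φ 0) /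
        (ε * Complex.exp (y * Complex.I)) = ∫ y in (-π)..π, φ (ε * Complex.exp (y * Complex.I)) /
        (ε * Complex.exp (y * Complex.I)) := by
    filter_upwards [self_mem_nhdsWithin] with ε hε
    have hε' : (ε : ℂ) ≠ 0 := by exact_mod_cast (ne_of_gt hε)
    simp only [sub_div]
    rw [intervalIntegral.integral_sub]
    · rw [sub_eq_self]
      have : ∀ y : ℝ, φ 0 / (ε * Complex.exp (y * Complex.I)) =
          φ 0 / ε * Complex.exp (((-1 : ℤ) * Complex.I) * y) := by
        intro y
        have : ((-1 : ℤ) * Complex.I) * y = -(y * Complex.I) := by push_cast; ring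
        rw [this, Complex.exp_neg]; field_simp
      simp only [this]
      rw [intervalIntegral.integral_const_mul, integral_exp_mul_I_eq_zero (n := -1) (by norm_num) rfl,
        mul_zero]
    · refine Continuous.intervalIntegrable (Continuous.div (hφ.continuous.comp (by fun_prop))
        (by fun_prop) fun y => mul_ne_zero hε' (Complex.exp_ne_zero _)) _ _
    · refine Continuous.intervalIntegrable (Continuous.div (by fun_prop)
        (by fun_prop) fun y => mul_ne_zero hε' (Complex.exp_ne_zero _)) _ _
  refine Tendsto.congr' hsub ?_
  refine intervalIntegral.tendsto_integral_filter_of_dominated_convergence (fun _ => (L : ℝ))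
    ?_ ?_ (by simp) ?_
  · filter_upwards [self_mem_nhdsWithin] with ε hε
    have hε' : (ε : ℂ) ≠ 0 := by exact_mod_cast (ne_of_gt hε)
    exact (Continuous.div ((hφ.continuous.comp (by fun_prop)).sub continuous_const)
        (by fun_prop) fun y => mul_ne_zero hε' (Complex.exp_ne_zero _)).aestronglyMeasurable
  · filter_upwards [self_mem_nhdsWithin] with ε hε
    refine ae_of_all _ fun y _ => ?_
    have hε' : (ε : ℂ) ≠ 0 := by exact_mod_cast (ne_of_gt hε)
    rw [norm_div, div_le_iff₀ (norm_pos_iff.2 (mul_ne_zero hε' (Complex.exp_ne_zero _)))]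
    simpa using hL.norm_sub_le (ε * Complex.exp (y * Complex.I)) 0
  · refine ae_of_all _ fun y _ => ?_
    have h := (hφ.differentiable one_ne_zero 0).hasFDerivAt.hasLineDerivAt
      (Complex.exp (y * Complex.I))
    have h2 := h.tendsto_slope_zero
    simp only [zero_add] at h2
    have h3 := (h2.const_mul (Complex.exp (-(y * Complex.I)))).mono_left
      (nhdsWithin_mono (0 : ℝ) fun x (hx : 0 < x) => (ne_of_gt hx : x ≠ 0))
    refine h3.congr fun ε => ?_
    simp [Complex.exp_neg, div_eq_mul_inv]
    ring

lemma angMean_eq_zero {h : ℂ → ℂ} {R r : ℝ} (hR : ∀ w, R ≤ ‖w‖ → h w = 0) (hr : 0 ≤ r)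
    (hRr : R ≤ r) : angMean h r = 0 := by
  have : ∀ y : ℝ, h (r * Complex.exp (y * Complex.I)) = 0 := fun y => hR _ (by
    rwa [norm_mul, Complex.norm_exp_ofReal_mul_I, mul_one, Complex.norm_real,
      Real.norm_of_nonneg hr])
  simp [angMean, this]

lemma norm_angMean_le {h : ℂ → ℂ} {L : ℝ≥0} (hL : LipschitzWith L h) {r : ℝ} (hr : 0 ≤ r) :
    ‖angMean h r‖ ≤ 2 * π * L * r := by
  have hc := hL.continuous
  have e : angMean h r = ∫ y in (-π)..π, Complex.exp (-(2 * y * Complex.I)) *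
      (h (r * Complex.exp (y * Complex.I)) - h 0) := by
    simp only [mul_sub]
    rw [intervalIntegral.integral_sub (Continuous.intervalIntegrable (by fun_prop) _ _)
      (Continuous.intervalIntegrable (by fun_prop) _ _), intervalIntegral.integral_mul_const]
    have : ∀ y : ℝ, Complex.exp (-(2 * y * Complex.I)) =
        Complex.exp (((-2 : ℤ) * Complex.I) * y) := fun y => by
      congr 1; push_cast; ring
    simp only [this]
    rw [integral_exp_mul_I_eq_zero (n := -2) (by norm_num) rfl, zero_mul, sub_zero]
    simp only [← this]; rfl
  rw [e]
  refine (intervalIntegral.norm_integral_le_of_norm_le_const (C := L * r) fun y _ => ?_).trans_eq ?_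
  · have h1 := norm_exp_neg_mul_I (2 * y)
    push_cast at h1
    rw [norm_mul, h1, one_mul]
    refine (hL.norm_sub_le _ _).trans_eq ?_
    rw [sub_zero, norm_mul, Complex.norm_exp_ofReal_mul_I, mul_one, Complex.norm_real,
      Real.norm_of_nonneg hr]
  · rw [abs_of_nonneg (by linarith [Real.pi_pos])]; ring

lemma integrableOn_indicator_Ioi {C R : ℝ} :
    IntegrableOn ((Ioc 0 R).indicator fun _ => C) (Ioi 0) :=
  ((integrable_indicator_iff measurableSet_Ioc).2 (integrableOn_const (by simp))).integrableOn

lemma norm_inv_mul_angMean_le {h : ℂ → ℂ} {L : ℝ≥0} (hL : LipschitzWith L h) {R : ℝ}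
    (hR : ∀ w, R ≤ ‖w‖ → h w = 0) {r : ℝ} (hr : 0 < r) :
    ‖(r : ℂ)⁻¹ * angMean h r‖ ≤ (Ioc 0 R).indicator (fun _ => 2 * π * L) r := by
  by_cases hrR : r ≤ R
  · rw [indicator_of_mem (show r ∈ Ioc 0 R from ⟨hr, hrR⟩), norm_mul, norm_inv, Complex.norm_real,
      Real.norm_of_nonneg hr.le, inv_mul_le_iff₀ hr, mul_comm r]
    exact norm_angMean_le hL hr.le
  · rw [angMean_eq_zero hR hr.le (not_le.1 hrR).le, mul_zero, norm_zero]
    exact indicator_nonneg (fun _ _ => by positivity) _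

lemma aestronglyMeasurable_inv_mul_angMean {h : ℂ → ℂ} (hh : Continuous h) :
    AEStronglyMeasurable (fun r : ℝ => (r : ℂ)⁻¹ * angMean h r) (volume.restrict (Ioi 0)) := by
  refine Measurable.aestronglyMeasurable ?_
  exact (Complex.measurable_ofReal.inv).mul (continuous_angMean hh).measurable

lemma integrableOn_inv_mul_angMean {h : ℂ → ℂ} {L : ℝ≥0} (hL : LipschitzWith L h) {R : ℝ}
    (hR : ∀ w, R ≤ ‖w‖ → h w = 0) :
    IntegrableOn (fun r : ℝ => (r : ℂ)⁻¹ * angMean h r) (Ioi 0) := by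
  refine Integrable.mono' (integrableOn_indicator_Ioi (C := 2 * π * L) (R := R))
    (aestronglyMeasurable_inv_mul_angMean hL.continuous) ?_
  filter_upwards [ae_restrict_mem measurableSet_Ioi] with r hr
  exact norm_inv_mul_angMean_le hL hR hr

lemma exists_pos_forall_eq_zero {g : ℂ → ℂ} (hc : HasCompactSupport g) :
    ∃ R : ℝ, 0 < R ∧ ∀ w, R ≤ ‖w‖ → g w = 0 := by
  obtain ⟨R, hR, h⟩ := hc.isCompact.isBounded.subset_ball_lt 0 0
  refine ⟨R, hR, fun w hw => image_eq_zero_of_notMem_tsupport fun hm => ?_⟩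
  have := h hm
  rw [mem_ball_zero_iff] at this
  linarith

lemma tsupport_wirtBar_subset (g : ℂ → ℂ) : tsupport (wirtBar g) ⊆ tsupport g := by
  refine closure_minimal (fun w hw => ?_) (isClosed_tsupport g)
  by_contra h
  apply hw
  have : fderiv ℝ g w = 0 := by
    by_contra hne
    exact h (support_fderiv_subset ℝ hne)
  simp [wirtBar, this]

lemma HasCompactSupport.wirtBar {g : ℂ → ℂ} (hc : HasCompactSupport g) :
    HasCompactSupport (wirtBar g) :=
  hc.isCompact.of_isClosed_subset (isClosed_tsupport _) (tsupport_wirtBar_subset g)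

lemma contDiff_wirtBar {g : ℂ → ℂ} (hg : ContDiff ℝ 2 g) : ContDiff ℝ 1 (wirtBar g) := by
  have h : ContDiff ℝ 1 (fderiv ℝ g) := hg.fderiv_right (by norm_num)
  exact contDiff_const.mul ((h.clm_apply contDiff_const).add
    (contDiff_const.mul (h.clm_apply contDiff_const)))

open Filter Topology in
lemma integral_inv_mul_angMean_wirtBar {φ : ℂ → ℂ} (hφ : ContDiff ℝ 2 φ)
    (hc : HasCompactSupport φ) :
    ∫ r in Ioi (0 : ℝ), (r : ℂ)⁻¹ * angMean (wirtBar φ) r = -π * wirt φ 0 := by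
  have hφ1 : ContDiff ℝ 1 φ := hφ.of_le (by norm_num)
  obtain ⟨R, hR0, hR⟩ := exists_pos_forall_eq_zero hc
  obtain ⟨R', hR'0, hR'⟩ := exists_pos_forall_eq_zero hc.wirtBar
  obtain ⟨L, hL⟩ := (contDiff_wirtBar hφ).lipschitzWith_of_hasCompactSupport hc.wirtBar one_ne_zero
  set M := max R R'
  have hM0 : 0 < M := lt_max_of_lt_left hR0
  have h_int := integrableOn_inv_mul_angMean hL hR'
  have e1 : ∫ r in Ioi (0 : ℝ), (r : ℂ)⁻¹ * angMean (wirtBar φ) r =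
      ∫ r in (0 : ℝ)..M, (r : ℂ)⁻¹ * angMean (wirtBar φ) r := by
    rw [intervalIntegral.integral_of_le hM0.le]
    refine (setIntegral_eq_of_subset_of_forall_sdiff_eq_zero measurableSet_Ioi
      (fun x hx => hx.1) ?_)
    rintro r ⟨hr, hr'⟩
    have hr0 : 0 < r := hr
    have : M < r := by
      by_contra! h
      exact hr' ⟨hr, h⟩
    rw [angMean_eq_zero hR' hr0.le ((le_max_right _ _).trans this.le), mul_zero]
  have e2 : Tendsto (fun ε : ℝ => ∫ r in ε..M, (r : ℂ)⁻¹ * angMean (wirtBar φ) r) (𝓝[>] 0)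
      (𝓝 (∫ r in (0 : ℝ)..M, (r : ℂ)⁻¹ * angMean (wirtBar φ) r)) := by
    have hcont := intervalIntegral.continuousOn_primitive_interval_left (μ := volume)
      (f := fun r : ℝ => (r : ℂ)⁻¹ * angMean (wirtBar φ) r) (a := 0) (b := M) (by
        rw [uIcc_of_le hM0.le, integrableOn_Icc_iff_integrableOn_Ioc]
        exact h_int.mono_set fun x hx => hx.1)
    have h0 := hcont 0 left_mem_uIcc
    rw [uIcc_of_le hM0.le] at h0
    refine h0.mono_left ?_
    rw [← nhdsWithin_Ioc_eq_nhdsGT hM0]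
    exact nhdsWithin_mono _ Ioc_subset_Icc_self
  have e3 := (tendsto_integral_circle_div hφ1 hc).const_mul (-(1 / 2) : ℂ)
  rw [e1]
  refine tendsto_nhds_unique e2 ?_
  have : -π * wirt φ 0 = -(1 / 2) * (2 * π * wirt φ 0) := by ring
  rw [this]
  refine e3.congr' ?_
  filter_upwards [Ioo_mem_nhdsGT hM0] with ε hε
  exact (integral_angMean_wirtBar_div hφ1 hε.1 hε.2
    fun w hw => hR w ((le_max_left _ _).trans hw)).symm

lemma integrableOn_of_continuous_of_eq_zero {X : Type*} [TopologicalSpace X] [MeasurableSpace X]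
    [OpensMeasurableSpace X] [T2Space X] [SecondCountableTopology X]
    {μ : Measure X} [IsFiniteMeasureOnCompacts μ]
    {G : X → ℂ} (hG : Continuous G) {K t : Set X} (hK : IsCompact K) (ht : MeasurableSet t)
    (h : ∀ x ∈ t, x ∉ K → G x = 0) : IntegrableOn G t μ :=
  (hG.continuousOn.integrableOn_compact' hK hK.measurableSet).of_forall_sdiff_eq_zero ht
    fun x hx => h x hx.1 hx.2

/-- Angular factor of the kernel of `rotAvg` in polar coordinates. -/
def angFactor (δ r : ℝ) : ℝ :=
  ∫ β in (-π)..π, 2 * ((r * cos β * conjPoisson δ (r * cos β)) *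
    (r * sin β * conjPoisson δ (r * sin β)))

lemma mul_conjPoisson_nonneg (δ x : ℝ) : 0 ≤ x * conjPoisson δ x := by
  rw [conjPoisson, ← mul_div_assoc]; exact div_nonneg (mul_self_nonneg x) (by positivity)

lemma mul_conjPoisson_le_one (δ x : ℝ) : x * conjPoisson δ x ≤ 1 := by
  rw [conjPoisson, ← mul_div_assoc]
  exact div_le_one_of_le₀ (by nlinarith [sq_nonneg δ]) (by positivity)

lemma integral_kernel_circle {δ : ℝ} (hδ : 0 < δ) (r : ℝ) :
    ∫ β in (-π)..π, ((r ^ 2 * (conjPoisson δ (r * cos β) * conjPoisson δ (r * sin β)) : ℝ) : ℂ) *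
      Complex.exp (2 * β * Complex.I) = Complex.I * angFactor δ r := by
  have hk := continuous_conjPoisson hδ
  set A : ℝ → ℝ := fun β =>
    r ^ 2 * (conjPoisson δ (r * cos β) * conjPoisson δ (r * sin β)) * cos (2 * β) with hA
  have hAc : Continuous A := by
    have h1 : Continuous fun β => conjPoisson δ (r * cos β) := hk.comp (by fun_prop)
    have h2 : Continuous fun β => conjPoisson δ (r * sin β) := hk.comp (by fun_prop)
    fun_prop
  have hA0 : ∫ β in (-π)..π, A β = 0 := by
    have h1 := intervalIntegral.integral_comp_neg (a := -π) (b := π) A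
    have h2 : ∀ x, A (-x) = -A x := fun x => by
      simp only [A, cos_neg, sin_neg, mul_neg, conjPoisson_neg]; ring
    simp only [h2, neg_neg, intervalIntegral.integral_neg] at h1
    linarith
  have hB : Continuous fun β => 2 * ((r * cos β * conjPoisson δ (r * cos β)) *
    (r * sin β * conjPoisson δ (r * sin β))) := by
    have h1 : Continuous fun β => conjPoisson δ (r * cos β) := hk.comp (by fun_prop)
    have h2 : Continuous fun β => conjPoisson δ (r * sin β) := hk.comp (by fun_prop)
    fun_prop
  calc _ = ∫ β in (-π)..π, ((A β : ℂ) + Complex.I * ((2 * ((r * cos β * conjPoisson δ (r * cos β)) *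
            (r * sin β * conjPoisson δ (r * sin β))) : ℝ) : ℂ)) := by
        congr 1; ext β
        have : Complex.exp (2 * β * Complex.I) = (cos (2 * β) : ℂ) + (sin (2 * β) : ℝ) * Complex.I := by
          rw [← Complex.exp_ofReal_mul_I_re (2 * β), ← Complex.exp_ofReal_mul_I_im (2 * β)]
          push_cast
          exact (Complex.re_add_im _).symm
        rw [this, Real.sin_two_mul]
        simp only [A]
        push_cast
        ring
    _ = _ := by
        rw [intervalIntegral.integral_add (Continuous.intervalIntegrable (by fun_prop) _ _)
          (Continuous.intervalIntegrable (by fun_prop) _ _), intervalIntegral.integral_ofReal, hA0,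
          intervalIntegral.integral_const_mul, intervalIntegral.integral_ofReal]
        simp [angFactor]

lemma abs_angFactor_le (δ r : ℝ) : |angFactor δ r| ≤ 4 * π := by
  have := intervalIntegral.norm_integral_le_of_norm_le_const (a := -π) (b := π) (C := 2)
    (f := fun β => 2 * ((r * cos β * conjPoisson δ (r * cos β)) *
    (r * sin β * conjPoisson δ (r * sin β)))) fun β _ => by
      have h1 := mul_conjPoisson_nonneg δ (r * cos β)
      have h2 := mul_conjPoisson_nonneg δ (r * sin β)
      rw [Real.norm_of_nonneg (by positivity)]
      nlinarith [mul_conjPoisson_le_one δ (r * cos β), mul_conjPoisson_le_one δ (r * sin β)]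
  rw [abs_of_nonneg (by linarith [Real.pi_pos])] at this
  refine this.trans_eq (by ring)

lemma continuous_angFactor {δ : ℝ} (hδ : 0 < δ) : Continuous (angFactor δ) := by
  have hk := continuous_conjPoisson hδ
  have h1 : Continuous fun q : ℝ × ℝ => conjPoisson δ (q.1 * cos q.2) := hk.comp (by fun_prop)
  have h2 : Continuous fun q : ℝ × ℝ => conjPoisson δ (q.1 * sin q.2) := hk.comp (by fun_prop)
  unfold angFactor
  refine intervalIntegral.continuous_parametric_intervalIntegral_of_continuous' ?_ _ _
  unfold Function.uncurry
  fun_prop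

open Filter Topology in
lemma tendsto_mul_conjPoisson {x : ℝ} (hx : x ≠ 0) :
    Tendsto (fun δ => x * conjPoisson δ x) (𝓝[>] 0) (𝓝 1) := by
  have h : ContinuousAt (fun δ : ℝ => x * (x / (x ^ 2 + δ ^ 2))) 0 := by
    refine ContinuousAt.mul continuousAt_const (ContinuousAt.div continuousAt_const (by fun_prop) ?_)
    simp [hx]
  have h2 := h.tendsto
  have : x * (x / (x ^ 2 + 0 ^ 2)) = 1 := by field_simp; simp
  rw [this] at h2
  exact h2.mono_left nhdsWithin_le_nhds

open Filter Topology in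
lemma tendsto_angFactor {r : ℝ} (hr : 0 < r) :
    Tendsto (fun δ => angFactor δ r) (𝓝[>] 0) (𝓝 (4 * π)) := by
  have e : (4 * π) = ∫ _ in (-π)..π, (2 * (1 * 1) : ℝ) := by
    rw [intervalIntegral.integral_const, smul_eq_mul]; ring
  rw [e]
  refine intervalIntegral.tendsto_integral_filter_of_dominated_convergence (fun _ => (2 : ℝ))
    ?_ ?_ (by simp) ?_
  · filter_upwards [self_mem_nhdsWithin] with δ hδ
    have hk := continuous_conjPoisson hδ
    have h1 : Continuous fun β => conjPoisson δ (r * cos β) := hk.comp (by fun_prop)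
    have h2 : Continuous fun β => conjPoisson δ (r * sin β) := hk.comp (by fun_prop)
    exact Continuous.aestronglyMeasurable (by fun_prop)
  · refine Eventually.of_forall fun δ => ae_of_all _ fun β _ => ?_
    have h1 := mul_conjPoisson_nonneg δ (r * cos β)
    have h2 := mul_conjPoisson_nonneg δ (r * sin β)
    rw [Real.norm_of_nonneg (by positivity)]
    nlinarith [mul_conjPoisson_le_one δ (r * cos β), mul_conjPoisson_le_one δ (r * sin β)]
  · have hfin : {β : ℝ | cos β = 0 ∨ sin β = 0}.Countable := by
      refine Countable.union ?_ ?_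
      · refine (countable_range fun k : ℤ => (2 * k + 1) * π / 2).mono fun β hβ => ?_
        obtain ⟨k, hk⟩ := Real.cos_eq_zero_iff.1 hβ
        exact ⟨k, hk.symm⟩
      · refine (countable_range fun k : ℤ => (k : ℝ) * π).mono fun β hβ => ?_
        obtain ⟨k, hk⟩ := Real.sin_eq_zero_iff.1 hβ
        exact ⟨k, hk⟩
    filter_upwards [hfin.ae_notMem volume] with β hβ _
    rw [not_or] at hβ
    exact ((tendsto_mul_conjPoisson (mul_ne_zero hr.ne' hβ.1)).mul
      (tendsto_mul_conjPoisson (mul_ne_zero hr.ne' hβ.2))).const_mul 2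

lemma dblHilbert_rot_eq {δ : ℝ} (hδ : 0 < δ) {f : ℂ → ℂ} (hf : Continuous f)
    (hc : HasCompactSupport f) (α : ℝ) (z : ℂ) :
    dblHilbert δ (fun w => f (Complex.exp (α * Complex.I) * w))
      (Complex.exp (-(α * Complex.I)) * z) =
      ∫ w, ((conjPoisson δ w.re * conjPoisson δ w.im : ℝ) : ℂ) *
        f (z - Complex.exp (α * Complex.I) * w) := by
  rw [dblHilbert_eq_integral hδ (by fun_prop)
    (hasCompactSupport_comp_mul_left hc (Complex.exp_ne_zero _)),
    ← integral_sub_left_eq_self _ volume (Complex.exp (-(α * Complex.I)) * z)]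
  congr 1; ext w
  have : Complex.exp (α * Complex.I) * Complex.exp (-(α * Complex.I)) = 1 := by
    rw [← Complex.exp_add]; simp
  rw [sub_sub_cancel, mul_sub, ← mul_assoc (Complex.exp _), this, one_mul]

lemma integral_rot_eq_angMean (h : ℂ → ℂ) (r β : ℝ) :
    ∫ α in (-π)..π, Complex.exp (-(2 * α * Complex.I)) *
      h (Complex.exp (α * Complex.I) * (r * Complex.exp (β * Complex.I))) =
      Complex.exp (2 * β * Complex.I) * angMean h r := by
  set W : ℝ → ℂ := fun y =>
    Complex.exp (-(2 * y * Complex.I)) * h (r * Complex.exp (y * Complex.I)) with hW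
  have hper : Function.Periodic W (2 * π) := by
    intro y
    simp only [W]
    have h1 : Complex.exp (((y + 2 * π : ℝ) : ℂ) * Complex.I) = Complex.exp (y * Complex.I) := by
      rw [← Complex.exp_periodic (y * Complex.I)]; congr 1; push_cast; ring
    have h2 : ∀ t : ℝ, Complex.exp (-(2 * t * Complex.I)) = (Complex.exp (t * Complex.I))⁻¹ ^ 2 := by
      intro t
      rw [← Complex.exp_neg, ← Complex.exp_nat_mul]; congr 1; push_cast; ring
    rw [h2, h2, h1]
  have e1 : ∀ α : ℝ, Complex.exp (-(2 * α * Complex.I)) *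
      h (Complex.exp (α * Complex.I) * (r * Complex.exp (β * Complex.I))) =
      Complex.exp (2 * β * Complex.I) * W (α + β) := by
    intro α
    simp only [W]
    rw [← mul_assoc (Complex.exp (2 * β * Complex.I)), ← Complex.exp_add]
    congr 2
    · push_cast; ring
    · rw [mul_left_comm, ← Complex.exp_add]; congr 3; push_cast; ring
  simp only [e1]
  rw [intervalIntegral.integral_const_mul, intervalIntegral.integral_comp_add_right]
  congr 1
  have := hper.intervalIntegral_add_eq (-π + β) (-π)
  rw [show -π + β + 2 * π = π + β by ring, show -π + 2 * π = π by ring] at this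
  exact this

lemma rotAvg_eq_integral {δ : ℝ} (hδ : 0 < δ) {f : ℂ → ℂ} (hf : Continuous f)
    (hc : HasCompactSupport f) (z : ℂ) :
    rotAvg δ f z = ∫ r in Ioi (0 : ℝ), (r : ℂ)⁻¹ * angMean (fun w => f (z - w)) r *
      (Complex.I * angFactor δ r) := by
  set h : ℂ → ℂ := fun w => f (z - w) with hh
  have hhc : Continuous h := by fun_prop
  have hhs : HasCompactSupport h := hc.comp_homeomorph (Homeomorph.subLeft z)
  obtain ⟨R, hR0, hR⟩ := exists_pos_forall_eq_zero hhs
  set K : ℂ → ℂ := fun w => ((conjPoisson δ w.re * conjPoisson δ w.im : ℝ) : ℂ) with hK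
  have hKc : Continuous K := continuous_conjPoisson_mul hδ
  have hππ : -π ≤ π := by linarith [Real.pi_pos]
  have hswap : rotAvg δ f z = ∫ w, K w * ∫ α in (-π)..π, Complex.exp (-(2 * α * Complex.I)) *
      h (Complex.exp (α * Complex.I) * w) := by
    simp only [rotAvg, dblHilbert_rot_eq hδ hf hc, ← integral_const_mul]
    rw [integral_integral_swap]
    · congr 1; ext w
      rw [intervalIntegral.integral_of_le hππ, ← integral_const_mul]
      congr 1; ext α
      simp only [K, h]; ring
    · have hG : Continuous (Function.uncurry fun (α : ℝ) (w : ℂ) =>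
          Complex.exp (-(2 * α * Complex.I)) *
          (((conjPoisson δ w.re * conjPoisson δ w.im : ℝ) : ℂ) *
          f (z - Complex.exp (α * Complex.I) * w))) := by
        unfold Function.uncurry
        have := hKc.comp (continuous_snd (X := ℝ) (Y := ℂ))
        exact Continuous.mul (by fun_prop) (this.mul (by fun_prop))
      have := integrableOn_of_continuous_of_eq_zero (μ := volume.prod volume) hG
        ((isCompact_Icc (a := -π) (b := π)).prod (isCompact_closedBall (0 : ℂ) R))
        (t := Ioc (-π) π ×ˢ univ) (measurableSet_Ioc.prod MeasurableSet.univ) (by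
          rintro ⟨α, w⟩ ⟨hα, _⟩ hx
          have hw : R ≤ ‖w‖ := by
            by_contra! hlt
            exact hx ⟨Ioc_subset_Icc_self hα, by simpa using hlt.le⟩
          have : h (Complex.exp (α * Complex.I) * w) = 0 := hR _ (by
            rwa [norm_mul, Complex.norm_exp_ofReal_mul_I, one_mul])
          simp only [Function.uncurry]
          simp only [h] at this
          rw [this]; simp)
      rwa [IntegrableOn, ← Measure.prod_restrict, Measure.restrict_univ] at this
  rw [hswap, ← Complex.integral_comp_polarCoord_symm, polarCoord_target]
  have hpol : ∀ p : ℝ × ℝ, Complex.polarCoord.symm p = p.1 * Complex.exp (p.2 * Complex.I) := by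
    intro p
    rw [Complex.polarCoord_symm_apply, Complex.exp_mul_I]
    push_cast; ring
  have hKp : ∀ p : ℝ × ℝ, K (p.1 * Complex.exp (p.2 * Complex.I)) =
      ((conjPoisson δ (p.1 * cos p.2) * conjPoisson δ (p.1 * sin p.2) : ℝ) : ℂ) := by
    intro p
    simp only [K]
    congr 3
    · simp [Complex.exp_ofReal_mul_I_re]
    · simp [Complex.exp_ofReal_mul_I_im]
  simp only [hpol, integral_rot_eq_angMean, hKp]
  have hk := continuous_conjPoisson hδ
  have h1 : Continuous fun q : ℝ × ℝ => conjPoisson δ (q.1 * cos q.2) := hk.comp (by fun_prop)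
  have h2 : Continuous fun q : ℝ × ℝ => conjPoisson δ (q.1 * sin q.2) := hk.comp (by fun_prop)
  have h3 : Continuous (angMean h) := continuous_angMean hhc
  rw [Measure.volume_eq_prod, setIntegral_prod]
  · refine setIntegral_congr_fun measurableSet_Ioi fun r hr => ?_
    have hr0 : (r : ℂ) ≠ 0 := by exact_mod_cast (ne_of_gt hr)
    simp only
    rw [← integral_Ioc_eq_integral_Ioo, ← intervalIntegral.integral_of_le hππ,
      ← integral_kernel_circle hδ, ← intervalIntegral.integral_const_mul]
    congr 1; ext β
    rw [Complex.real_smul]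
    push_cast
    field_simp
  · refine integrableOn_of_continuous_of_eq_zero (by fun_prop)
      ((isCompact_Icc (a := 0) (b := R)).prod (isCompact_Icc (a := -π) (b := π)))
      (measurableSet_Ioi.prod measurableSet_Ioo) ?_
    rintro ⟨r, β⟩ ⟨hr, hβ⟩ hx
    have hr0 : 0 < r := hr
    have hrR : R ≤ r := by
      by_contra! hlt
      exact hx ⟨⟨hr0.le, hlt.le⟩, Ioo_subset_Icc_self hβ⟩
    simp only
    rw [angMean_eq_zero hR hr0.le hrR]; simp

open Filter Topology in
lemma tendsto_rotAvg {f : ℂ → ℂ} {L : ℝ≥0} (hL : LipschitzWith L f)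
    (hc : HasCompactSupport f) (z : ℂ) :
    Tendsto (fun δ => rotAvg δ f z) (𝓝[>] 0) (𝓝 (∫ r in Ioi (0 : ℝ),
      (r : ℂ)⁻¹ * angMean (fun w => f (z - w)) r * (Complex.I * (4 * π : ℝ)))) := by
  set h : ℂ → ℂ := fun w => f (z - w) with hh
  have hhL : LipschitzWith L h := LipschitzWith.of_dist_le_mul fun x y =>
    (hL.dist_le_mul _ _).trans_eq (by rw [dist_sub_left])
  obtain ⟨R, hR0, hR⟩ := exists_pos_forall_eq_zero
    (hc.comp_homeomorph (Homeomorph.subLeft z) : HasCompactSupport h)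
  have hev : ∀ᶠ δ : ℝ in 𝓝[>] 0, ∫ r in Ioi (0 : ℝ), (r : ℂ)⁻¹ * angMean h r *
      (Complex.I * angFactor δ r) = rotAvg δ f z := by
    filter_upwards [self_mem_nhdsWithin] with δ hδ
    exact (rotAvg_eq_integral hδ hL.continuous hc z).symm
  refine Tendsto.congr' hev ?_
  refine tendsto_integral_filter_of_dominated_convergence
    ((Ioc 0 R).indicator fun _ => 2 * π * L * (4 * π)) ?_ ?_ integrableOn_indicator_Ioi ?_
  · filter_upwards [self_mem_nhdsWithin] with δ hδ
    refine (aestronglyMeasurable_inv_mul_angMean hhL.continuous).mul ?_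
    have := continuous_angFactor hδ
    exact Continuous.aestronglyMeasurable (by fun_prop)
  · refine Eventually.of_forall fun δ => ?_
    filter_upwards [ae_restrict_mem measurableSet_Ioi] with r hr
    have e1 := norm_inv_mul_angMean_le hhL hR hr
    have e2 : ‖Complex.I * (angFactor δ r : ℂ)‖ ≤ 4 * π := by
      rw [norm_mul, Complex.norm_I, one_mul, Complex.norm_real]; exact abs_angFactor_le δ r
    rw [norm_mul]
    refine (mul_le_mul e1 e2 (norm_nonneg _) (indicator_nonneg (fun _ _ => by positivity) _)).trans ?_
    by_cases hm : r ∈ Ioc 0 R <;> simp [hm]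
  · filter_upwards [ae_restrict_mem measurableSet_Ioi] with r hr
    refine Tendsto.const_mul _ (Tendsto.const_mul _ ?_)
    exact (Complex.continuous_ofReal.tendsto _).comp (tendsto_angFactor hr)

lemma fderiv_comp_sub_left {g : ℂ → ℂ} (hg : Differentiable ℝ g) (z w : ℂ) :
    fderiv ℝ (fun w => g (z - w)) w = -fderiv ℝ g (z - w) := by
  have h := (hg (z - w)).hasFDerivAt.comp w ((hasFDerivAt_id w).const_sub z)
  refine h.fderiv.trans ?_
  ext u
  simp

open Filter Topology in
lemma tendsto_rotAvg_wirtBar {g : ℂ → ℂ} (hg : ContDiff ℝ 2 g) (hc : HasCompactSupport g) (z : ℂ) :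
    Tendsto (fun δ => rotAvg δ (wirtBar g) z) (𝓝[>] 0)
      (𝓝 (-(4 * π ^ 2) * Complex.I * wirt g z)) := by
  obtain ⟨L, hL⟩ := (contDiff_wirtBar hg).lipschitzWith_of_hasCompactSupport hc.wirtBar one_ne_zero
  have h := tendsto_rotAvg hL hc.wirtBar z
  set φ : ℂ → ℂ := fun w => g (z - w) with hφ
  have hφs : ContDiff ℝ 2 φ := hg.comp (contDiff_const.sub contDiff_id)
  have hφc : HasCompactSupport φ := hc.comp_homeomorph (Homeomorph.subLeft z)
  have hgd : Differentiable ℝ g := hg.differentiable (by norm_num)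
  have e1 : ∀ w, wirtBar φ w = -wirtBar g (z - w) := fun w => by
    simp only [wirtBar, φ, fderiv_comp_sub_left hgd, neg_apply]; ring
  have e2 : wirt φ 0 = -wirt g z := by
    simp only [wirt, φ, fderiv_comp_sub_left hgd, neg_apply, sub_zero]; ring
  have e3 : ∀ r, angMean (fun w => wirtBar g (z - w)) r = -angMean (wirtBar φ) r := fun r => by
    simp only [angMean, e1, mul_neg, intervalIntegral.integral_neg, neg_neg]
  simp only [e3, mul_neg, neg_mul, integral_neg] at h
  rw [integral_mul_const, integral_inv_mul_angMean_wirtBar hφs hφc, e2] at h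
  convert h using 2
  push_cast; ring

open Filter Topology in
/-- The Beurling-Ahlfors estimate: `∂g` is controlled by `∂̄g` in `L ^ p`. -/
theorem lintegral_wirt_rpow_le {p : ℝ} (hp : 1 < p) :
    ∃ C : ℝ≥0∞, C ≠ ∞ ∧ ∀ g : ℂ → ℂ, ContDiff ℝ 2 g → HasCompactSupport g →
      ∫⁻ z, ‖wirt g z‖ₑ ^ p ≤ C * ∫⁻ z, ‖wirtBar g z‖ₑ ^ p := by
  obtain ⟨C, hC, H⟩ := lintegral_rotAvg_rpow_le hp
  refine ⟨C, hC, fun g hg hc => ?_⟩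
  have hb : Continuous (wirtBar g) := (contDiff_wirtBar hg).continuous
  set d : ℕ → ℝ := fun n => 1 / ((n : ℝ) + 1) with hd
  have hd0 : ∀ n, 0 < d n := fun n => by positivity
  have hdt : Tendsto d atTop (𝓝[>] 0) := by
    refine tendsto_nhdsWithin_iff.2 ⟨tendsto_one_div_add_atTop_nhds_zero_nat, ?_⟩
    exact Eventually.of_forall hd0
  have hmeas : ∀ n, Measurable (rotAvg (d n) (wirtBar g)) := by
    intro n
    have hm : StronglyMeasurable (Function.uncurry fun (z : ℂ) (α : ℝ) =>
        Complex.exp (-(2 * α * Complex.I)) *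
        dblHilbert (d n) (fun w => wirtBar g (Complex.exp (α * Complex.I) * w))
          (Complex.exp (-(α * Complex.I)) * z)) := by
      have := (continuous_dblHilbert_rot (hd0 n) hb hc.wirtBar).comp (continuous_swap (X := ℂ))
      refine Continuous.stronglyMeasurable ?_
      exact Continuous.mul (f := fun q : ℂ × ℝ => Complex.exp (-(2 * q.2 * Complex.I)))
        (by fun_prop) this
    exact (hm.integral_prod_right (ν := volume.restrict (Ioc (-π) π))).measurable
  have hc1 : 1 ≤ ‖-(4 * π ^ 2 : ℂ) * Complex.I‖ := by
    simp only [norm_mul, norm_neg, Complex.norm_I, mul_one, norm_pow, Complex.norm_real]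
    rw [Real.norm_of_nonneg Real.pi_pos.le]
    norm_num
    nlinarith [Real.pi_gt_three]
  have hpt : ∀ z, ‖wirt g z‖ₑ ^ p ≤
      liminf (fun n => ‖rotAvg (d n) (wirtBar g) z‖ₑ ^ p) atTop := by
    intro z
    have h1 := ((tendsto_rotAvg_wirtBar hg hc z).comp hdt).enorm
    have h2 := h1.ennrpow_const p
    have h3 := h2.liminf_eq
    simp only [Function.comp] at h3
    rw [h3]
    refine ENNReal.rpow_le_rpow ?_ (by linarith)
    rw [← ofReal_norm, ← ofReal_norm]
    refine ENNReal.ofReal_le_ofReal ?_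
    rw [norm_mul]
    exact le_mul_of_one_le_left (norm_nonneg _) hc1
  calc ∫⁻ z, ‖wirt g z‖ₑ ^ p
      ≤ ∫⁻ z, liminf (fun n => ‖rotAvg (d n) (wirtBar g) z‖ₑ ^ p) atTop := lintegral_mono hpt
    _ ≤ liminf (fun n => ∫⁻ z, ‖rotAvg (d n) (wirtBar g) z‖ₑ ^ p) atTop :=
        lintegral_liminf_le fun n => (hmeas n).enorm.pow_const p
    _ ≤ liminf (fun _ : ℕ => C * ∫⁻ z, ‖wirtBar g z‖ₑ ^ p) atTop := by
        refine liminf_le_liminf (Eventually.of_forall fun n => ?_)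
        exact H _ (hd0 n) _ hb hc.wirtBar
    _ = _ := by simp

lemma norm_fderiv_le_wirt (g : ℂ → ℂ) (w : ℂ) :
    ‖fderiv ℝ g w‖ ≤ ‖wirt g w‖ + ‖wirtBar g w‖ := by
  refine ContinuousLinearMap.opNorm_le_bound _ (by positivity) fun u => ?_
  rw [fderiv_eq_wirt, add_mul]
  refine (norm_add_le _ _).trans_eq ?_
  rw [norm_mul, norm_mul, RCLike.norm_conj]

lemma wirtBar_mul {χ f : ℂ → ℂ} {w : ℂ} (hχ : DifferentiableAt ℝ χ w)
    (hf : DifferentiableAt ℝ f w) :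
    wirtBar (fun w => χ w * f w) w = χ w * wirtBar f w + f w * wirtBar χ w := by
  have h : fderiv ℝ (fun w => χ w * f w) w = χ w • fderiv ℝ f w + f w • fderiv ℝ χ w :=
    fderiv_fun_mul hχ hf
  simp only [wirtBar, h, add_apply, smul_apply, smul_eq_mul]
  ring

/-- The half-plane trace of the open cylinder. -/
def openRect : Set ℂ := Ioo 1 4 ×ℂ Ioo (-4) 4

lemma isOpen_openRect : IsOpen openRect := isOpen_Ioo.reProdIm isOpen_Ioo

lemma exists_rect_cutoff : ∃ χ : ℂ → ℂ, ContDiff ℝ 2 χ ∧ HasCompactSupport χ ∧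
    tsupport χ ⊆ openRect ∧ (∀ w, ‖χ w‖ ≤ 1) ∧
    ∀ w ∈ Icc 2 3 ×ℂ Icc (-3) 3, ∀ᶠ y in nhds w, χ y = 1 := by
  let φ₁ : ContDiffBump (2.5 : ℝ) := ⟨0.6, 1.2, by norm_num, by norm_num⟩
  let φ₂ : ContDiffBump (0 : ℝ) := ⟨3.1, 3.5, by norm_num, by norm_num⟩
  set χ : ℂ → ℂ := fun w => ((φ₁ w.re * φ₂ w.im : ℝ) : ℂ) with hχ
  have hsub : tsupport χ ⊆ Metric.closedBall (2.5 : ℝ) 1.2 ×ℂ Metric.closedBall (0 : ℝ) 3.5 := by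
    refine closure_minimal (fun w hw => ?_)
      (Metric.isClosed_closedBall.reProdIm Metric.isClosed_closedBall)
    have h1 : φ₁ w.re ≠ 0 := fun h => hw (by simp [χ, h])
    have h2 : φ₂ w.im ≠ 0 := fun h => hw (by simp [χ, h])
    have h1' : w.re ∈ Function.support φ₁ := h1
    have h2' : w.im ∈ Function.support φ₂ := h2
    rw [φ₁.support_eq] at h1'
    rw [φ₂.support_eq] at h2'
    exact ⟨Metric.ball_subset_closedBall h1', Metric.ball_subset_closedBall h2'⟩
  refine ⟨χ, ?_, ?_, hsub.trans ?_, ?_, ?_⟩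
  · exact Complex.ofRealCLM.contDiff.comp ((φ₁.contDiff.comp Complex.reCLM.contDiff).mul
      (φ₂.contDiff.comp Complex.imCLM.contDiff))
  · exact ((isCompact_closedBall _ _).reProdIm (isCompact_closedBall _ _)).of_isClosed_subset
      (isClosed_tsupport _) hsub
  · rintro w ⟨h1, h2⟩
    rw [mem_preimage, Real.closedBall_eq_Icc] at h1 h2
    refine ⟨⟨?_, ?_⟩, ?_, ?_⟩
    · linarith [h1.1]
    · linarith [h1.2]
    · linarith [h2.1]
    · linarith [h2.2]
  · intro w
    rw [Complex.norm_real, Real.norm_of_nonneg (mul_nonneg φ₁.nonneg φ₂.nonneg)]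
    exact mul_le_one₀ φ₁.le_one φ₂.nonneg φ₂.le_one
  · rintro w ⟨⟨h1, h2⟩, h3, h4⟩
    have hO : IsOpen (Ioo (1.9 : ℝ) 3.1 ×ℂ Ioo (-3.1 : ℝ) 3.1) := isOpen_Ioo.reProdIm isOpen_Ioo
    have hw : w ∈ Ioo (1.9 : ℝ) 3.1 ×ℂ Ioo (-3.1 : ℝ) 3.1 :=
      ⟨⟨by linarith, by linarith⟩, by linarith, by linarith⟩
    filter_upwards [hO.mem_nhds hw] with y hy
    obtain ⟨⟨a1, a2⟩, a3, a4⟩ := hy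
    have e1 : φ₁ y.re = 1 := φ₁.one_of_mem_closedBall (by
      rw [Real.closedBall_eq_Icc]; simp only [φ₁]; constructor <;> linarith)
    have e2 : φ₂ y.im = 1 := φ₂.one_of_mem_closedBall (by
      rw [Real.closedBall_eq_Icc]; simp only [φ₂]; constructor <;> linarith)
    simp [χ, e1, e2]

lemma rpow_add_le_two_mul {q : ℝ} (hq : 1 < q) (a b : ℝ≥0∞) :
    (a + b) ^ q ≤ 2 ^ q * (a ^ q + b ^ q) := by
  refine (ENNReal.rpow_add_le_mul_rpow_add_rpow a b hq.le).trans ?_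
  gcongr
  · norm_num
  · linarith

lemma measurable_wirt {g : ℂ → ℂ} : Measurable (wirt g) := by
  unfold wirt
  exact ((measurable_fderiv_apply_const ℝ g 1).sub
    ((measurable_fderiv_apply_const ℝ g Complex.I).const_mul _)).const_mul _

lemma measurable_wirtBar {g : ℂ → ℂ} : Measurable (wirtBar g) := by
  unfold wirtBar
  exact ((measurable_fderiv_apply_const ℝ g 1).add
    ((measurable_fderiv_apply_const ℝ g Complex.I).const_mul _)).const_mul _

/-- Interior `L ^ q` estimate for the full gradient in terms of `∂̄f` and `f`. -/
theorem setLIntegral_fderiv_rpow_le {q : ℝ} (hq : 1 < q) :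
    ∃ C : ℝ≥0∞, C ≠ ∞ ∧ ∀ f : ℂ → ℂ, (∀ w ∈ openRect, ContDiffAt ℝ 2 f w) →
      ∫⁻ w in Icc 2 3 ×ℂ Icc (-3) 3, ‖fderiv ℝ f w‖ₑ ^ q ≤
        C * ((∫⁻ w in openRect, ‖wirtBar f w‖ₑ ^ q) + ∫⁻ w in openRect, ‖f w‖ₑ ^ q) := by
  obtain ⟨C, hC, H⟩ := lintegral_wirt_rpow_le hq
  obtain ⟨χ, hχs, hχc, hχU, hχ1, hχD⟩ := exists_rect_cutoff
  have hχs1 : ContDiff ℝ 1 χ := hχs.of_le (by norm_num)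
  obtain ⟨M, hM⟩ := hχc.wirtBar.exists_bound_of_continuous (continuous_wirtBar hχs1)
  have hM0 : 0 ≤ M := (norm_nonneg _).trans (hM 0)
  have h2 : (2 : ℝ≥0∞) ^ q ≠ ∞ := ENNReal.rpow_ne_top_of_nonneg (by linarith) (by simp)
  set K : ℝ≥0∞ := 1 + ENNReal.ofReal M ^ q with hK
  have hKt : K ≠ ∞ := ENNReal.add_ne_top.2 ⟨ENNReal.one_ne_top,
    ENNReal.rpow_ne_top_of_nonneg (by linarith) ENNReal.ofReal_ne_top⟩
  refine ⟨2 ^ q * ((C + 1) * (2 ^ q * K)), ENNReal.mul_ne_top h2 (ENNReal.mul_ne_top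
    (ENNReal.add_ne_top.2 ⟨hC, ENNReal.one_ne_top⟩) (ENNReal.mul_ne_top h2 hKt)), fun f hf => ?_⟩
  set g : ℂ → ℂ := fun w => χ w * f w with hg
  have hgsub : tsupport g ⊆ tsupport χ := tsupport_mul_subset_left
  have hgs : ContDiff ℝ 2 g := contDiff_iff_contDiffAt.2 fun w => by
    by_cases hw : w ∈ tsupport g
    · exact hχs.contDiffAt.mul (hf w (hχU (hgsub hw)))
    · exact contDiffAt_const.congr_of_eventuallyEq (notMem_tsupport_iff_eventuallyEq.1 hw)
  have hgc : HasCompactSupport g := hχc.mul_right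
  have hgf : ∀ w ∈ Icc 2 3 ×ℂ Icc (-3) 3, ‖fderiv ℝ f w‖ₑ ≤ ‖wirt g w‖ₑ + ‖wirtBar g w‖ₑ := by
    intro w hw
    have : g =ᶠ[nhds w] f := by
      filter_upwards [hχD w hw] with y hy
      simp [g, hy]
    rw [← this.fderiv_eq, ← ofReal_norm, ← ofReal_norm, ← ofReal_norm,
      ← ENNReal.ofReal_add (norm_nonneg _) (norm_nonneg _)]
    exact ENNReal.ofReal_le_ofReal (norm_fderiv_le_wirt g w)
  have hD : MeasurableSet (Icc 2 3 ×ℂ Icc (-3) 3 : Set ℂ) :=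
    (isClosed_Icc.reProdIm isClosed_Icc).measurableSet
  have hbar : ∫⁻ w, ‖wirtBar g w‖ₑ ^ q ≤ 2 ^ q * K *
      ((∫⁻ w in openRect, ‖wirtBar f w‖ₑ ^ q) + ∫⁻ w in openRect, ‖f w‖ₑ ^ q) := by
    have hsupp : Function.support (fun w => ‖wirtBar g w‖ₑ ^ q) ⊆ openRect := by
      intro w hw
      refine hχU (hgsub (tsupport_wirtBar_subset g (subset_tsupport _ fun h => hw ?_)))
      simp [h, show 0 < q by linarith]
    rw [← setLIntegral_eq_of_support_subset hsupp,
      ← lintegral_add_left (measurable_wirtBar.enorm.pow_const q), ← lintegral_const_mul'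
      _ _ (ENNReal.mul_ne_top h2 hKt)]
    refine setLIntegral_mono' isOpen_openRect.measurableSet fun w hw => ?_
    have hfd : DifferentiableAt ℝ f w := (hf w hw).differentiableAt (by norm_num)
    have e1 : ‖wirtBar g w‖ₑ ≤ ‖wirtBar f w‖ₑ + ENNReal.ofReal M * ‖f w‖ₑ := by
      rw [wirtBar_mul (hχs.differentiable (by norm_num) w) hfd, ← ofReal_norm, ← ofReal_norm,
        ← ofReal_norm, ← ENNReal.ofReal_mul hM0, ← ENNReal.ofReal_add (norm_nonneg _) (by positivity)]
      refine ENNReal.ofReal_le_ofReal ((norm_add_le _ _).trans ?_)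
      rw [norm_mul, norm_mul, mul_comm ‖f w‖]
      exact add_le_add (mul_le_of_le_one_left (norm_nonneg _) (hχ1 w))
        (mul_le_mul_of_nonneg_right (hM w) (norm_nonneg _))
    refine (ENNReal.rpow_le_rpow e1 (by linarith)).trans ((rpow_add_le_two_mul hq _ _).trans ?_)
    rw [ENNReal.mul_rpow_of_nonneg _ _ (by linarith : (0 : ℝ) ≤ q), mul_assoc]
    gcongr 2 ^ q * ?_
    rw [mul_add]
    gcongr
    · exact le_mul_of_one_le_left zero_le (by simp [K])
    · simp [K]
  calc ∫⁻ w in Icc 2 3 ×ℂ Icc (-3) 3, ‖fderiv ℝ f w‖ₑ ^ q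
      ≤ ∫⁻ w in Icc 2 3 ×ℂ Icc (-3) 3, 2 ^ q * (‖wirt g w‖ₑ ^ q + ‖wirtBar g w‖ₑ ^ q) :=
        setLIntegral_mono' hD fun w hw => (ENNReal.rpow_le_rpow (hgf w hw) (by linarith)).trans
          (rpow_add_le_two_mul hq _ _)
    _ ≤ ∫⁻ w, 2 ^ q * (‖wirt g w‖ₑ ^ q + ‖wirtBar g w‖ₑ ^ q) := setLIntegral_le_lintegral _ _
    _ = 2 ^ q * ((∫⁻ w, ‖wirt g w‖ₑ ^ q) + ∫⁻ w, ‖wirtBar g w‖ₑ ^ q) := by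
        rw [lintegral_const_mul' _ _ h2, lintegral_add_left (measurable_wirt.enorm.pow_const q)]
    _ ≤ 2 ^ q * ((C + 1) * ∫⁻ w, ‖wirtBar g w‖ₑ ^ q) := by
        rw [add_mul, one_mul]
        gcongr
        exact H g hgs hgc
    _ ≤ _ := by
        refine (mul_le_mul_right (mul_le_mul_right hbar _) _).trans_eq ?_
        ring

/-- Projection of `ℝ³` onto the meridional half-plane `r + i z`. -/
def mer (x : X3) : ℂ := ⟨rad x, x 2⟩

/-- Embedding of the meridional half-plane into `ℝ³`. -/
def halfEmb (w : ℂ) : X3 := ![w.re, 0, w.im]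

/-- The combination `v_r - i v_z` as a function on the half-plane. -/
def meridional (u : X3 → X3) (w : ℂ) : ℂ := (u (halfEmb w) 0 : ℂ) - Complex.I * (u (halfEmb w) 2 : ℂ)

lemma rad_vec (r z : ℝ) (hr : 0 ≤ r) : rad ![r, 0, z] = r := by
  simp [rad, Real.sqrt_sq hr]

lemma mer_halfEmb {w : ℂ} (hw : 0 ≤ w.re) : mer (halfEmb w) = w := by
  apply Complex.ext
  · exact rad_vec _ _ hw
  · simp [mer, halfEmb]

lemma halfEmb_mk (r z : ℝ) : halfEmb ⟨r, z⟩ = ![r, 0, z] := rfl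

/-- `halfEmb` as a continuous linear map. -/
def halfEmbL : ℂ →L[ℝ] X3 :=
  ContinuousLinearMap.pi ![Complex.reCLM, 0, Complex.imCLM]

lemma halfEmbL_apply (w : ℂ) : halfEmbL w = halfEmb w := by
  ext i
  fin_cases i <;> simp [halfEmbL, halfEmb]

lemma contDiff_halfEmb {n : WithTop ℕ∞} : ContDiff ℝ n halfEmb := by
  have : halfEmb = halfEmbL := funext fun w => (halfEmbL_apply w).symm
  rw [this]
  exact halfEmbL.contDiff

lemma hasFDerivAt_halfEmb (w : ℂ) : HasFDerivAt halfEmb halfEmbL w := by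
  have : halfEmb = halfEmbL := funext fun w => (halfEmbL_apply w).symm
  rw [this]
  exact halfEmbL.hasFDerivAt

lemma rad_pos_of_mer_mem {x : X3} (hx : mer x ∈ openRect) : 0 < rad x :=
  lt_trans one_pos hx.1.1

lemma isAxisym_radial {u : X3 → X3} {a b c : ℝ → ℝ → ℝ}
    (hax : ∀ x, 0 < rad x → ∀ i, u x i =
      a (rad x) (x 2) * er x i + c (rad x) (x 2) * eθv x i + b (rad x) (x 2) * ezv i)
    {r : ℝ} (hr : 0 < r) (z : ℝ) : u ![r, 0, z] 0 = a r z ∧ u ![r, 0, z] 2 = b r z := by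
  have h := hax ![r, 0, z] (by rw [rad_vec _ _ hr.le]; exact hr)
  constructor
  · rw [h 0, rad_vec _ _ hr.le]
    simp [er, eθv, ezv, rad_vec _ _ hr.le, hr.ne']
  · rw [h 2, rad_vec _ _ hr.le]
    simp [er, eθv, ezv]

lemma contDiffAt_meridional {u : X3 → X3} {w : ℂ} (hu : ContDiffAt ℝ 2 u (halfEmb w)) :
    ContDiffAt ℝ 2 (meridional u) w := by
  have h : ContDiffAt ℝ 2 (fun w => u (halfEmb w)) w := hu.comp w contDiff_halfEmb.contDiffAt
  have h' := contDiffAt_pi.1 h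
  exact (Complex.ofRealCLM.contDiff.contDiffAt.comp w (h' 0)).sub
    (contDiffAt_const.mul (Complex.ofRealCLM.contDiff.contDiffAt.comp w (h' 2)))

lemma fderiv_coord (u : X3 → X3) {x : X3} (hu : DifferentiableAt ℝ u x) (i : Fin 3) :
    HasFDerivAt (fun y => u y i) (fderiv ℝ (fun y => u y i) x) x :=
  ((differentiableAt_pi.1 hu) i).hasFDerivAt

lemma hasDerivAt_coord_comp {u : X3 → X3} {γ : ℝ → X3} {e : X3} {s : ℝ}
    (hu : DifferentiableAt ℝ u (γ s)) (hγ : HasDerivAt γ e s) (i : Fin 3) :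
    HasDerivAt (fun s => u (γ s) i) (fderiv ℝ (fun y => u y i) (γ s) e) s :=
  HasFDerivAt.comp_hasDerivAt (l := fun y => u y i) s (fderiv_coord u hu i) hγ

lemma fderiv_meridional {u : X3 → X3} {w : ℂ} (hu : DifferentiableAt ℝ u (halfEmb w)) (h : ℂ) :
    fderiv ℝ (meridional u) w h = (fderiv ℝ (fun y => u y 0) (halfEmb w) (halfEmb h) : ℂ)
      - Complex.I * (fderiv ℝ (fun y => u y 2) (halfEmb w) (halfEmb h) : ℂ) := by
  have h0 := (fderiv_coord u hu 0).comp w (hasFDerivAt_halfEmb w)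
  have h2 := (fderiv_coord u hu 2).comp w (hasFDerivAt_halfEmb w)
  have h0' := (Complex.ofRealCLM.hasFDerivAt (x := u (halfEmb w) 0)).comp w h0
  have h2' := (Complex.ofRealCLM.hasFDerivAt (x := u (halfEmb w) 2)).comp w h2
  have : HasFDerivAt (meridional u) _ w := h0'.sub (h2'.const_mul Complex.I)
  rw [this.fderiv]
  simp [halfEmbL_apply]

lemma halfEmb_one : halfEmb 1 = Pi.single 0 1 := by
  ext i; fin_cases i <;> simp [halfEmb]

lemma halfEmb_I : halfEmb Complex.I = Pi.single 2 1 := by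
  ext i; fin_cases i <;> simp [halfEmb]

lemma wirtBar_meridional {u : X3 → X3} {w : ℂ} (hu : DifferentiableAt ℝ u (halfEmb w)) :
    wirtBar (meridional u) w =
      (1 / 2) * (((pd 0 (fun y => u y 0) (halfEmb w) + pd 2 (fun y => u y 2) (halfEmb w) : ℝ) : ℂ)
        + Complex.I * ((pd 2 (fun y => u y 0) (halfEmb w)
          - pd 0 (fun y => u y 2) (halfEmb w) : ℝ) : ℂ)) := by
  rw [wirtBar, fderiv_meridional hu, fderiv_meridional hu, halfEmb_one, halfEmb_I]
  simp only [pd]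
  push_cast
  linear_combination (-1 / 2 * (fderiv ℝ (fun y => u y 2) (halfEmb w) (Pi.single 2 1) : ℂ)) *
    Complex.I_mul_I

/-- On the half-plane the angular derivative of an axially symmetric field is `v_r / r`. -/
lemma pd_one_of_axisym {u : X3 → X3} {a b c : ℝ → ℝ → ℝ}
    (hax : ∀ x, 0 < rad x → ∀ i, u x i =
      a (rad x) (x 2) * er x i + c (rad x) (x 2) * eθv x i + b (rad x) (x 2) * ezv i)
    {r : ℝ} (hr : 0 < r) (z : ℝ) (hu : DifferentiableAt ℝ u ![r, 0, z]) :
    pd 1 (fun y => u y 1) ![r, 0, z] = a r z / r := by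
  set d := pd 1 (fun y => u y 1) ![r, 0, z] with hd
  have hline : HasDerivAt (fun s : ℝ => (![r, s, z] : X3)) (Pi.single 1 1) 0 := by
    rw [hasDerivAt_pi]
    intro i
    fin_cases i
    · simpa using hasDerivAt_const (0 : ℝ) r
    · simpa using hasDerivAt_id' (0 : ℝ)
    · simpa using hasDerivAt_const (0 : ℝ) z
  have hg : HasDerivAt (fun s : ℝ => u ![r, s, z] 1) d 0 :=
    hasDerivAt_coord_comp (s := 0) hu hline 1
  have hg' : HasDerivAt (fun s : ℝ => u ![r, -s, z] 1) (d * (-1)) 0 := by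
    have hg0 : HasDerivAt (fun s : ℝ => u ![r, s, z] 1) d (-0) := by rwa [neg_zero]
    exact hg0.comp (0 : ℝ) (hasDerivAt_neg (0 : ℝ))
  have hdiff := hg.sub hg'
  set ρ : ℝ → ℝ := fun s => Real.sqrt (r ^ 2 + s ^ 2) with hρ
  have hρpos : ∀ s, 0 < ρ s := fun s => Real.sqrt_pos.2 (by positivity)
  have hρ0 : ρ 0 = r := by simp [ρ, Real.sqrt_sq hr.le]
  have hval : ∀ s, u ![r, s, z] 1 - u ![r, -s, z] 1 = s * (2 * (a (ρ s) z / ρ s)) := by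
    intro s
    have r1 : rad ![r, s, z] = ρ s := by simp [rad, ρ]
    have r2 : rad ![r, -s, z] = ρ s := by simp [rad, ρ]
    rw [hax _ (by rw [r1]; exact hρpos s) 1, hax _ (by rw [r2]; exact hρpos s) 1, r1, r2]
    simp [er, eθv, ezv, r1, r2]
    ring
  have hcont : ContinuousAt (fun s => 2 * (a (ρ s) z / ρ s)) 0 := by
    have hρc : Continuous ρ := by fun_prop
    have e : (fun s => a (ρ s) z) = fun s => u ![ρ s, 0, z] 0 :=
      funext fun s => ((isAxisym_radial hax (hρpos s) z).1).symm
    have hvec : Continuous fun s => (![ρ s, 0, z] : X3) := by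
      refine continuous_pi fun i => ?_
      fin_cases i
      · simpa using hρc
      · simpa using continuous_const
      · simpa using continuous_const
    have hc : ContinuousAt u ![ρ 0, 0, z] := by rw [hρ0]; exact hu.continuousAt
    have hc' : ContinuousAt (fun s => u ![ρ s, 0, z] 0) 0 :=
      (continuous_apply 0).continuousAt.comp (ContinuousAt.comp (f := fun s => (![ρ s, 0, z] : X3)) hc hvec.continuousAt)
    rw [← e] at hc'
    exact continuousAt_const.mul (hc'.div hρc.continuousAt (hρpos 0).ne')
  have hder : HasDerivAt (fun s => s * (2 * (a (ρ s) z / ρ s))) (2 * (a (ρ 0) z / ρ 0)) 0 := by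
    rw [hasDerivAt_iff_tendsto_slope]
    refine (hcont.tendsto.mono_left nhdsWithin_le_nhds).congr' ?_
    filter_upwards [self_mem_nhdsWithin] with s hs
    have hs' : s ≠ 0 := hs
    rw [slope_def_field]
    field_simp
    ring
  have : HasDerivAt (fun s => s * (2 * (a (ρ s) z / ρ s))) (d - d * (-1)) 0 := by
    refine hdiff.congr_of_eventuallyEq (Filter.Eventually.of_forall fun s => ?_)
    exact (hval s).symm
  have h := this.unique hder
  rw [hρ0] at h
  linarith

lemma profile_derivs {u : X3 → X3} {a b c : ℝ → ℝ → ℝ}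
    (hax : ∀ x, 0 < rad x → ∀ i, u x i =
      a (rad x) (x 2) * er x i + c (rad x) (x 2) * eθv x i + b (rad x) (x 2) * ezv i)
    {r : ℝ} (hr : 0 < r) (z : ℝ) (hu : DifferentiableAt ℝ u ![r, 0, z]) :
    deriv (fun s => a r s) z = pd 2 (fun y => u y 0) ![r, 0, z] ∧
      deriv (fun s => b s z) r = pd 0 (fun y => u y 2) ![r, 0, z] := by
  constructor
  · have hline : HasDerivAt (fun s : ℝ => (![r, 0, s] : X3)) (Pi.single 2 1) z := by
      rw [hasDerivAt_pi]
      intro i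
      fin_cases i
      · simpa using hasDerivAt_const z r
      · simpa using hasDerivAt_const z (0 : ℝ)
      · simpa using hasDerivAt_id' z
    have h : HasDerivAt (fun s : ℝ => u ![r, 0, s] 0) (pd 2 (fun y => u y 0) ![r, 0, z]) z :=
      hasDerivAt_coord_comp (s := z) hu hline 0
    rw [← h.deriv]
    congr 1
    exact funext fun s => ((isAxisym_radial hax hr s).1).symm
  · have hline : HasDerivAt (fun s : ℝ => (![s, 0, z] : X3)) (Pi.single 0 1) r := by
      rw [hasDerivAt_pi]
      intro i
      fin_cases i
      · simpa using hasDerivAt_id' r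
      · simpa using hasDerivAt_const r (0 : ℝ)
      · simpa using hasDerivAt_const r z
    have h : HasDerivAt (fun s : ℝ => u ![s, 0, z] 2) (pd 0 (fun y => u y 2) ![r, 0, z]) r :=
      hasDerivAt_coord_comp (s := r) hu hline 2
    rw [← h.deriv]
    refine Filter.EventuallyEq.deriv_eq ?_
    filter_upwards [lt_mem_nhds hr] with s hs
    exact ((isAxisym_radial hax hs z).2).symm

lemma meridional_mk {u : X3 → X3} {a b c : ℝ → ℝ → ℝ}
    (hax : ∀ x, 0 < rad x → ∀ i, u x i =
      a (rad x) (x 2) * er x i + c (rad x) (x 2) * eθv x i + b (rad x) (x 2) * ezv i)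
    {r : ℝ} (hr : 0 < r) (z : ℝ) :
    meridional u ⟨r, z⟩ = (a r z : ℂ) - Complex.I * (b r z : ℂ) := by
  rw [meridional, halfEmb_mk, (isAxisym_radial hax hr z).1, (isAxisym_radial hax hr z).2]

lemma re_meridional {u : X3 → X3} {a b c : ℝ → ℝ → ℝ}
    (hax : ∀ x, 0 < rad x → ∀ i, u x i =
      a (rad x) (x 2) * er x i + c (rad x) (x 2) * eθv x i + b (rad x) (x 2) * ezv i)
    {r : ℝ} (hr : 0 < r) (z : ℝ) : (meridional u ⟨r, z⟩).re = a r z := by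
  simp [meridional_mk hax hr]

lemma im_meridional {u : X3 → X3} {a b c : ℝ → ℝ → ℝ}
    (hax : ∀ x, 0 < rad x → ∀ i, u x i =
      a (rad x) (x 2) * er x i + c (rad x) (x 2) * eθv x i + b (rad x) (x 2) * ezv i)
    {r : ℝ} (hr : 0 < r) (z : ℝ) : (meridional u ⟨r, z⟩).im = - b r z := by
  simp [meridional_mk hax hr]

lemma sum_sq_axisym {u : X3 → X3} {a b c : ℝ → ℝ → ℝ}
    (hax : ∀ x, 0 < rad x → ∀ i, u x i =
      a (rad x) (x 2) * er x i + c (rad x) (x 2) * eθv x i + b (rad x) (x 2) * ezv i)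
    {x : X3} (hx : 0 < rad x) :
    ∑ i : Fin 3, (u x i) ^ 2 =
      a (rad x) (x 2) ^ 2 + c (rad x) (x 2) ^ 2 + b (rad x) (x 2) ^ 2 := by
  have h : (x 0 / rad x) ^ 2 + (x 1 / rad x) ^ 2 = 1 := by
    have h2 : rad x ^ 2 = x 0 ^ 2 + x 1 ^ 2 := Real.sq_sqrt (by positivity)
    field_simp
    linarith
  rw [Fin.sum_univ_three, hax x hx, hax x hx, hax x hx]
  simp only [er, eθv, ezv, Matrix.cons_val, neg_div]
  linear_combination (a (rad x) (x 2) ^ 2 + c (rad x) (x 2) ^ 2) * h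

lemma norm_meridional_sq_le {u : X3 → X3} {a b c : ℝ → ℝ → ℝ}
    (hax : ∀ x, 0 < rad x → ∀ i, u x i =
      a (rad x) (x 2) * er x i + c (rad x) (x 2) * eθv x i + b (rad x) (x 2) * ezv i)
    {x : X3} (hx : 0 < rad x) :
    ‖meridional u (mer x)‖ ^ 2 ≤ ∑ i : Fin 3, (u x i) ^ 2 := by
  rw [sum_sq_axisym hax hx, ← Complex.normSq_eq_norm_sq, Complex.normSq_apply, mer,
    re_meridional hax hx, im_meridional hax hx]
  nlinarith [sq_nonneg (c (rad x) (x 2))]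

lemma abs_div_rad_le {u : X3 → X3} {a b c : ℝ → ℝ → ℝ}
    (hax : ∀ x, 0 < rad x → ∀ i, u x i =
      a (rad x) (x 2) * er x i + c (rad x) (x 2) * eθv x i + b (rad x) (x 2) * ezv i)
    {x : X3} (hx : 1 ≤ rad x) :
    |a (rad x) (x 2) / rad x| ≤ ‖meridional u (mer x)‖ := by
  have h0 : 0 < rad x := by linarith
  rw [abs_div, abs_of_pos h0]
  refine (div_le_self (abs_nonneg _) hx).trans ?_
  rw [← re_meridional hax h0 (x 2)]
  exact Complex.abs_re_le_norm _

lemma norm_wirtBar_meridional_le {u : X3 → X3} {a b c : ℝ → ℝ → ℝ}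
    (hax : ∀ x, 0 < rad x → ∀ i, u x i =
      a (rad x) (x 2) * er x i + c (rad x) (x 2) * eθv x i + b (rad x) (x 2) * ezv i)
    {r z : ℝ} (hr : 1 ≤ r) (hu : DifferentiableAt ℝ u ![r, 0, z]) (hd : divg u ![r, 0, z] = 0) :
    ‖wirtBar (meridional u) ⟨r, z⟩‖ ≤
      |deriv (fun s => a r s) z - deriv (fun s => b s z) r| + ‖meridional u ⟨r, z⟩‖ := by
  have h0 : 0 < r := by linarith
  have hu' : DifferentiableAt ℝ u (halfEmb ⟨r, z⟩) := hu
  rw [wirtBar_meridional hu', halfEmb_mk, ← (profile_derivs hax h0 z hu).1,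
    (profile_derivs hax h0 z hu).2.symm]
  rw [divg, Fin.sum_univ_three, pd_one_of_axisym hax h0 z hu] at hd
  have e : pd 0 (fun y => u y 0) ![r, 0, z] + pd 2 (fun y => u y 2) ![r, 0, z] = - (a r z / r) := by
    linarith
  rw [e, norm_mul]
  set ω := deriv (fun s => a r s) z - deriv (fun s => b s z) r
  have h1 : ‖((- (a r z / r) : ℝ) : ℂ) + Complex.I * (ω : ℂ)‖ ≤ ‖meridional u ⟨r, z⟩‖ + |ω| := by
    refine (norm_add_le _ _).trans ?_
    rw [norm_mul, Complex.norm_I, one_mul, Complex.norm_real, Complex.norm_real, Real.norm_eq_abs,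
      Real.norm_eq_abs, abs_neg]
    gcongr
    rw [abs_div, abs_of_pos h0]
    refine (div_le_self (abs_nonneg _) hr).trans ?_
    rw [← re_meridional hax h0 z]
    exact Complex.abs_re_le_norm _
  have h2 : ‖(1 / 2 : ℂ)‖ ≤ 1 := by norm_num
  calc _ ≤ 1 * ‖((- (a r z / r) : ℝ) : ℂ) + Complex.I * (ω : ℂ)‖ := by gcongr
    _ ≤ _ := by linarith

lemma hasFDerivAt_rad {x : X3} (hx : 0 < rad x) :
    HasFDerivAt rad ((1 / (2 * rad x)) • ((2 * x 0) • ContinuousLinearMap.proj (R := ℝ) (φ := fun _ : Fin 3 => ℝ) 0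
      + (2 * x 1) • ContinuousLinearMap.proj (R := ℝ) (φ := fun _ : Fin 3 => ℝ) 1)) x := by
  have h0 : HasFDerivAt (fun y : X3 => y 0) (ContinuousLinearMap.proj (R := ℝ) (φ := fun _ : Fin 3 => ℝ) 0) x :=
    hasFDerivAt_apply 0 x
  have h1 : HasFDerivAt (fun y : X3 => y 1) (ContinuousLinearMap.proj (R := ℝ) (φ := fun _ : Fin 3 => ℝ) 1) x :=
    hasFDerivAt_apply 1 x
  have h := ((h0.pow 2).add (h1.pow 2)).sqrt (f := fun y : X3 => y 0 ^ 2 + y 1 ^ 2)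
    (fun h => hx.ne' (by rw [rad, h, Real.sqrt_zero]))
  refine h.congr_fderiv ?_
  simp [rad]

lemma exists_hasFDerivAt_mer {x : X3} (hx : 0 < rad x) :
    ∃ L : X3 →L[ℝ] ℂ, HasFDerivAt mer L x ∧ ∀ i : Fin 3, ‖L (Pi.single i 1)‖ ≤ 1 := by
  have h2 : HasFDerivAt (fun y : X3 => y 2) (ContinuousLinearMap.proj (R := ℝ) (φ := fun _ : Fin 3 => ℝ) 2) x :=
    hasFDerivAt_apply 2 x
  have h : HasFDerivAt mer _ x :=
    (((Complex.ofRealCLM.hasFDerivAt (x := rad x)).comp x (hasFDerivAt_rad hx)).add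
      (((Complex.ofRealCLM.hasFDerivAt (x := x 2)).comp x h2).const_mul Complex.I)).congr_of_eventuallyEq
      (Filter.Eventually.of_forall fun y => by
        apply Complex.ext <;> simp [mer])
  refine ⟨_, h, fun i => ?_⟩
  have hs : rad x ^ 2 = x 0 ^ 2 + x 1 ^ 2 := Real.sq_sqrt (by positivity)
  have b0 : |x 0| ≤ rad x := abs_le_of_sq_le_sq (by nlinarith [sq_nonneg (x 1)]) hx.le
  have b1 : |x 1| ≤ rad x := abs_le_of_sq_le_sq (by nlinarith [sq_nonneg (x 0)]) hx.le
  fin_cases i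
  · simp [abs_of_pos hx]
    field_simp
    exact b0
  · simp [abs_of_pos hx]
    field_simp
    exact b1
  · simp

lemma gradSq_comp_mer_le {f : ℂ → ℂ} {x : X3} (hx : 0 < rad x) (hf : DifferentiableAt ℝ f (mer x))
    (ℓ : ℂ →L[ℝ] ℝ) (hℓ : ‖ℓ‖ ≤ 1) {g : X3 → ℝ} (hg : g =ᶠ[nhds x] fun y => ℓ (f (mer y))) :
    gradSq g x ≤ 3 * ‖fderiv ℝ f (mer x)‖ ^ 2 := by
  obtain ⟨L, hL, hL1⟩ := exists_hasFDerivAt_mer hx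
  have h : HasFDerivAt g (ℓ.comp ((fderiv ℝ f (mer x)).comp L)) x :=
    (ℓ.hasFDerivAt.comp x (hf.hasFDerivAt.comp x hL)).congr_of_eventuallyEq hg
  have key : ∀ i : Fin 3, (pd i g x) ^ 2 ≤ ‖fderiv ℝ f (mer x)‖ ^ 2 := by
    intro i
    rw [pd, h.fderiv, ← sq_abs, ← Real.norm_eq_abs]
    refine pow_le_pow_left₀ (norm_nonneg _) ?_ 2
    calc ‖ℓ (fderiv ℝ f (mer x) (L (Pi.single i 1)))‖
        ≤ 1 * ‖fderiv ℝ f (mer x) (L (Pi.single i 1))‖ := ℓ.le_of_opNorm_le hℓ _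
      _ ≤ ‖fderiv ℝ f (mer x)‖ * ‖L (Pi.single i 1)‖ := by
          rw [one_mul]; exact (fderiv ℝ f (mer x)).le_opNorm _
      _ ≤ _ := mul_le_of_le_one_right (norm_nonneg _) (hL1 i)
  rw [gradSq, Fin.sum_univ_three]
  linarith [key 0, key 1, key 2]

lemma continuous_rad : Continuous rad := by
  unfold rad
  fun_prop

lemma continuous_mer : Continuous mer :=
  continuous_complex_mk.comp (continuous_rad.prodMk (continuous_apply 2))

lemma gradSq_radial_le {u : X3 → X3} {a b c : ℝ → ℝ → ℝ}
    (hax : ∀ x, 0 < rad x → ∀ i, u x i =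
      a (rad x) (x 2) * er x i + c (rad x) (x 2) * eθv x i + b (rad x) (x 2) * ezv i)
    {x : X3} (hx : 0 < rad x) (hf : DifferentiableAt ℝ (meridional u) (mer x)) :
    gradSq (fun y => a (rad y) (y 2)) x ≤ 3 * ‖fderiv ℝ (meridional u) (mer x)‖ ^ 2 := by
  refine gradSq_comp_mer_le hx hf Complex.reCLM Complex.reCLM_norm.le ?_
  filter_upwards [continuous_rad.continuousAt.eventually (lt_mem_nhds hx)] with y hy
  exact (re_meridional hax hy (y 2)).symm

lemma gradSq_vertical_le {u : X3 → X3} {a b c : ℝ → ℝ → ℝ}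
    (hax : ∀ x, 0 < rad x → ∀ i, u x i =
      a (rad x) (x 2) * er x i + c (rad x) (x 2) * eθv x i + b (rad x) (x 2) * ezv i)
    {x : X3} (hx : 0 < rad x) (hf : DifferentiableAt ℝ (meridional u) (mer x)) :
    gradSq (fun y => b (rad y) (y 2)) x ≤ 3 * ‖fderiv ℝ (meridional u) (mer x)‖ ^ 2 := by
  refine gradSq_comp_mer_le hx hf (-Complex.imCLM) (by rw [norm_neg]; exact Complex.imCLM_norm.le) ?_
  filter_upwards [continuous_rad.continuousAt.eventually (lt_mem_nhds hx)] with y hy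
  have := im_meridional hax hy (y 2)
  simp [mer, this]

lemma lintegral_comp_sqrt_sq_add_sq {F : ℝ → ℝ≥0∞} (hF : Measurable F) :
    ∫⁻ p : ℝ × ℝ, F (Real.sqrt (p.1 ^ 2 + p.2 ^ 2)) =
      ∫⁻ r in Ioi 0, ENNReal.ofReal (2 * π * r) * F r := by
  rw [← lintegral_comp_polarCoord_symm]
  have e : ∀ p ∈ polarCoord.target, ENNReal.ofReal p.1 •
      F (Real.sqrt ((polarCoord.symm p).1 ^ 2 + (polarCoord.symm p).2 ^ 2)) =
      ENNReal.ofReal p.1 * F p.1 := by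
    intro p hp
    have hp0 : 0 < p.1 := hp.1
    have : (polarCoord.symm p).1 ^ 2 + (polarCoord.symm p).2 ^ 2 = p.1 ^ 2 := by
      simp only [polarCoord_symm_apply]
      linear_combination p.1 ^ 2 * Real.sin_sq_add_cos_sq p.2
    rw [this, Real.sqrt_sq hp0.le, smul_eq_mul]
  rw [setLIntegral_congr_fun polarCoord.open_target.measurableSet e, polarCoord_target,
    Measure.volume_eq_prod, ← Measure.prod_restrict, lintegral_prod _ (by fun_prop)]
  refine lintegral_congr fun r => ?_
  simp only [lintegral_const, Measure.restrict_apply MeasurableSet.univ, univ_inter,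
    Real.volume_Ioo]
  rw [mul_right_comm, ← ENNReal.ofReal_mul' (by linarith [pi_pos])]
  congr 2
  ring

lemma lintegral_fin_three {F : X3 → ℝ≥0∞} (hF : Measurable F) :
    ∫⁻ x, F x = ∫⁻ z : ℝ, ∫⁻ p : ℝ × ℝ, F ![p.1, p.2, z] := by
  have h1 := (volume_preserving_piFinSuccAbove (fun _ : Fin 3 => ℝ) 2).symm
  have h2 := (volume_preserving_finTwoArrow ℝ).symm
  rw [← h1.lintegral_comp hF, Measure.volume_eq_prod, lintegral_prod _ (by
    exact (hF.comp h1.measurable).aemeasurable)]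
  refine lintegral_congr fun z => ?_
  rw [← h2.lintegral_comp (by exact (hF.comp h1.measurable).comp measurable_prodMk_left)]
  refine lintegral_congr fun p => ?_
  congr 1
  ext i
  fin_cases i <;> rfl

lemma lintegral_comp_mer {G : ℂ → ℝ≥0∞} (hG : Measurable G) :
    ∫⁻ x : X3, G (mer x) =
      ∫⁻ w in {w : ℂ | 0 < w.re}, ENNReal.ofReal (2 * π * w.re) * G w := by
  have hs : MeasurableSet {w : ℂ | 0 < w.re} := measurableSet_lt measurable_const Complex.measurable_re
  have hmk : Measurable fun q : ℝ × ℝ => (⟨q.1, q.2⟩ : ℂ) := continuous_complex_mk.measurable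
  have h_int : Measurable fun w : ℂ => ENNReal.ofReal (2 * π * w.re) * G w := by fun_prop
  have hsw := lintegral_lintegral_swap (μ := (volume : Measure ℝ)) (ν := (volume : Measure ℝ))
    (f := fun s t => {w : ℂ | 0 < w.re}.indicator (fun w => ENNReal.ofReal (2 * π * w.re) * G w) ⟨s, t⟩)
    (((h_int.indicator hs).comp hmk).aemeasurable)
  rw [lintegral_fin_three (F := fun x => G (mer x)) (hG.comp continuous_mer.measurable),
    ← lintegral_indicator hs, lintegral_complex_eq (h_int.indicator hs), hsw]
  refine lintegral_congr fun z => ?_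
  have := lintegral_comp_sqrt_sq_add_sq (F := fun r => G ⟨r, z⟩)
    (hG.comp (hmk.comp measurable_prodMk_right))
  rw [← lintegral_indicator measurableSet_Ioi] at this
  exact this

lemma measurable_mer : Measurable mer := continuous_mer.measurable

lemma volume_preimage_mer_eq_zero {N : Set ℂ} (hN : MeasurableSet N) (h : volume N = 0) :
    volume (mer ⁻¹' N) = 0 := by
  rw [← lintegral_indicator_one (measurable_mer hN)]
  have e : (mer ⁻¹' N).indicator (1 : X3 → ℝ≥0∞) = fun x => N.indicator 1 (mer x) := rfl
  rw [e, lintegral_comp_mer (measurable_one.indicator hN)]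
  refine (lintegral_eq_zero_iff' ?_).2 ?_
  · exact (Measurable.mul (by fun_prop) (measurable_one.indicator hN)).aemeasurable
  · refine ae_restrict_of_ae ?_
    have : ∀ᵐ w : ℂ, w ∉ N := measure_eq_zero_iff_ae_notMem.1 h
    filter_upwards [this] with w hw
    simp [hw]

lemma quasiMeasurePreserving_mer : Measure.QuasiMeasurePreserving mer volume volume :=
  ⟨measurable_mer, Measure.AbsolutelyContinuous.mk fun N hN h => by
    rw [Measure.map_apply measurable_mer hN]; exact volume_preimage_mer_eq_zero hN h⟩

lemma Ccyl_one_four : Ccyl 1 4 1 = mer ⁻¹' (Icc 1 4 ×ℂ Icc (-4) 4) := by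
  ext x
  simp [Ccyl, mer, Complex.mem_reProdIm, abs_le, and_assoc]

lemma Ccyl_two_three : Ccyl 2 3 1 = mer ⁻¹' (Icc 2 3 ×ℂ Icc (-3) 3) := by
  ext x
  simp [Ccyl, mer, Complex.mem_reProdIm, abs_le, and_assoc]

/-- The open hollow cylinder `1 < r < 4`, `|z| < 4`. -/
def openCyl : Set X3 := mer ⁻¹' openRect

lemma isOpen_openCyl : IsOpen openCyl := isOpen_openRect.preimage continuous_mer

lemma Ccyl_ae_eq_openCyl : (Ccyl 1 4 1 : Set X3) =ᵐ[volume] openCyl := by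
  rw [Ccyl_one_four]
  refine quasiMeasurePreserving_mer.preimage_ae_eq ?_
  have h : (Icc (1 : ℝ) 4 ×ˢ Icc (-4 : ℝ) 4) =ᵐ[volume.prod volume]
      (Ioo (1 : ℝ) 4 ×ˢ Ioo (-4 : ℝ) 4) :=
    Measure.set_prod_ae_eq Ioo_ae_eq_Icc.symm Ioo_ae_eq_Icc.symm
  exact Complex.volume_preserving_equiv_real_prod.quasiMeasurePreserving.preimage_ae_eq h

lemma openCyl_subset : openCyl ⊆ Ccyl 1 4 1 := by
  rw [Ccyl_one_four]
  exact preimage_mono (Complex.reProdIm_subset_iff.2 (prod_mono Ioo_subset_Icc_self Ioo_subset_Icc_self))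

lemma Ccyl_two_three_subset : Ccyl 2 3 1 ⊆ openCyl := by
  rw [Ccyl_two_three]
  refine preimage_mono (Complex.reProdIm_subset_iff.2 (prod_mono ?_ ?_))
  · exact Icc_subset_Ioo (by norm_num) (by norm_num)
  · exact Icc_subset_Ioo (by norm_num) (by norm_num)

lemma isCompact_Ccyl : IsCompact (Ccyl 1 4 1) := by
  refine Metric.isCompact_of_isClosed_isBounded ?_ ?_
  · rw [Ccyl_one_four]
    exact (isClosed_Icc.reProdIm isClosed_Icc).preimage continuous_mer
  · refine (isBounded_iff_forall_norm_le).2 ⟨4, fun x hx => ?_⟩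
    obtain ⟨-, h1, h2⟩ := hx
    rw [mul_one] at h1 h2
    have hs : rad x ^ 2 = x 0 ^ 2 + x 1 ^ 2 := Real.sq_sqrt (by positivity)
    have h0 : 0 ≤ rad x := Real.sqrt_nonneg _
    refine (pi_norm_le_iff_of_nonneg (by norm_num)).2 fun i => ?_
    rw [Real.norm_eq_abs]
    fin_cases i
    · change |x 0| ≤ 4
      exact (abs_le_of_sq_le_sq (by nlinarith [sq_nonneg (x 1)]) h0).trans h1
    · change |x 1| ≤ 4
      exact (abs_le_of_sq_le_sq (by nlinarith [sq_nonneg (x 0)]) h0).trans h1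
    · exact h2

/-- Integrals over the inner cylinder are controlled by half-plane integrals. -/
lemma setLIntegral_Ccyl_le {G : ℂ → ℝ≥0∞} (hG : Measurable G) :
    ∫⁻ x in Ccyl 2 3 1, G (mer x) ≤
      ENNReal.ofReal (6 * π) * ∫⁻ w in Icc 2 3 ×ℂ Icc (-3) 3, G w := by
  have hD : MeasurableSet (Icc 2 3 ×ℂ Icc (-3) 3 : Set ℂ) :=
    (isClosed_Icc.reProdIm isClosed_Icc).measurableSet
  rw [Ccyl_two_three, ← lintegral_indicator (measurable_mer hD)]
  have e : (mer ⁻¹' (Icc 2 3 ×ℂ Icc (-3) 3)).indicator (fun x => G (mer x)) =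
    fun x => (Icc 2 3 ×ℂ Icc (-3) 3).indicator G (mer x) := rfl
  rw [e, lintegral_comp_mer (hG.indicator hD), ← lintegral_const_mul' _ _ ENNReal.ofReal_ne_top,
    ← lintegral_indicator hD]
  refine (setLIntegral_le_lintegral _ _).trans (lintegral_mono fun w => ?_)
  by_cases hw : w ∈ (Icc 2 3 ×ℂ Icc (-3) 3 : Set ℂ)
  · simp only [indicator_of_mem hw]
    gcongr ENNReal.ofReal ?_ * _
    have : w.re ≤ 3 := hw.1.2
    nlinarith [pi_pos]
  · simp [indicator_of_notMem hw]

/-- Half-plane integrals are controlled by integrals over the outer cylinder. -/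
lemma setLIntegral_openRect_le {G : ℂ → ℝ≥0∞} (hG : Measurable (openRect.indicator G)) :
    ∫⁻ w in openRect, G w ≤ ∫⁻ x in openCyl, G (mer x) := by
  have hm := isOpen_openRect.measurableSet
  rw [openCyl, ← lintegral_indicator (measurable_mer hm), ← lintegral_indicator hm]
  have e : (mer ⁻¹' openRect).indicator (fun x => G (mer x)) =
    fun x => openRect.indicator G (mer x) := rfl
  have hs : MeasurableSet {w : ℂ | 0 < w.re} := measurableSet_lt measurable_const Complex.measurable_re
  rw [e, lintegral_comp_mer hG, ← lintegral_indicator hs]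
  refine lintegral_mono fun w => ?_
  by_cases hw : w ∈ openRect
  · have h1 : 1 < w.re := hw.1.1
    have hw' : w ∈ {w : ℂ | 0 < w.re} := lt_trans one_pos h1
    rw [indicator_of_mem hw']
    refine le_mul_of_one_le_left zero_le (ENNReal.one_le_ofReal.2 ?_)
    nlinarith [pi_gt_three]
  · simp [indicator_of_notMem hw]

lemma sq_rpow_half {s : ℝ} (hs : 0 ≤ s) (q : ℝ) : (s ^ 2) ^ (q / 2) = s ^ q := by
  rw [← Real.rpow_natCast, ← Real.rpow_mul hs]
  congr 1
  push_cast
  ring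

lemma enorm_rpow_eq_ofReal_rpow {s : ℝ} (hs : 0 ≤ s) {q : ℝ} (hq : 0 ≤ q) :
    ‖s ^ q‖ₑ = ENNReal.ofReal s ^ q := by
  rw [Real.enorm_of_nonneg (Real.rpow_nonneg hs q), ENNReal.ofReal_rpow_of_nonneg hs hq]

/-- The interior gradient estimate on a fixed time slice. -/
theorem lintegral_gradient_slice_le {q : ℝ} (hq : 1 < q) :
    ∃ C : ℝ≥0∞, C ≠ ∞ ∧ ∀ (u : X3 → X3) (a b c : ℝ → ℝ → ℝ),
      (∀ x ∈ openCyl, ContDiffAt ℝ 2 u x) → (∀ x ∈ openCyl, divg u x = 0) →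
      (∀ x, 0 < rad x → ∀ i, u x i =
        a (rad x) (x 2) * er x i + c (rad x) (x 2) * eθv x i + b (rad x) (x 2) * ezv i) →
      ∀ R : ℝ≥0∞, R = (∫⁻ x in openCyl, ‖|deriv (fun s => a (rad x) s) (x 2)
          - deriv (fun s => b s (x 2)) (rad x)| ^ q‖ₑ)
          + ∫⁻ x in openCyl, ‖(∑ i : Fin 3, (u x i) ^ 2) ^ (q / 2)‖ₑ →
      ∫⁻ x in Ccyl 2 3 1, ‖gradSq (fun y => a (rad y) (y 2)) x ^ (q / 2)‖ₑ ≤ C * R ∧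
      ∫⁻ x in Ccyl 2 3 1, ‖gradSq (fun y => b (rad y) (y 2)) x ^ (q / 2)‖ₑ ≤ C * R ∧
      ∫⁻ x in Ccyl 2 3 1, ‖|a (rad x) (x 2) / rad x| ^ q‖ₑ ≤ C * R := by
  obtain ⟨C, hC, H⟩ := setLIntegral_fderiv_rpow_le hq
  have hq0 : 0 ≤ q := by linarith
  have h2 : (2 : ℝ≥0∞) ^ q ≠ ∞ := ENNReal.rpow_ne_top_of_nonneg hq0 (by simp)
  set κ : ℝ≥0∞ := ENNReal.ofReal (3 ^ (q / 2)) with hκ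
  set D : ℝ≥0∞ := κ * (ENNReal.ofReal (6 * π) * (C * (2 ^ q + 2 ^ q + 1))) with hDdef
  have hDt : D ≠ ∞ := ENNReal.mul_ne_top ENNReal.ofReal_ne_top (ENNReal.mul_ne_top
    ENNReal.ofReal_ne_top (ENNReal.mul_ne_top hC (ENNReal.add_ne_top.2
      ⟨ENNReal.add_ne_top.2 ⟨h2, h2⟩, ENNReal.one_ne_top⟩)))
  refine ⟨D + 1, ENNReal.add_ne_top.2 ⟨hDt, ENNReal.one_ne_top⟩,
    fun u a b c hu hd hax R hR => ?_⟩
  set f := meridional u with hfdef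
  set P := ∫⁻ x in openCyl, ‖|deriv (fun s => a (rad x) s) (x 2)
          - deriv (fun s => b s (x 2)) (rad x)| ^ q‖ₑ with hP
  set Q := ∫⁻ x in openCyl, ‖(∑ i : Fin 3, (u x i) ^ 2) ^ (q / 2)‖ₑ with hQ
  have hhalf : ∀ w ∈ openRect, halfEmb w ∈ openCyl := by
    intro w hw
    change mer (halfEmb w) ∈ openRect
    rwa [mer_halfEmb (by linarith [hw.1.1])]
  have hfs : ∀ w ∈ openRect, ContDiffAt ℝ 2 f w := fun w hw =>
    contDiffAt_meridional (hu _ (hhalf w hw))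
  have hfc : ContinuousOn f openRect := fun w hw => (hfs w hw).continuousAt.continuousWithinAt
  have hmO := isOpen_openCyl.measurableSet
  have hmR := isOpen_openRect.measurableSet
  have hpow : ∀ w, ‖f w‖ₑ ^ q = ENNReal.ofReal (‖f w‖ ^ q) := fun w => by
    rw [← ofReal_norm, ENNReal.ofReal_rpow_of_nonneg (norm_nonneg _) hq0]
  have hfQ : ∫⁻ x in openCyl, ‖f (mer x)‖ₑ ^ q ≤ Q := by
    refine setLIntegral_mono' hmO fun x hx => ?_
    rw [hpow, Real.enorm_of_nonneg (by positivity), ← sq_rpow_half (norm_nonneg _)]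
    have := norm_meridional_sq_le hax (rad_pos_of_mer_mem hx)
    gcongr
  have hfR : ∫⁻ w in openRect, ‖f w‖ₑ ^ q ≤ Q := by
    refine (setLIntegral_openRect_le ?_).trans hfQ
    have hcont : ContinuousOn (fun w => ‖f w‖ₑ ^ q) openRect :=
      ENNReal.continuous_rpow_const.comp_continuousOn hfc.enorm
    classical
    rw [← piecewise_eq_indicator]
    exact hcont.measurable_piecewise continuousOn_const hmR
  have hbar : ∫⁻ w in openRect, ‖wirtBar f w‖ₑ ^ q ≤ 2 ^ q * (P + Q) := by
    refine (setLIntegral_openRect_le ((measurable_wirtBar.enorm.pow_const q).indicator hmR)).trans ?_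
    have hmf : AEMeasurable (fun x => ‖f (mer x)‖ₑ ^ q) (volume.restrict openCyl) := by
      refine ContinuousOn.aemeasurable ?_ hmO
      exact ENNReal.continuous_rpow_const.comp_continuousOn
        (hfc.comp continuous_mer.continuousOn fun x hx => hx).enorm
    calc _ ≤ ∫⁻ x in openCyl, 2 ^ q * (‖|deriv (fun s => a (rad x) s) (x 2)
          - deriv (fun s => b s (x 2)) (rad x)| ^ q‖ₑ + ‖f (mer x)‖ₑ ^ q) := by
          refine setLIntegral_mono' hmO fun x hx => ?_
          have hx1 : 1 ≤ rad x := hx.1.1.le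
          have hmem : halfEmb (mer x) ∈ openCyl := hhalf _ hx
          have hle := norm_wirtBar_meridional_le hax hx1
            ((hu _ hmem).differentiableAt (by norm_num)) (hd _ hmem)
          have hle' : ‖wirtBar f (mer x)‖ₑ ≤ ENNReal.ofReal |deriv (fun s => a (rad x) s) (x 2)
              - deriv (fun s => b s (x 2)) (rad x)| + ‖f (mer x)‖ₑ := by
            rw [← ofReal_norm, ← ofReal_norm,
              ← ENNReal.ofReal_add (abs_nonneg _) (norm_nonneg _)]
            exact ENNReal.ofReal_le_ofReal hle
          rw [enorm_rpow_eq_ofReal_rpow (abs_nonneg _) hq0]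
          exact (ENNReal.rpow_le_rpow hle' hq0).trans (rpow_add_le_two_mul hq _ _)
      _ = 2 ^ q * (P + ∫⁻ x in openCyl, ‖f (mer x)‖ₑ ^ q) := by
          rw [lintegral_const_mul' _ _ h2, lintegral_add_right' _ hmf]
      _ ≤ _ := by gcongr
  have hmain : ∫⁻ x in Ccyl 2 3 1, κ * ‖fderiv ℝ f (mer x)‖ₑ ^ q ≤ (D + 1) * R := by
    rw [lintegral_const_mul' _ _ ENNReal.ofReal_ne_top]
    calc _ ≤ κ * (ENNReal.ofReal (6 * π) * (C * (2 ^ q * (P + Q) + Q))) := by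
          gcongr
          refine (setLIntegral_Ccyl_le (G := fun w => ‖fderiv ℝ f w‖ₑ ^ q)
            ((measurable_fderiv ℝ f).enorm.pow_const q)).trans ?_
          gcongr
          exact (H f hfs).trans (by gcongr)
      _ ≤ κ * (ENNReal.ofReal (6 * π) * (C * ((2 ^ q + 2 ^ q + 1) * (P + Q)))) := by
          gcongr
          calc 2 ^ q * (P + Q) + Q ≤ 2 ^ q * (P + Q) + (2 ^ q + 1) * (P + Q) := by
                gcongr
                exact le_add_self.trans (le_mul_of_one_le_left zero_le le_add_self)
            _ = _ := by ring
      _ = D * R := by rw [hR, hDdef]; ring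
      _ ≤ _ := by gcongr; exact le_self_add
  have hC23 : MeasurableSet (Ccyl 2 3 1) := by
    rw [Ccyl_two_three]
    exact measurable_mer (isClosed_Icc.reProdIm isClosed_Icc).measurableSet
  have hgrad : ∀ (g : X3 → ℝ) (x : X3), gradSq g x ≤ 3 * ‖fderiv ℝ f (mer x)‖ ^ 2 →
      ‖gradSq g x ^ (q / 2)‖ₑ ≤ κ * ‖fderiv ℝ f (mer x)‖ₑ ^ q := by
    intro g x hg
    have h0 : 0 ≤ gradSq g x := Finset.sum_nonneg fun i _ => sq_nonneg _
    rw [Real.enorm_of_nonneg (by positivity), ← ofReal_norm,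
      ENNReal.ofReal_rpow_of_nonneg (norm_nonneg _) hq0, hκ, ← ENNReal.ofReal_mul (by positivity),
      ← sq_rpow_half (norm_nonneg _), ← Real.mul_rpow (by norm_num) (by positivity)]
    gcongr
  refine ⟨(setLIntegral_mono' hC23 fun x hx => hgrad _ x ?_).trans hmain,
    (setLIntegral_mono' hC23 fun x hx => hgrad _ x ?_).trans hmain, ?_⟩
  · have hx' := Ccyl_two_three_subset hx
    exact gradSq_radial_le hax (rad_pos_of_mer_mem hx') ((hfs _ hx').differentiableAt (by norm_num))
  · have hx' := Ccyl_two_three_subset hx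
    exact gradSq_vertical_le hax (rad_pos_of_mer_mem hx') ((hfs _ hx').differentiableAt (by norm_num))
  · calc _ ≤ ∫⁻ x in Ccyl 2 3 1, ‖f (mer x)‖ₑ ^ q := by
          refine setLIntegral_mono' hC23 fun x hx => ?_
          have hx' := Ccyl_two_three_subset hx
          rw [hpow, Real.enorm_of_nonneg (by positivity)]
          have := abs_div_rad_le hax (x := x) hx'.1.1.le
          gcongr
      _ ≤ ∫⁻ x in openCyl, ‖f (mer x)‖ₑ ^ q := lintegral_mono_set Ccyl_two_three_subset
      _ ≤ Q := hfQ
      _ ≤ R := by rw [hR]; exact le_add_self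
      _ ≤ _ := le_mul_of_one_le_left zero_le le_add_self

/-- A `C¹` function on a compact set has bounded derivative on the interior. -/
lemma IsCompact.exists_norm_fderiv_le {E F : Type*} [NormedAddCommGroup E] [NormedSpace ℝ E]
    [NormedAddCommGroup F] [NormedSpace ℝ F] {S : Set E} (hS : IsCompact S) {V : E → F}
    (hV : ContDiffOn ℝ 1 V S) : ∃ M, ∀ y ∈ interior S, ‖fderiv ℝ V y‖ ≤ M := by
  have key : ∃ M, ∀ y ∈ S ∩ interior S, ‖fderiv ℝ V y‖ ≤ M := by
    refine hS.induction_on (p := fun s => ∃ M, ∀ y ∈ s ∩ interior S, ‖fderiv ℝ V y‖ ≤ M)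
      ⟨0, by simp⟩ ?_ ?_ ?_
    · rintro s t hst ⟨M, hM⟩
      exact ⟨M, fun y hy => hM y ⟨hst hy.1, hy.2⟩⟩
    · rintro s t ⟨M, hM⟩ ⟨N, hN⟩
      refine ⟨max M N, fun y hy => ?_⟩
      rcases hy.1 with h | h
      · exact (hM y ⟨h, hy.2⟩).trans (le_max_left _ _)
      · exact (hN y ⟨h, hy.2⟩).trans (le_max_right _ _)
    · intro x hx
      have h1 : ContDiffWithinAt ℝ (0 + 1) V S x := by rw [zero_add]; exact hV x hx
      obtain ⟨u, hu, -, V', hV', hc⟩ :=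
        (contDiffWithinAt_succ_iff_hasFDerivWithinAt (by simp)).1 h1
      rw [insert_eq_of_mem hx] at hu
      have hb : ∀ᶠ y in nhdsWithin x u, ‖V' y‖ < ‖V' x‖ + 1 :=
        hc.continuousWithinAt.norm.eventually_lt_const (lt_add_one _)
      have hb' : ∀ᶠ y in nhdsWithin x S, ‖V' y‖ < ‖V' x‖ + 1 := nhdsWithin_le_of_mem hu hb
      obtain ⟨O, hO, hxO, hOu⟩ := mem_nhdsWithin.1 hu
      refine ⟨{y | ‖V' y‖ < ‖V' x‖ + 1} ∩ O,
        Filter.inter_mem hb' (mem_nhdsWithin_of_mem_nhds (hO.mem_nhds hxO)), ‖V' x‖ + 1, ?_⟩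
      rintro y ⟨⟨hy, hyO⟩, hyS⟩
      have hun : u ∈ nhds y := Filter.mem_of_superset
        (Filter.inter_mem (hO.mem_nhds hyO) (isOpen_interior.mem_nhds hyS))
        fun w hw => hOu ⟨hw.1, interior_subset hw.2⟩
      rw [((hV' y (mem_of_mem_nhds hun)).hasFDerivAt hun).fderiv]
      exact le_of_lt hy
  obtain ⟨M, hM⟩ := key
  exact ⟨M, fun y hy => hM y ⟨interior_subset hy, hy⟩⟩

lemma openCyl_prod_subset_interior (T : ℝ) :
    openCyl ×ˢ Ioo (-T) T ⊆ interior (Ccyl 1 4 1 ×ˢ Icc (-T) T) :=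
  interior_maximal (prod_mono openCyl_subset Ioo_subset_Icc_self)
    (isOpen_openCyl.prod isOpen_Ioo)

lemma contDiffAt_of_smoothVF {v : X3 → ℝ → X3} {T : ℝ}
    (hv : SmoothVF v (Ccyl 1 4 1 ×ˢ Icc (-T) T)) {x : X3} (hx : x ∈ openCyl) {t : ℝ}
    (ht : t ∈ Ioo (-T) T) : ContDiffAt ℝ 2 (fun q : X3 × ℝ => v q.1 q.2) (x, t) := by
  have h := hv.contDiffAt (mem_interior_iff_mem_nhds.1
    (openCyl_prod_subset_interior T (mk_mem_prod hx ht)))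
  exact h.of_le (WithTop.coe_le_coe.2 le_top)

lemma pd_slice {v : X3 → ℝ → X3} {x : X3} {t : ℝ}
    (h : DifferentiableAt ℝ (fun q : X3 × ℝ => v q.1 q.2) (x, t)) (i j : Fin 3) :
    pd i (fun y => v y t j) x =
      fderiv ℝ (fun q : X3 × ℝ => v q.1 q.2) (x, t) (Pi.single i 1, 0) j := by
  have h1 : HasFDerivAt (fun y => v y t) ((fderiv ℝ (fun q : X3 × ℝ => v q.1 q.2) (x, t)).comp
      (ContinuousLinearMap.inl ℝ X3 ℝ)) x :=
    HasFDerivAt.comp (g := fun q : X3 × ℝ => v q.1 q.2) (f := fun y : X3 => (y, t))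
      x h.hasFDerivAt (hasFDerivAt_prodMk_left x t)
  have h2 := (hasFDerivAt_pi'.1 h1) j
  rw [pd, h2.fderiv]
  simp

/-- A globally measurable version of `ω_θ`. -/
def omθMeas (v : X3 → ℝ → X3) (q : X3 × ℝ) : ℝ :=
  fderiv ℝ (fun q : X3 × ℝ => v q.1 q.2) (halfEmb (mer q.1), q.2) (Pi.single 2 1, 0) 0
    - fderiv ℝ (fun q : X3 × ℝ => v q.1 q.2) (halfEmb (mer q.1), q.2) (Pi.single 0 1, 0) 2

lemma measurable_omθMeas (v : X3 → ℝ → X3) : Measurable (omθMeas v) := by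
  have hm : Measurable fun q : X3 × ℝ => (halfEmb (mer q.1), q.2) :=
    ((contDiff_halfEmb (n := 0)).continuous.measurable.comp
      (measurable_mer.comp measurable_fst)).prodMk measurable_snd
  have h : ∀ (e : X3 × ℝ) (i : Fin 3), Measurable fun q : X3 × ℝ =>
      fderiv ℝ (fun q : X3 × ℝ => v q.1 q.2) (halfEmb (mer q.1), q.2) e i := fun e i =>
    (measurable_pi_apply i).comp ((measurable_fderiv_apply_const ℝ _ e).comp hm)
  exact (h _ _).sub (h _ _)

lemma halfEmb_mer_mem {x : X3} (hx : x ∈ openCyl) : halfEmb (mer x) ∈ openCyl := by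
  change mer (halfEmb (mer x)) ∈ openRect
  rwa [mer_halfEmb (Real.sqrt_nonneg _ : 0 ≤ (mer x).re)]

lemma omθ_eq_omθMeas {v : X3 → ℝ → X3} {vr vθ vz : Prof} {T : ℝ}
    (hv : SmoothVF v (Ccyl 1 4 1 ×ˢ Icc (-T) T)) (hax : IsAxisym v vr vθ vz)
    {x : X3} (hx : x ∈ openCyl) {t : ℝ} (ht : t ∈ Ioo (-T) T) :
    omθ vr vz (rad x) (x 2) t = omθMeas v (x, t) := by
  have hcd := (contDiffAt_of_smoothVF hv (halfEmb_mer_mem hx) ht).differentiableAt (by norm_num)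
  have hu : DifferentiableAt ℝ (fun y => v y t) (halfEmb (mer x)) :=
    DifferentiableAt.comp (g := fun q : X3 × ℝ => v q.1 q.2) (f := fun y : X3 => (y, t)) _ hcd (by fun_prop)
  have hp := profile_derivs (u := fun y => v y t) (a := fun r z => vr r z t)
    (b := fun r z => vz r z t) (c := fun r z => vθ r z t) (fun x hx => hax x t hx)
    (rad_pos_of_mer_mem hx) (x 2) hu
  have e1 : pdz vr (rad x) (x 2) t = _ := hp.1
  have e2 : pdr vz (rad x) (x 2) t = _ := hp.2
  rw [omθ, e1, e2]
  exact congrArg₂ (· - ·) (pd_slice hcd 2 0) (pd_slice hcd 0 2)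

lemma volume_openCyl_prod_ne_top (T : ℝ) : volume (openCyl ×ˢ Ioo (-T) T) ≠ ∞ :=
  ((measure_mono ((openCyl_prod_subset_interior T).trans interior_subset)).trans_lt
    (isCompact_Ccyl.prod isCompact_Icc).measure_lt_top).ne

lemma integrableOn_omθ {q : ℝ} (hq : 0 ≤ q) {v : X3 → ℝ → X3} {vr vθ vz : Prof} {T : ℝ}
    (hv : SmoothVF v (Ccyl 1 4 1 ×ˢ Icc (-T) T)) (hax : IsAxisym v vr vθ vz) :
    IntegrableOn (fun p : X3 × ℝ => |omθ vr vz (rad p.1) (p.1 2) p.2| ^ q)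
      (openCyl ×ˢ Ioo (-T) T) := by
  have hms : MeasurableSet (openCyl ×ˢ Ioo (-T) T) := (isOpen_openCyl.prod isOpen_Ioo).measurableSet
  obtain ⟨M, hM⟩ := (isCompact_Ccyl.prod isCompact_Icc).exists_norm_fderiv_le
    (hv.of_le (by exact_mod_cast le_top))
  have h : IntegrableOn (fun p : X3 × ℝ => |omθMeas v p| ^ q) (openCyl ×ˢ Ioo (-T) T) := by
    set K := M * ‖((Pi.single 2 1, 0) : X3 × ℝ)‖ + M * ‖((Pi.single 0 1, 0) : X3 × ℝ)‖
    refine Measure.integrableOn_of_bounded (M := K ^ q) (volume_openCyl_prod_ne_top T)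
      ((measurable_omθMeas v).abs.pow_const q).aestronglyMeasurable ?_
    filter_upwards [ae_restrict_mem hms] with p hp
    rw [Real.norm_of_nonneg (by positivity)]
    refine Real.rpow_le_rpow (abs_nonneg _) ?_ hq
    have hb := hM (halfEmb (mer p.1), p.2)
      (openCyl_prod_subset_interior T (mk_mem_prod (halfEmb_mer_mem hp.1) hp.2))
    have hc : ∀ (e : X3 × ℝ) (i : Fin 3),
        |fderiv ℝ (fun q : X3 × ℝ => v q.1 q.2) (halfEmb (mer p.1), p.2) e i| ≤ M * ‖e‖ :=
      fun e i => (norm_le_pi_norm _ i).trans (ContinuousLinearMap.le_of_opNorm_le _ hb e)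
    exact (abs_sub _ _).trans (add_le_add (hc _ _) (hc _ _))
  refine h.congr_fun (fun p hp => ?_) hms
  simp only [omθ_eq_omθMeas hv hax hp.1 hp.2]

lemma integrableOn_sum_sq {q : ℝ} (hq : 0 ≤ q) {v : X3 → ℝ → X3} {T : ℝ}
    (hv : SmoothVF v (Ccyl 1 4 1 ×ˢ Icc (-T) T)) :
    IntegrableOn (fun p : X3 × ℝ => (∑ i : Fin 3, (v p.1 p.2 i) ^ 2) ^ (q / 2))
      (openCyl ×ˢ Ioo (-T) T) := by
  have hc : ContinuousOn (fun p : X3 × ℝ => (∑ i : Fin 3, (v p.1 p.2 i) ^ 2) ^ (q / 2))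
      (Ccyl 1 4 1 ×ˢ Icc (-T) T) := by
    refine ContinuousOn.rpow_const ?_ fun p hp => Or.inr (by positivity)
    exact continuousOn_finsetSum _ fun i _ => ((continuousOn_pi.1 hv.continuousOn) i).pow 2
  exact (hc.integrableOn_compact (isCompact_Ccyl.prod isCompact_Icc)).mono_set
    ((openCyl_prod_subset_interior T).trans interior_subset)

lemma setIntegral_Ccyl_eq (f : X3 → ℝ) :
    ∫ x in Ccyl 1 4 1, f x = ∫ x in openCyl, f x :=
  setIntegral_congr_set Ccyl_ae_eq_openCyl

lemma slice_integrable {f : X3 × ℝ → ℝ} {T : ℝ}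
    (hf : IntegrableOn f (openCyl ×ˢ Ioo (-T) T)) :
    IntegrableOn (fun t => ∫ x in openCyl, f (x, t)) (Ioo (-T) T) ∧
      ∀ᵐ t ∂volume.restrict (Ioo (-T) T), IntegrableOn (fun x => f (x, t)) openCyl := by
  rw [IntegrableOn, Measure.volume_eq_prod, ← Measure.prod_restrict] at hf
  exact ⟨hf.integral_prod_right, hf.prod_left_ae⟩

lemma integral_le_of_lintegral_enorm_le {α β : Type*} [MeasurableSpace α] [MeasurableSpace β]
    {μ : Measure α} {ν : Measure β} {f : α → ℝ} {P Q : β → ℝ} {C : ℝ≥0∞} (hC : C ≠ ∞)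
    (hP : Integrable P ν) (hQ : Integrable Q ν) (hP0 : ∀ x, 0 ≤ P x) (hQ0 : ∀ x, 0 ≤ Q x)
    (h : ∫⁻ x, ‖f x‖ₑ ∂μ ≤ C * ((∫⁻ x, ‖P x‖ₑ ∂ν) + ∫⁻ x, ‖Q x‖ₑ ∂ν)) :
    ∫ x, f x ∂μ ≤ C.toReal * (∫ x, P x ∂ν + ∫ x, Q x ∂ν) := by
  have e : ∀ {P : β → ℝ}, Integrable P ν → (∀ x, 0 ≤ P x) →
      ∫⁻ x, ‖P x‖ₑ ∂ν = ENNReal.ofReal (∫ x, P x ∂ν) := fun {P} hP h0 => by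
    rw [← ofReal_integral_norm_eq_lintegral_enorm hP]
    simp only [Real.norm_of_nonneg (h0 _)]
  rw [e hP hP0, e hQ hQ0, ← ENNReal.ofReal_add (integral_nonneg hP0) (integral_nonneg hQ0),
    ← ENNReal.ofReal_toReal hC, ← ENNReal.ofReal_mul ENNReal.toReal_nonneg] at h
  have h2 := (enorm_integral_le_lintegral_enorm f).trans h
  rw [← ofReal_norm, ENNReal.ofReal_le_ofReal_iff (mul_nonneg ENNReal.toReal_nonneg
    (add_nonneg (integral_nonneg hP0) (integral_nonneg hQ0)))] at h2
  exact (Real.le_norm_self _).trans h2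

lemma rpow_integral_le {C p : ℝ} (hC : 0 ≤ C) (hp : 0 ≤ p) (hp1 : p ≤ 1) {μ : Measure ℝ}
    {X P Q : ℝ → ℝ} (hP : Integrable P μ) (hQ : Integrable Q μ) (hX0 : ∀ t, 0 ≤ X t)
    (hP0 : ∀ t, 0 ≤ P t) (hQ0 : ∀ t, 0 ≤ Q t) (h : ∀ᵐ t ∂μ, X t ≤ C * (P t + Q t)) :
    (∫ t, X t ∂μ) ^ p ≤ C ^ p * ((∫ t, P t ∂μ) ^ p + (∫ t, Q t ∂μ) ^ p) := by
  have hm := integral_mono_of_nonneg (.of_forall hX0) ((hP.add hQ).const_mul C) h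
  have e : ∫ t, C * (P + Q) t ∂μ = C * (∫ t, P t ∂μ + ∫ t, Q t ∂μ) := by
    rw [integral_const_mul, integral_add' hP hQ]
  rw [e] at hm
  have i1 := integral_nonneg (μ := μ) (f := P) hP0
  have i2 := integral_nonneg (μ := μ) (f := Q) hQ0
  calc _ ≤ _ := Real.rpow_le_rpow (integral_nonneg hX0) hm hp
    _ = C ^ p * (∫ t, P t ∂μ + ∫ t, Q t ∂μ) ^ p := Real.mul_rpow hC (add_nonneg i1 i2)
    _ ≤ _ := by gcongr; exact Real.rpow_add_le_add_rpow i1 i2 hp hp1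

lemma gradSq_nonneg (g : X3 → ℝ) (x : X3) : 0 ≤ gradSq g x :=
  Finset.sum_nonneg fun _ _ => sq_nonneg _

/-- Lemma 4.2: `L^q` bounds on `∇v_r`, `v_r/r`, `∇v_z` for
divergence-free axis symmetric fields. -/
theorem axisym_gradient_Lq_bound (q : ℝ) (hq : 1 < q) :
    ∃ c : ℝ, 0 < c ∧
      ∀ (T : ℝ) (v : X3 → ℝ → X3) (vr vθ vz : Prof),
        0 < T →
        SmoothVF v (Ccyl 1 4 1 ×ˢ Icc (-T) T) →
        (∀ x ∈ Ccyl 1 4 1, ∀ t ∈ Icc (-T) T, divg (fun y => v y t) x = 0) →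
        IsAxisym v vr vθ vz →
        (∫ t in Icc (-T) T, ∫ x in Ccyl 2 3 1,
              (gradSq (fun y => vr (rad y) (y 2) t) x) ^ (q/2)) ^ (1/q)
          + (∫ t in Icc (-T) T, ∫ x in Ccyl 2 3 1,
              |vr (rad x) (x 2) t / rad x| ^ q) ^ (1/q)
          + (∫ t in Icc (-T) T, ∫ x in Ccyl 2 3 1,
              (gradSq (fun y => vz (rad y) (y 2) t) x) ^ (q/2)) ^ (1/q) ≤
          c * ((∫ t in Icc (-T) T, ∫ x in Ccyl 1 4 1,
                  |omθ vr vz (rad x) (x 2) t| ^ q) ^ (1/q)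
              + (∫ t in Icc (-T) T, ∫ x in Ccyl 1 4 1,
                  (∑ i : Fin 3, (v x t i)^2) ^ (q/2)) ^ (1/q)) := by
  obtain ⟨C, hC, key⟩ := lintegral_gradient_slice_le hq
  have hq0 : 0 ≤ q := by linarith
  have hC0 : 0 ≤ C.toReal := ENNReal.toReal_nonneg
  refine ⟨3 * C.toReal ^ (1 / q) + 1, by positivity, fun T v vr vθ vz _ hv hdiv hax => ?_⟩
  simp only [setIntegral_Ccyl_eq, integral_Icc_eq_integral_Ioo]
  obtain ⟨hP, hP'⟩ := slice_integrable (integrableOn_omθ hq0 hv hax)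
  obtain ⟨hQ, hQ'⟩ := slice_integrable (integrableOn_sum_sq hq0 hv)
  dsimp only at hP hP' hQ hQ'
  have hP0 : ∀ (t : ℝ) (x : X3), 0 ≤ |omθ vr vz (rad x) (x 2) t| ^ q := fun t x => by positivity
  have hQ0 : ∀ (t : ℝ) (x : X3), 0 ≤ (∑ i : Fin 3, (v x t i) ^ 2) ^ (q / 2) :=
    fun t x => by positivity
  have hslice : ∀ᵐ t ∂volume.restrict (Ioo (-T) T), ∀ N : ℝ,
      N = C.toReal * ((∫ x in openCyl, |omθ vr vz (rad x) (x 2) t| ^ q) +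
        ∫ x in openCyl, (∑ i : Fin 3, (v x t i) ^ 2) ^ (q / 2)) →
      (∫ x in Ccyl 2 3 1, gradSq (fun y => vr (rad y) (y 2) t) x ^ (q / 2)) ≤ N ∧
      (∫ x in Ccyl 2 3 1, gradSq (fun y => vz (rad y) (y 2) t) x ^ (q / 2)) ≤ N ∧
      (∫ x in Ccyl 2 3 1, |vr (rad x) (x 2) t / rad x| ^ q) ≤ N := by
    filter_upwards [hP', hQ', ae_restrict_mem measurableSet_Ioo] with t htP htQ ht
    obtain ⟨k1, k2, k3⟩ := key (fun y => v y t) (fun r z => vr r z t) (fun r z => vz r z t)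
      (fun r z => vθ r z t)
      (fun x hx => (contDiffAt_of_smoothVF hv hx ht).comp (f := fun y : X3 => (y, t)) x
        (contDiffAt_id.prodMk contDiffAt_const))
      (fun x hx => hdiv x (openCyl_subset hx) t (Ioo_subset_Icc_self ht))
      (fun x hx => hax x t hx) _ rfl
    rintro _ rfl
    exact ⟨integral_le_of_lintegral_enorm_le hC htP htQ (hP0 t) (hQ0 t) k1,
      integral_le_of_lintegral_enorm_le hC htP htQ (hP0 t) (hQ0 t) k2,
      integral_le_of_lintegral_enorm_le hC htP htQ (hP0 t) (hQ0 t) k3⟩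
  have hp : 0 ≤ 1 / q := by positivity
  have hp1 : 1 / q ≤ 1 := (div_le_one (by linarith)).2 hq.le
  have hPi : ∀ t, 0 ≤ ∫ x in openCyl, |omθ vr vz (rad x) (x 2) t| ^ q :=
    fun t => integral_nonneg (hP0 t)
  have hQi : ∀ t, 0 ≤ ∫ x in openCyl, (∑ i : Fin 3, (v x t i) ^ 2) ^ (q / 2) :=
    fun t => integral_nonneg (hQ0 t)
  have main := fun (X : ℝ → ℝ) (hX : ∀ t, 0 ≤ X t) =>
    rpow_integral_le (X := X) hC0 hp hp1 hP hQ hX hPi hQi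
  have m1 := main _ (fun t => integral_nonneg fun x =>
    Real.rpow_nonneg (gradSq_nonneg _ x) _) (hslice.mono fun t h => (h _ rfl).1)
  have m2 := main _ (fun t => integral_nonneg fun x =>
    Real.rpow_nonneg (abs_nonneg _) _) (hslice.mono fun t h => (h _ rfl).2.2)
  have m3 := main _ (fun t => integral_nonneg fun x =>
    Real.rpow_nonneg (gradSq_nonneg _ x) _) (hslice.mono fun t h => (h _ rfl).2.1)
  have hS := add_nonneg (Real.rpow_nonneg (integral_nonneg (μ := volume.restrict (Ioo (-T) T)) hPi)
    (1 / q)) (Real.rpow_nonneg (integral_nonneg (μ := volume.restrict (Ioo (-T) T)) hQi) (1 / q))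
  linarith

end
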